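/- Let D be a compact subset of ℝ² with nonempty interior. Then D is homeomorphic to the closed two-dimensional disk if and only if: (1) int D is connected; (2) ℝ² \ D is connected; (3) every point of ∂D is accessible from int D; and (4) every point of ∂D is accessible from ℝ² \ D. -/

import Mathlib

open Metric Set

/-- The plane `ℝ²`. -/
abbrev Plane := EuclideanSpace ℝ (Fin 2)

/-- A point `x` is accessible from a set `E` if there is a continuous injective map
`φ : [0,1] → ℝ²` with `φ 1 = x` and `φ([0,1)) ⊆ E`. -/
def Accessible (E : Set Plane) (x : Plane) : Prop :=
  ∃ φ : ℝ → Plane, ContinuousOn φ (Icc 0 1) ∧ InjOn φ (Icc 0 1) ∧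
    φ 1 = x ∧ φ '' Ico 0 1 ⊆ E

namespace PlaneTopology

open Filter Topology

/-- `K` does not separate `p` from `q`. -/
def Unsep (K : Set ℂ) (p q : ℂ) : Prop :=
  ∃ C : Set ℂ, IsPreconnected C ∧ p ∈ C ∧ q ∈ C ∧ Disjoint C K

section Logarithms

lemma isCoveringMap_exp :
    IsCoveringMap fun z : ℂ ↦ (⟨_, z.exp_ne_zero⟩ : {z : ℂ // z ≠ 0}) :=
  Complex.isCoveringMap_exp

/-- Homotopy lifting for `exp` on an arbitrary set. -/
lemma exists_log_of_homotopy {X : Type*} [TopologicalSpace X] (H : unitInterval × X → ℂ)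
    (hH : Continuous H) (h0 : ∀ x, H x ≠ 0) (f : X → ℂ) (hf : Continuous f)
    (hfH : ∀ x, H (0, x) = Complex.exp (f x)) :
    ∃ g : X → ℂ, Continuous g ∧ ∀ x, Complex.exp (g x) = H (1, x) := by
  let H' : C(unitInterval × X, {z : ℂ // z ≠ 0}) := ⟨fun x ↦ ⟨H x, h0 x⟩, by fun_prop⟩
  let f' : C(X, ℂ) := ⟨f, hf⟩
  have key : ∀ a, H' (0, a) = (fun z : ℂ ↦ (⟨_, z.exp_ne_zero⟩ : {z : ℂ // z ≠ 0})) (f' a) :=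
    fun a ↦ Subtype.ext (hfH a)
  refine ⟨fun x ↦ isCoveringMap_exp.liftHomotopy H' f' key (1, x), by fun_prop, fun x ↦ ?_⟩
  have := congrFun (isCoveringMap_exp.liftHomotopy_lifts H' f' key) (1, x)
  exact congrArg Subtype.val this

lemma exists_continuousOn_extend {X Y : Type*} [TopologicalSpace X] [TopologicalSpace Y]
    [Nonempty Y] {S : Set X} (g : S → Y) (hg : Continuous g) :
    ∃ G : X → Y, ContinuousOn G S ∧ ∀ x : S, G x = g x := by
  classical
  have key : ∀ x : S, (fun x ↦ if h : x ∈ S then g ⟨x, h⟩ else Classical.arbitrary Y) x = g x := by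
    intro x
    simp
  refine ⟨fun x ↦ if h : x ∈ S then g ⟨x, h⟩ else Classical.arbitrary Y, ?_, key⟩
  rw [continuousOn_iff_continuous_domRestrict]
  convert hg using 1
  ext x
  exact key x

lemma exists_log_of_path {p q : ℂ} (γ : Path q p) {S : Set ℂ} (h : ∀ t, γ t ∉ S) :
    ∃ g : ℂ → ℂ, ContinuousOn g S ∧ ∀ z ∈ S, z - p = (z - q) * Complex.exp (g z) := by
  have hq : ∀ z ∈ S, z - q ≠ 0 := fun z hz h0 ↦ by
    have := h 0
    rw [γ.source, ← sub_eq_zero.1 h0] at this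
    exact this hz
  obtain ⟨g, hg, hge⟩ := exists_log_of_homotopy (X := S)
    (fun x ↦ ((x.2 : ℂ) - γ x.1) / ((x.2 : ℂ) - q))
    (Continuous.div (by fun_prop) (by fun_prop) fun x ↦ hq _ x.2.2)
    (fun x ↦ div_ne_zero (fun h0 ↦ h x.1 (sub_eq_zero.1 h0 ▸ x.2.2)) (hq _ x.2.2))
    (fun _ ↦ 0) continuous_const (fun x ↦ by simp [div_self (hq _ x.2)])
  obtain ⟨G, hG, hGg⟩ := exists_continuousOn_extend g hg
  refine ⟨G, hG, fun z hz ↦ ?_⟩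
  rw [hGg ⟨z, hz⟩, hge]
  have := hq z hz
  simp only [γ.target]
  field_simp

lemma exists_log_of_convex {E : Type*} [NormedAddCommGroup E] [NormedSpace ℝ E] {C : Set E}
    (hC : Convex ℝ C) {f : E → ℂ} (hf : ContinuousOn f C) (h0 : ∀ x ∈ C, f x ≠ 0) :
    ∃ g : E → ℂ, ContinuousOn g C ∧ ∀ x ∈ C, f x = Complex.exp (g x) := by
  rcases C.eq_empty_or_nonempty with rfl | ⟨x₀, hx₀⟩
  · exact ⟨0, by simp, by simp⟩
  have hmem : ∀ x : unitInterval × C, x₀ + (x.1 : ℝ) • ((x.2 : E) - x₀) ∈ C := fun x ↦ by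
    have := hC hx₀ x.2.2 (sub_nonneg.2 x.1.2.2) x.1.2.1 (by ring)
    convert this using 1
    module
  obtain ⟨g, hg, hge⟩ := exists_log_of_homotopy (X := C)
    (fun x ↦ f (x₀ + (x.1 : ℝ) • ((x.2 : E) - x₀)))
    (hf.comp_continuous (by fun_prop) hmem) (fun x ↦ h0 _ (hmem x))
    (fun _ ↦ Complex.log (f x₀)) continuous_const
    (fun x ↦ by simp [Complex.exp_log (h0 _ hx₀)])
  obtain ⟨G, hG, hGg⟩ := exists_continuousOn_extend g hg
  exact ⟨G, hG, fun z hz ↦ by rw [hGg ⟨z, hz⟩, hge]; simp⟩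

/-- Two logarithms of the same function differ by a constant on a preconnected set. -/
lemma sub_eq_sub_of_exp_eq {X : Type*} [TopologicalSpace X] {S : Set X} (hS : IsPreconnected S)
    {u v : X → ℂ} (hu : ContinuousOn u S) (hv : ContinuousOn v S)
    (h : ∀ z ∈ S, Complex.exp (u z) = Complex.exp (v z)) {z w : X} (hz : z ∈ S) (hw : w ∈ S) :
    u z - v z = u w - v w :=
  isCoveringMap_exp.constOn_of_comp (g := fun z ↦ u z - v z) hS (hu.sub hv)
    (fun a ha b hb ↦ Subtype.ext (by
      simp [Complex.exp_sub, h a ha, h b hb])) hz hw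

lemma not_exists_log_on_sphere (p : ℂ) {r : ℝ} (hr : 0 < r) (g : ℂ → ℂ)
    (hg : ContinuousOn g (sphere p r)) (h : ∀ z ∈ sphere p r, z - p = Complex.exp (g z)) :
    False := by
  have hm : ∀ θ : ℝ, circleMap p r θ ∈ sphere p r := circleMap_mem_sphere p hr.le
  have hr' : (r : ℂ) ≠ 0 := by exact_mod_cast hr.ne'
  have := sub_eq_sub_of_exp_eq (X := ℝ) isPreconnected_univ
    (u := fun θ ↦ g (circleMap p r θ)) (v := fun θ ↦ Complex.log r + θ * Complex.I)
    (hg.comp (continuous_circleMap p r).continuousOn fun θ _ ↦ hm θ) (by fun_prop)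
    (fun θ _ ↦ by
      rw [← h _ (hm θ), Complex.exp_add, Complex.exp_log hr']
      simp [circleMap]) (mem_univ 0) (mem_univ (2 * Real.pi))
  have h2 : circleMap p r (2 * Real.pi) = circleMap p r 0 := by
    simp [circleMap]
  rw [h2] at this
  have h3 : (2 * Real.pi : ℂ) * Complex.I = 0 := by
    push_cast at this
    linear_combination this
  simp [Real.pi_ne_zero] at h3

end Logarithms

section Separation

lemma Unsep.symm {K : Set ℂ} {p q : ℂ} (h : Unsep K p q) : Unsep K q p := by
  obtain ⟨C, hC, hp, hq, hd⟩ := h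
  exact ⟨C, hC, hq, hp, hd⟩

lemma Unsep.mono {K L : Set ℂ} {p q : ℂ} (h : Unsep K p q) (hL : L ⊆ K) : Unsep L p q := by
  obtain ⟨C, hC, hp, hq, hd⟩ := h
  exact ⟨C, hC, hp, hq, hd.mono_right hL⟩

lemma Unsep.trans {K : Set ℂ} {p q r : ℂ} (h : Unsep K p q) (h' : Unsep K q r) : Unsep K p r := by
  obtain ⟨C, hC, hp, hq, hd⟩ := h
  obtain ⟨C', hC', hp', hq', hd'⟩ := h'
  exact ⟨C ∪ C', hC.union q hq hp' hC', .inl hp, .inr hq', hd.union_left hd'⟩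

lemma Unsep.left_notMem {K : Set ℂ} {p q : ℂ} (h : Unsep K p q) : p ∉ K := by
  obtain ⟨C, hC, hp, hq, hd⟩ := h
  exact disjoint_left.1 hd hp

lemma Unsep.right_notMem {K : Set ℂ} {p q : ℂ} (h : Unsep K p q) : q ∉ K :=
  h.symm.left_notMem

lemma unsep_iff {K : Set ℂ} {p q : ℂ} :
    Unsep K p q ↔ p ∉ K ∧ q ∈ connectedComponentIn Kᶜ p := by
  constructor
  · rintro ⟨C, hC, hp, hq, hd⟩
    exact ⟨disjoint_left.1 hd hp,
      hC.subset_connectedComponentIn hp (disjoint_left.1 hd) hq⟩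
  · rintro ⟨hp, hq⟩
    exact ⟨_, isPreconnected_connectedComponentIn, mem_connectedComponentIn hp, hq,
      disjoint_left.2 (connectedComponentIn_subset _ _)⟩

lemma unsep_of_isPreconnected {C K : Set ℂ} (hC : IsPreconnected C) (hd : Disjoint C K) {p q : ℂ}
    (hp : p ∈ C) (hq : q ∈ C) : Unsep K p q :=
  ⟨C, hC, hp, hq, hd⟩

/-- The frontier of a component of the complement of a closed set lies in the set. -/
lemma closure_connectedComponentIn_subset {K : Set ℂ} (hK : IsClosed K) (p : ℂ) :
    closure (connectedComponentIn Kᶜ p) ⊆ connectedComponentIn Kᶜ p ∪ K := by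
  intro z hz
  by_cases hzK : z ∈ K
  · exact .inr hzK
  left
  have ho : IsOpen (connectedComponentIn Kᶜ z) := hK.isOpen_compl.connectedComponentIn
  obtain ⟨w, hw, hw'⟩ := mem_closure_iff.1 hz _ ho (mem_connectedComponentIn hzK)
  rw [connectedComponentIn_eq hw', ← connectedComponentIn_eq hw]
  exact mem_connectedComponentIn hzK

lemma isPreconnected_lt_norm {r : ℝ} (hr : 0 < r) : IsPreconnected {z : ℂ | r < ‖z‖} := by
  have h : {z : ℂ | r < ‖z‖} = Complex.exp '' {w | Real.log r < w.re} := by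
    ext z
    constructor
    · intro hz
      have hz' : 0 < ‖z‖ := hr.trans hz
      refine ⟨Complex.log z, ?_, Complex.exp_log (norm_pos_iff.1 hz')⟩
      simpa [Complex.log_re] using Real.log_lt_log hr hz
    · rintro ⟨w, hw, rfl⟩
      simpa [Complex.norm_exp] using (Real.log_lt_iff_lt_exp hr).1 hw
  rw [h]
  exact ((convex_halfSpace_re_gt _).isPreconnected).image _ Complex.continuous_exp.continuousOn

/-- Two unbounded components of the complement of a bounded set coincide. -/
lemma unsep_of_not_isBounded {K : Set ℂ} (hK : Bornology.IsBounded K) {p q : ℂ}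
    (hp : ¬ Bornology.IsBounded (connectedComponentIn Kᶜ p))
    (hq : ¬ Bornology.IsBounded (connectedComponentIn Kᶜ q)) : Unsep K p q := by
  obtain ⟨r, hr0, hr⟩ := hK.subset_closedBall_lt 0 0
  have key : ∀ x, ¬ Bornology.IsBounded (connectedComponentIn Kᶜ x) →
      ∃ y, Unsep K x y ∧ r < ‖y‖ := by
    intro x hx
    have : ¬ connectedComponentIn Kᶜ x ⊆ closedBall 0 r := fun h ↦ hx (isBounded_closedBall.subset h)
    obtain ⟨y, hy, hy'⟩ := not_subset.1 this
    refine ⟨y, unsep_iff.2 ⟨?_, hy⟩, by simpa using hy'⟩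
    intro h
    simp [connectedComponentIn_eq_empty (show x ∉ Kᶜ from not_not.2 h)] at hx
  obtain ⟨y, hy, hyr⟩ := key p hp
  obtain ⟨z, hz, hzr⟩ := key q hq
  refine hy.trans (.trans ?_ hz.symm)
  refine unsep_of_isPreconnected (isPreconnected_lt_norm hr0) (disjoint_left.2 fun w hw hwK ↦ ?_) hyr hzr
  have := hr hwK
  simp only [mem_closedBall, dist_zero_right] at this
  exact absurd this (not_le.2 hw)

lemma Unsep.exists_log {K : Set ℂ} (hK : IsClosed K) {p q : ℂ} (h : Unsep K p q) :
    ∃ g : ℂ → ℂ, ContinuousOn g K ∧ ∀ z ∈ K, z - p = (z - q) * Complex.exp (g z) := by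
  obtain ⟨hp, hq⟩ := unsep_iff.1 h
  have ho : IsOpen (connectedComponentIn Kᶜ p) := hK.isOpen_compl.connectedComponentIn
  have hc : IsConnected (connectedComponentIn Kᶜ p) := isConnected_connectedComponentIn_iff.2 hp
  obtain ⟨γ, hγ⟩ := (ho.isConnected_iff_isPathConnected.1 hc).joinedIn q hq p
    (mem_connectedComponentIn hp)
  exact exists_log_of_path γ fun t ht ↦ connectedComponentIn_subset _ _ (hγ t) ht

lemma unsep_of_log_of_isBounded {K : Set ℂ} (hK : IsCompact K) {p q : ℂ} (hp : p ∉ K)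
    (hb : Bornology.IsBounded (connectedComponentIn Kᶜ p)) {g : ℂ → ℂ} (hg : ContinuousOn g K)
    (h : ∀ z ∈ K, z - p = (z - q) * Complex.exp (g z)) : Unsep K p q := by
  classical
  by_contra hsep
  rw [unsep_iff, not_and] at hsep
  specialize hsep hp
  set A := connectedComponentIn Kᶜ p with hA
  have hAo : IsOpen A := hK.isClosed.isOpen_compl.connectedComponentIn
  obtain ⟨G, hG⟩ := ContinuousMap.exists_restrict_eq hK.isClosed ⟨K.domRestrict g, hg.domRestrict⟩
  have hGg : ∀ z ∈ K, G z = g z := fun z hz ↦ DFunLike.congr_fun hG ⟨z, hz⟩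
  let H : ℂ → ℂ := fun z ↦ if z ∈ A then (z - q) * Complex.exp (G z) else z - p
  have hH : Continuous H := by
    refine Continuous.if ?_ (by fun_prop) (by fun_prop)
    intro z hz
    have hzK : z ∈ K := by
      have h1 := closure_connectedComponentIn_subset hK.isClosed p (frontier_subset_closure hz)
      refine h1.resolve_left fun h2 ↦ ?_
      exact (hAo.frontier_eq ▸ hz).2 h2
    rw [hGg z hzK, h z hzK]
  have hH0 : ∀ z ∈ univ, H z ≠ 0 := by
    intro z _
    by_cases hz : z ∈ A
    · simp only [H, hz, if_true]
      refine mul_ne_zero (fun h0 ↦ hsep ?_) (Complex.exp_ne_zero _)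
      rwa [← sub_eq_zero.1 h0]
    · simp only [H, hz, if_false]
      intro h0
      exact hz (sub_eq_zero.1 h0 ▸ mem_connectedComponentIn hp)
  obtain ⟨f, hf, hf'⟩ := exists_log_of_convex convex_univ hH.continuousOn hH0
  obtain ⟨r, hr0, hr⟩ := hb.subset_ball_lt 0 p
  refine not_exists_log_on_sphere p hr0 f (hf.mono (subset_univ _)) fun z hz ↦ ?_
  rw [← hf' z (mem_univ _)]
  have : z ∉ A := fun hzA ↦ by
    have h1 := hr hzA
    rw [mem_ball] at h1
    exact h1.ne hz
  simp [H, this]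

/-- Eilenberg's criterion. -/
lemma unsep_of_log {K : Set ℂ} (hK : IsCompact K) {p q : ℂ} (hp : p ∉ K) (hq : q ∉ K)
    {g : ℂ → ℂ} (hg : ContinuousOn g K)
    (h : ∀ z ∈ K, z - p = (z - q) * Complex.exp (g z)) : Unsep K p q := by
  by_cases hbp : Bornology.IsBounded (connectedComponentIn Kᶜ p)
  · exact unsep_of_log_of_isBounded hK hp hbp hg h
  by_cases hbq : Bornology.IsBounded (connectedComponentIn Kᶜ q)
  · refine (unsep_of_log_of_isBounded hK hq hbq hg.neg fun z hz ↦ ?_).symm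
    rw [h z hz, mul_assoc, ← Complex.exp_add]
    simp
  exact unsep_of_not_isBounded hK.isBounded hbp hbq

/-- Janiszewski's theorem. -/
lemma Unsep.union {K L : Set ℂ} (hK : IsCompact K) (hL : IsCompact L)
    (hKL : IsPreconnected (K ∩ L)) {p q : ℂ} (h : Unsep K p q) (h' : Unsep L p q) :
    Unsep (K ∪ L) p q := by
  classical
  obtain ⟨g, hg, hge⟩ := h.exists_log hK.isClosed
  obtain ⟨f, hf, hfe⟩ := h'.exists_log hL.isClosed
  have hexp : ∀ z ∈ K ∩ L, Complex.exp (g z) = Complex.exp (f z) := fun z hz ↦ by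
    have h1 := hge z hz.1
    rw [hfe z hz.2] at h1
    refine (mul_left_cancel₀ (fun h0 ↦ ?_) h1).symm
    exact h.right_notMem (sub_eq_zero.1 h0 ▸ hz.1)
  obtain ⟨c, hc, hcK⟩ : ∃ c, Complex.exp c = 1 ∧ ∀ z ∈ K ∩ L, g z = f z + c := by
    rcases (K ∩ L).eq_empty_or_nonempty with he | ⟨w, hw⟩
    · exact ⟨0, by simp, by simp [he]⟩
    · refine ⟨g w - f w, by rw [Complex.exp_sub, hexp w hw, div_self (Complex.exp_ne_zero _)],
        fun z hz ↦ ?_⟩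
      have := sub_eq_sub_of_exp_eq hKL (hg.mono inter_subset_left) (hf.mono inter_subset_right)
        hexp hz hw
      linear_combination this
  let F : ℂ → ℂ := fun z ↦ if z ∈ K then g z else f z + c
  have hFK : EqOn F g K := fun z hz ↦ by simp [F, hz]
  have hFL : EqOn F (fun z ↦ f z + c) L := fun z hz ↦ by
    by_cases hzK : z ∈ K
    · simp [F, hzK, hcK z ⟨hzK, hz⟩]
    · simp [F, hzK]
  refine unsep_of_log (hK.union hL) (by simp [h.left_notMem, h'.left_notMem])
    (by simp [h.right_notMem, h'.right_notMem]) (g := F) ?_ ?_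
  · exact (hg.congr hFK).union_of_isClosed ((hf.add continuousOn_const).congr hFL)
      hK.isClosed hL.isClosed
  · rintro z (hz | hz)
    · rw [hFK hz, hge z hz]
    · rw [hFL hz, hfe z hz]
      simp [Complex.exp_add, hc]

/-- A continuous injective image of a compact convex set does not separate the plane. -/
lemma unsep_image {E : Type*} [NormedAddCommGroup E] [NormedSpace ℝ E] {C : Set E}
    (hC : Convex ℝ C) (hCc : IsCompact C) {φ : E → ℂ} (hφ : ContinuousOn φ C)
    (hi : InjOn φ C) {p q : ℂ} (hp : p ∉ φ '' C) (hq : q ∉ φ '' C) : Unsep (φ '' C) p q := by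
  have hp' : ∀ x ∈ C, φ x - p ≠ 0 := fun x hx h0 ↦ hp ⟨x, hx, sub_eq_zero.1 h0⟩
  have hq' : ∀ x ∈ C, φ x - q ≠ 0 := fun x hx h0 ↦ hq ⟨x, hx, sub_eq_zero.1 h0⟩
  obtain ⟨g, hg, hge⟩ := exists_log_of_convex hC (f := fun x ↦ (φ x - p) / (φ x - q))
    ((hφ.sub continuousOn_const).div (hφ.sub continuousOn_const) hq')
    (fun x hx ↦ div_ne_zero (hp' x hx) (hq' x hx))
  rcases C.eq_empty_or_nonempty with rfl | ⟨x₀, -⟩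
  · exact unsep_of_isPreconnected isPreconnected_univ (by simp) (mem_univ _) (mem_univ _)
  have : Nonempty E := ⟨x₀⟩
  have hinv : ∀ x ∈ C, Function.invFunOn φ C (φ x) = x := fun x hx ↦ hi.leftInvOn_invFunOn hx
  refine unsep_of_log (hCc.image_of_continuousOn hφ) hp hq
    (g := g ∘ Function.invFunOn φ C) ?_ ?_
  · refine hg.comp ?_ (by rintro _ ⟨x, hx, rfl⟩; rwa [hinv x hx])
    rw [continuousOn_iff_isClosed]
    intro t ht
    refine ⟨φ '' (C ∩ t), ((hCc.inter_right ht).image_of_continuousOn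
      (hφ.mono inter_subset_left)).isClosed, ?_⟩
    ext z
    constructor
    · rintro ⟨hz, x, hx, rfl⟩
      rw [mem_preimage, hinv x hx] at hz
      exact ⟨⟨x, ⟨hx, hz⟩, rfl⟩, ⟨x, hx, rfl⟩⟩
    · rintro ⟨⟨x, hx, rfl⟩, -⟩
      exact ⟨by simpa [hinv x hx.1] using hx.2, ⟨x, hx.1, rfl⟩⟩
  · rintro _ ⟨x, hx, rfl⟩
    simp only [Function.comp, hinv x hx, ← hge x hx]
    have := hq' x hx
    field_simp

end Separation

section InsideOutside

/-- The union of the bounded components of the complement of `K`. -/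
def inside (K : Set ℂ) : Set ℂ :=
  {p | p ∉ K ∧ Bornology.IsBounded (connectedComponentIn Kᶜ p)}

/-- The union of the unbounded components of the complement of `K`. -/
def outside (K : Set ℂ) : Set ℂ :=
  {p | p ∉ K ∧ ¬ Bornology.IsBounded (connectedComponentIn Kᶜ p)}

/-- The set `K` together with the bounded components of its complement. -/
def fill (K : Set ℂ) : Set ℂ := K ∪ inside K

variable {K : Set ℂ}

lemma subset_fill : K ⊆ fill K := subset_union_left

lemma inside_subset_fill : inside K ⊆ fill K := subset_union_right

lemma disjoint_inside_outside : Disjoint (inside K) (outside K) :=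
  disjoint_left.2 fun _ h h' ↦ h'.2 h.2

lemma disjoint_inside : Disjoint (inside K) K := disjoint_left.2 fun _ h ↦ h.1

lemma disjoint_outside : Disjoint (outside K) K := disjoint_left.2 fun _ h ↦ h.1

lemma mem_inside_or_outside {p : ℂ} (hp : p ∉ K) : p ∈ inside K ∨ p ∈ outside K := by
  by_cases h : Bornology.IsBounded (connectedComponentIn Kᶜ p)
  · exact .inl ⟨hp, h⟩
  · exact .inr ⟨hp, h⟩

lemma notMem_fill_iff {p : ℂ} : p ∉ fill K ↔ p ∈ outside K := by
  by_cases hp : p ∈ K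
  · simp [fill, outside, hp]
  · simp [fill, inside, outside, hp]

lemma fill_eq_compl : fill K = (outside K)ᶜ := by
  ext p
  rw [mem_compl_iff, ← notMem_fill_iff, not_not]

lemma disjoint_outside_fill : Disjoint (outside K) (fill K) :=
  disjoint_left.2 fun _ h ↦ notMem_fill_iff.2 h

lemma Unsep.component_eq {p q : ℂ} (h : Unsep K p q) :
    connectedComponentIn Kᶜ p = connectedComponentIn Kᶜ q :=
  connectedComponentIn_eq (unsep_iff.1 h).2

lemma Unsep.mem_inside {p q : ℂ} (h : Unsep K p q) (hp : p ∈ inside K) : q ∈ inside K :=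
  ⟨h.right_notMem, h.component_eq ▸ hp.2⟩

lemma Unsep.mem_outside {p q : ℂ} (h : Unsep K p q) (hp : p ∈ outside K) : q ∈ outside K :=
  ⟨h.right_notMem, h.component_eq ▸ hp.2⟩

lemma isOpen_inside (hK : IsClosed K) : IsOpen (inside K) := by
  refine isOpen_iff_mem_nhds.2 fun p hp ↦ ?_
  refine mem_of_superset (hK.isOpen_compl.connectedComponentIn.mem_nhds
    (mem_connectedComponentIn hp.1)) fun q hq ↦ ?_
  exact (unsep_iff.2 ⟨hp.1, hq⟩).mem_inside hp

lemma isOpen_outside (hK : IsClosed K) : IsOpen (outside K) := by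
  refine isOpen_iff_mem_nhds.2 fun p hp ↦ ?_
  refine mem_of_superset (hK.isOpen_compl.connectedComponentIn.mem_nhds
    (mem_connectedComponentIn hp.1)) fun q hq ↦ ?_
  exact (unsep_iff.2 ⟨hp.1, hq⟩).mem_outside hp

lemma unsep_of_mem_outside (hK : Bornology.IsBounded K) {p q : ℂ} (hp : p ∈ outside K)
    (hq : q ∈ outside K) : Unsep K p q :=
  unsep_of_not_isBounded hK hp.2 hq.2

lemma subset_outside_of_isPreconnected {C : Set ℂ} (hC : IsPreconnected C)
    (hb : ¬ Bornology.IsBounded C) (hd : Disjoint C K) : C ⊆ outside K := fun _ hp ↦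
  ⟨disjoint_left.1 hd hp, fun h ↦
    hb (h.subset (hC.subset_connectedComponentIn hp (disjoint_left.1 hd)))⟩

lemma mem_outside_of_notMem_closedBall {c : ℂ} {R : ℝ} (hR : 0 ≤ R) (hK : K ⊆ closedBall c R)
    {p : ℂ} (hp : p ∉ closedBall c R) : p ∈ outside K := by
  have hp' : R < ‖p - c‖ := by simpa [dist_eq_norm] using hp
  refine subset_outside_of_isPreconnected (C := (fun t : ℝ ↦ c + t • (p - c)) '' Ici 1) ?_ ?_ ?_
    ⟨1, by simp, by simp⟩
  · exact (convex_Ici _).isPreconnected.image _ (by fun_prop)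
  · intro hb
    obtain ⟨r, hr⟩ := hb.subset_closedBall c
    have h0 : 0 < ‖p - c‖ := hR.trans_lt hp'
    have := hr ⟨max 1 ((r + 1) / ‖p - c‖), by simp, rfl⟩
    simp only [mem_closedBall, dist_eq_norm, add_sub_cancel_left, norm_smul] at this
    have h2 : (r + 1) / ‖p - c‖ ≤ ‖max 1 ((r + 1) / ‖p - c‖)‖ :=
      (le_max_right _ _).trans (Real.le_norm_self _)
    rw [div_le_iff₀ h0] at h2
    linarith
  · rw [disjoint_left]
    rintro _ ⟨t, ht, rfl⟩ htK
    have := hK htK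
    simp only [mem_closedBall, dist_eq_norm, add_sub_cancel_left, norm_smul] at this
    rw [Real.norm_of_nonneg (zero_le_one.trans ht)] at this
    have : 1 * ‖p - c‖ ≤ t * ‖p - c‖ := by gcongr; exact ht
    linarith

lemma fill_subset_closedBall {c : ℂ} {R : ℝ} (hR : 0 ≤ R) (hK : K ⊆ closedBall c R) :
    fill K ⊆ closedBall c R := by
  intro p hp
  by_contra h
  exact notMem_fill_iff.2 (mem_outside_of_notMem_closedBall hR hK h) hp

lemma isCompact_fill (hK : IsCompact K) : IsCompact (fill K) := by
  obtain ⟨R, hR0, hR⟩ := hK.isBounded.subset_closedBall_lt 0 0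
  refine (isCompact_closedBall (0 : ℂ) R).of_isClosed_subset ?_ (fill_subset_closedBall hR0.le hR)
  rw [fill_eq_compl]
  exact (isOpen_outside hK.isClosed).isClosed_compl

lemma outside_nonempty (hK : IsCompact K) : (outside K).Nonempty := by
  by_contra h
  have := isCompact_fill hK
  rw [fill_eq_compl, not_nonempty_iff_eq_empty.1 h, compl_empty] at this
  exact noncompact_univ ℂ this

lemma not_isBounded_outside (hK : IsCompact K) : ¬ Bornology.IsBounded (outside K) := by
  intro h
  have := h.union (isCompact_fill hK).isBounded
  rw [fill_eq_compl, union_compl_self] at this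
  exact NormedSpace.unbounded_univ ℝ ℂ this

lemma isPreconnected_of_unsep {S : Set ℂ} (h : ∀ p ∈ S, ∀ q ∈ S, Unsep K p q)
    (hS : ∀ p ∈ S, ∀ q, Unsep K p q → q ∈ S) : IsPreconnected S := by
  refine isPreconnected_of_forall_pair fun p hp q hq ↦ ?_
  obtain ⟨C, hC, hpC, hqC, hd⟩ := h p hp q hq
  exact ⟨C, fun z hz ↦ hS p hp z ⟨C, hC, hpC, hz, hd⟩, hpC, hqC, hC⟩

lemma isConnected_outside (hK : IsCompact K) : IsConnected (outside K) :=
  ⟨outside_nonempty hK, isPreconnected_of_unsep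
    (fun _ hp _ hq ↦ unsep_of_mem_outside hK.isBounded hp hq) fun _ hp _ h ↦ h.mem_outside hp⟩

end InsideOutside

section Arcs

/-- `A` is an arc from `a` to `b`. -/
def IsArc (A : Set ℂ) (a b : ℂ) : Prop :=
  ∃ φ : ℝ → ℂ, ContinuousOn φ (Icc 0 1) ∧ InjOn φ (Icc 0 1) ∧ φ 0 = a ∧ φ 1 = b ∧
    φ '' Icc 0 1 = A

variable {A : Set ℂ} {a b : ℂ}

lemma IsArc.ne (h : IsArc A a b) : a ≠ b := by
  obtain ⟨φ, hc, hi, rfl, rfl, -⟩ := h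
  intro h
  exact zero_ne_one (hi (by simp) (by simp) h)

lemma IsArc.left_mem (h : IsArc A a b) : a ∈ A := by
  obtain ⟨φ, hc, hi, rfl, rfl, rfl⟩ := h
  exact ⟨0, by simp, rfl⟩

lemma IsArc.right_mem (h : IsArc A a b) : b ∈ A := by
  obtain ⟨φ, hc, hi, rfl, rfl, rfl⟩ := h
  exact ⟨1, by simp, rfl⟩

lemma IsArc.isCompact (h : IsArc A a b) : IsCompact A := by
  obtain ⟨φ, hc, hi, rfl, rfl, rfl⟩ := h
  exact isCompact_Icc.image_of_continuousOn hc

lemma IsArc.isPreconnected (h : IsArc A a b) : IsPreconnected A := by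
  obtain ⟨φ, hc, hi, rfl, rfl, rfl⟩ := h
  exact isPreconnected_Icc.image _ hc

lemma IsArc.unsep (h : IsArc A a b) {p q : ℂ} (hp : p ∉ A) (hq : q ∉ A) : Unsep A p q := by
  obtain ⟨φ, hc, hi, rfl, rfl, rfl⟩ := h
  exact unsep_image (convex_Icc 0 1) isCompact_Icc hc hi hp hq

lemma isArc_image {γ : ℝ → ℂ} {s t : ℝ} (hst : s < t) (hc : ContinuousOn γ (Icc s t))
    (hi : InjOn γ (Icc s t)) : IsArc (γ '' Icc s t) (γ s) (γ t) := by
  have hpos : 0 < t - s := sub_pos.2 hst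
  have him : (fun x : ℝ ↦ (t - s) * x + s) '' Icc 0 1 = Icc s t := by
    rw [image_affine_Icc' hpos]
    simp
  have hm : MapsTo (fun x : ℝ ↦ (t - s) * x + s) (Icc 0 1) (Icc s t) := by
    rw [← him]
    exact mapsTo_image _ _
  refine ⟨fun x ↦ γ ((t - s) * x + s), hc.comp (by fun_prop) hm, hi.comp ?_ hm, by simp, by simp, ?_⟩
  · intro x _ y _ h
    simpa [hpos.ne'] using h
  · rw [← him, image_image]

lemma IsArc.symm (h : IsArc A a b) : IsArc A b a := by
  obtain ⟨φ, hc, hi, rfl, rfl, rfl⟩ := h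
  have hm : MapsTo (fun x : ℝ ↦ 1 - x) (Icc 0 1) (Icc 0 1) := fun x hx ↦ by
    simp only [mem_Icc] at *
    constructor <;> linarith
  refine ⟨fun x ↦ φ (1 - x), hc.comp (by fun_prop) hm,
    hi.comp (fun x _ y _ h ↦ by simpa using h) hm, by simp, by simp, ?_⟩
  have := image_comp φ (fun x : ℝ ↦ 1 - x) (Icc 0 1)
  rw [image_const_sub_Icc, sub_self, sub_zero] at this
  exact this

lemma IsArc.interior_nonempty (h : IsArc A a b) : (A \ {a, b}).Nonempty := by
  obtain ⟨φ, hc, hi, rfl, rfl, rfl⟩ := h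
  have h2 : (1 / 2 : ℝ) ∈ Icc (0 : ℝ) 1 := by constructor <;> norm_num
  refine ⟨φ (1 / 2), ⟨_, h2, rfl⟩, ?_⟩
  rintro (h | h)
  · have := hi h2 (by simp) h
    norm_num at this
  · have := hi h2 (by simp) h
    norm_num at this

lemma IsArc.joinedIn (h : IsArc A a b) : JoinedIn A a b := by
  obtain ⟨φ, hc, hi, rfl, rfl, rfl⟩ := h
  refine JoinedIn.ofLine hc rfl rfl subset_rfl

/-- The first point of a closed set met by an oriented segment. -/
lemma exists_first_hit {K : Set ℂ} (hK : IsClosed K) {u x : ℂ} (hx : x ∈ K) :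
    ∃ c ∈ K, c ∈ segment ℝ u x ∧ ∀ z ∈ segment ℝ u c, z ∈ K → z = c := by
  have hcl : IsCompact (Icc (0 : ℝ) 1 ∩ AffineMap.lineMap u x ⁻¹' K) :=
    isCompact_Icc.inter_right (hK.preimage AffineMap.lineMap_continuous)
  obtain ⟨t, ⟨ht, htK⟩, hmin⟩ := hcl.exists_isLeast ⟨1, by simp, by simpa using hx⟩
  refine ⟨_, htK, by rw [segment_eq_image_lineMap]; exact ⟨t, ht, rfl⟩, ?_⟩
  intro z hz hzK
  rw [segment_eq_image_lineMap] at hz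
  obtain ⟨s, hs, rfl⟩ := hz
  rw [AffineMap.lineMap_lineMap_right] at hzK ⊢
  have h1 : s * t ∈ Icc (0 : ℝ) 1 :=
    ⟨mul_nonneg hs.1 ht.1, mul_le_one₀ hs.2 ht.1 ht.2⟩
  have h2 := hmin ⟨h1, hzK⟩
  have h3 : s * t ≤ t := mul_le_of_le_one_left ht.1 hs.2
  rw [le_antisymm h3 h2]

end Arcs

section Loops

/-- A simple closed curve parametrized by `ℝ / ℤ`. -/
structure IsLoop (γ : ℝ → ℂ) : Prop where
  cont : Continuous γ
  eq_iff : ∀ s t, γ s = γ t ↔ ∃ n : ℤ, s = t + n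

/-- The image of a simple closed curve. -/
def IsJordan (J : Set ℂ) : Prop := ∃ γ, IsLoop γ ∧ range γ = J

variable {γ : ℝ → ℂ}

lemma IsLoop.isJordan (h : IsLoop γ) : IsJordan (range γ) := ⟨γ, h, rfl⟩

lemma IsLoop.add_one (h : IsLoop γ) (s : ℝ) : γ (s + 1) = γ s :=
  (h.eq_iff _ _).2 ⟨1, by simp⟩

lemma IsLoop.injOn (h : IsLoop γ) {s t : ℝ} (hst : t < s + 1) : InjOn γ (Icc s t) := by
  intro x hx y hy hxy
  obtain ⟨n, hn⟩ := (h.eq_iff _ _).1 hxy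
  have h1 : (n : ℝ) < 1 := by linarith [hx.1, hx.2, hy.1, hy.2]
  have h2 : (-1 : ℝ) < n := by linarith [hx.1, hx.2, hy.1, hy.2]
  have h3 : n = 0 := by
    have h1' : n < 1 := by exact_mod_cast h1
    have h2' : -1 < n := by exact_mod_cast h2
    omega
  simpa [h3] using hn

lemma IsLoop.exists_mem_Ico (h : IsLoop γ) (s x : ℝ) : ∃ t ∈ Ico s (s + 1), γ t = γ x := by
  refine ⟨s + Int.fract (x - s), ⟨by linarith [Int.fract_nonneg (x - s)],
    by linarith [Int.fract_lt_one (x - s)]⟩, (h.eq_iff _ _).2 ⟨-⌊x - s⌋, ?_⟩⟩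
  rw [Int.fract]
  push_cast
  ring

lemma IsLoop.image_Icc (h : IsLoop γ) (s : ℝ) : γ '' Icc s (s + 1) = range γ := by
  refine (image_subset_range _ _).antisymm ?_
  rintro _ ⟨x, rfl⟩
  obtain ⟨t, ht, hx⟩ := h.exists_mem_Ico s x
  exact ⟨t, Ico_subset_Icc_self ht, hx⟩

lemma IsLoop.union_arcs (h : IsLoop γ) {s t : ℝ} (hst : s < t) (hts : t < s + 1) :
    γ '' Icc s t ∪ γ '' Icc t (s + 1) = range γ := by
  rw [← image_union, Icc_union_Icc_eq_Icc hst.le hts.le, h.image_Icc]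

lemma IsLoop.inter_arcs (h : IsLoop γ) {s t : ℝ} (hst : s < t) (hts : t < s + 1) :
    γ '' Icc s t ∩ γ '' Icc t (s + 1) = {γ s, γ t} := by
  ext z
  constructor
  · rintro ⟨⟨x, hx, rfl⟩, y, hy, hxy⟩
    obtain ⟨n, hn⟩ := (h.eq_iff _ _).1 hxy
    have h1 : (n : ℝ) < 2 := by linarith [hx.1, hx.2, hy.1, hy.2]
    have h2 : (-1 : ℝ) < n := by linarith [hx.1, hx.2, hy.1, hy.2]
    have h1' : n < 2 := by exact_mod_cast h1
    have h2' : -1 < n := by exact_mod_cast h2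
    obtain rfl | rfl : n = 0 ∨ n = 1 := by omega
    · right
      have : x = t := by push_cast at hn; linarith [hx.1, hx.2, hy.1, hy.2]
      rw [this]
      rfl
    · left
      have : x = s := by push_cast at hn; linarith [hx.1, hx.2, hy.1, hy.2]
      rw [this]
  · rintro (rfl | rfl)
    · exact ⟨⟨s, by simp [hst.le], rfl⟩, s + 1, by simp [hts.le], h.add_one s⟩
    · exact ⟨⟨t, by simp [hst.le], rfl⟩, t, by simp [hts.le], rfl⟩

lemma IsLoop.isArc (h : IsLoop γ) {s t : ℝ} (hst : s < t) (hts : t < s + 1) :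
    IsArc (γ '' Icc s t) (γ s) (γ t) :=
  isArc_image hst h.cont.continuousOn (h.injOn hts)

lemma IsLoop.isArc_compl (h : IsLoop γ) {s t : ℝ} (hst : s < t) (hts : t < s + 1) :
    IsArc (γ '' Icc t (s + 1)) (γ s) (γ t) := by
  have := (isArc_image hts h.cont.continuousOn (h.injOn (by linarith))).symm
  rwa [h.add_one] at this

lemma IsLoop.exists_params (h : IsLoop γ) {a b : ℂ} (ha : a ∈ range γ) (hb : b ∈ range γ)
    (hab : a ≠ b) : ∃ s t, s < t ∧ t < s + 1 ∧ γ s = a ∧ γ t = b := by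
  obtain ⟨s, rfl⟩ := ha
  obtain ⟨x, rfl⟩ := hb
  obtain ⟨t, ht, hx⟩ := h.exists_mem_Ico s x
  refine ⟨s, t, lt_of_le_of_ne ht.1 ?_, ht.2, rfl, hx⟩
  rintro rfl
  exact hab hx

/-- The complementary arcs of a Jordan curve cut out by two points. -/
structure Split (J A B : Set ℂ) (a b : ℂ) : Prop where
  left : IsArc A a b
  right : IsArc B a b
  union : A ∪ B = J
  inter : A ∩ B = {a, b}

lemma Split.symm {J A B : Set ℂ} {a b : ℂ} (h : Split J A B a b) : Split J B A a b :=
  ⟨h.right, h.left, by rw [union_comm, h.union], by rw [inter_comm, h.inter]⟩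

lemma IsLoop.split (h : IsLoop γ) {s t : ℝ} (hst : s < t) (hts : t < s + 1) :
    Split (range γ) (γ '' Icc s t) (γ '' Icc t (s + 1)) (γ s) (γ t) :=
  ⟨h.isArc hst hts, h.isArc_compl hst hts, h.union_arcs hst hts, h.inter_arcs hst hts⟩

lemma IsJordan.exists_split {J : Set ℂ} (hJ : IsJordan J) {a b : ℂ} (ha : a ∈ J) (hb : b ∈ J)
    (hab : a ≠ b) : ∃ A B, Split J A B a b := by
  obtain ⟨γ, hγ, rfl⟩ := hJ
  obtain ⟨s, t, hst, hts, rfl, rfl⟩ := hγ.exists_params ha hb hab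
  exact ⟨_, _, hγ.split hst hts⟩

lemma IsJordan.isCompact {J : Set ℂ} (hJ : IsJordan J) : IsCompact J := by
  obtain ⟨γ, hγ, rfl⟩ := hJ
  rw [← hγ.image_Icc 0]
  exact isCompact_Icc.image hγ.cont

lemma IsJordan.exists_ne {J : Set ℂ} (hJ : IsJordan J) : ∃ a ∈ J, ∃ b ∈ J, a ≠ b := by
  obtain ⟨γ, hγ, rfl⟩ := hJ
  exact ⟨_, ⟨0, rfl⟩, _, ⟨1 / 2, rfl⟩, (hγ.isArc (by norm_num) (by norm_num)).ne⟩

lemma IsJordan.exists_small_split {J : Set ℂ} (hJ : IsJordan J) {x : ℂ} (hx : x ∈ J) {ε : ℝ}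
    (hε : 0 < ε) : ∃ A B a b, Split J A B a b ∧ A ⊆ ball x ε ∧ x ∉ B := by
  obtain ⟨γ, hγ, rfl⟩ := hJ
  obtain ⟨s, rfl⟩ := hx
  obtain ⟨δ, hδ, h⟩ := Metric.continuous_iff.1 hγ.cont s ε hε
  set η := min (δ / 2) (1 / 4) with hη
  have hη0 : 0 < η := by positivity
  have hη1 : η ≤ 1 / 4 := min_le_right _ _
  have hη2 : η ≤ δ / 2 := min_le_left _ _
  have hst : s - η < s + η := by linarith
  have hts : s + η < s - η + 1 := by linarith
  refine ⟨_, _, _, _, hγ.split hst hts, ?_, ?_⟩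
  · rintro _ ⟨x, hx, rfl⟩
    refine h x ?_
    rw [Real.dist_eq, abs_lt]
    constructor <;> linarith [hx.1, hx.2]
  · intro h
    have h' : γ s ∈ γ '' Icc (s - η) (s + η) := ⟨s, by constructor <;> linarith, rfl⟩
    have := (hγ.inter_arcs hst hts).subset ⟨h', h⟩
    have hi := hγ.injOn hts
    rcases this with h1 | h1
    · have := hi ⟨by linarith, by linarith⟩ ⟨by linarith, by linarith⟩ h1
      linarith
    · have := hi ⟨by linarith, by linarith⟩ ⟨by linarith, by linarith⟩ h1
      linarith

end Loops

section Join

lemma isLoop_comp_fract {F : ℝ → ℂ} (hc : ContinuousOn F (Icc 0 1)) (h01 : F 0 = F 1)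
    (hi : InjOn F (Ico 0 1)) : IsLoop (F ∘ Int.fract) := by
  refine ⟨ContinuousOn.comp_fract'' hc h01, fun s t ↦ ?_⟩
  have hm : ∀ x : ℝ, Int.fract x ∈ Ico (0 : ℝ) 1 := fun x ↦ ⟨Int.fract_nonneg x, Int.fract_lt_one x⟩
  rw [Function.comp, Function.comp, hi.eq_iff (hm s) (hm t), Int.fract_eq_fract]
  refine exists_congr fun n ↦ ?_
  rw [sub_eq_iff_eq_add, add_comm]

/-- Follow `φ`, then `ψ` backwards. -/
noncomputable def joinLoop (φ ψ : ℝ → ℂ) : ℝ → ℂ :=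
  (fun t : ℝ ↦ if t ≤ 1 / 2 then φ (2 * t) else ψ (2 - 2 * t)) ∘ Int.fract

variable {φ ψ : ℝ → ℂ}

lemma joinLoop_left {x : ℝ} (hx : x ∈ Icc (0 : ℝ) 1) : joinLoop φ ψ (x / 2) = φ x := by
  have : Int.fract (x / 2) = x / 2 := Int.fract_eq_self.2 ⟨by linarith [hx.1], by linarith [hx.2]⟩
  simp only [joinLoop, Function.comp, this]
  rw [if_pos (by linarith [hx.2])]
  congr 1
  ring

lemma joinLoop_right (h0 : φ 0 = ψ 0) (h1 : φ 1 = ψ 1) {x : ℝ} (hx : x ∈ Icc (0 : ℝ) 1) :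
    joinLoop φ ψ (1 - x / 2) = ψ x := by
  rcases eq_or_lt_of_le hx.1 with rfl | hx0
  · rw [← h0]
    simp [joinLoop]
  have : Int.fract (1 - x / 2) = 1 - x / 2 :=
    Int.fract_eq_self.2 ⟨by linarith [hx.2], by linarith⟩
  simp only [joinLoop, Function.comp, this]
  rcases eq_or_lt_of_le hx.2 with rfl | hx1
  · rw [← h1, if_pos (by norm_num)]
    norm_num
  rw [if_neg (by linarith)]
  congr 1
  ring

lemma range_joinLoop (h0 : φ 0 = ψ 0) (h1 : φ 1 = ψ 1) :
    range (joinLoop φ ψ) = φ '' Icc 0 1 ∪ ψ '' Icc 0 1 := by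
  apply Subset.antisymm
  · rintro _ ⟨x, rfl⟩
    have hf0 := Int.fract_nonneg x
    have hf1 := Int.fract_lt_one x
    simp only [joinLoop, Function.comp]
    split_ifs with h
    · exact .inl ⟨_, ⟨by linarith, by linarith⟩, rfl⟩
    · exact .inr ⟨_, ⟨by linarith, by linarith⟩, rfl⟩
  · rintro _ (⟨x, hx, rfl⟩ | ⟨x, hx, rfl⟩)
    · exact ⟨_, joinLoop_left hx⟩
    · exact ⟨_, joinLoop_right h0 h1 hx⟩

lemma isLoop_joinLoop (hφ : ContinuousOn φ (Icc 0 1)) (hψ : ContinuousOn ψ (Icc 0 1))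
    (hφi : InjOn φ (Icc 0 1)) (hψi : InjOn ψ (Icc 0 1)) (h0 : φ 0 = ψ 0) (h1 : φ 1 = ψ 1)
    (hd : φ '' Icc 0 1 ∩ ψ '' Icc 0 1 ⊆ {φ 0, φ 1}) : IsLoop (joinLoop φ ψ) := by
  refine isLoop_comp_fract ?_ ?_ ?_
  · refine ContinuousOn.if ?_ ?_ ?_
    · rintro t ⟨ht, ht'⟩
      have h2 : frontier {t : ℝ | t ≤ 1 / 2} ⊆ {1 / 2} := by
        change frontier (Iic (1 / 2 : ℝ)) ⊆ _
        rw [frontier_Iic]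
      obtain rfl : t = 1 / 2 := h2 ht'
      norm_num [h1]
    · refine hφ.comp (by fun_prop) fun t ht ↦ ?_
      have : closure {t : ℝ | t ≤ 1 / 2} ⊆ Iic (1 / 2) := closure_minimal subset_rfl isClosed_Iic
      have h2 := this ht.2
      simp only [mem_Iic] at h2
      exact ⟨by linarith [ht.1.1], by linarith⟩
    · refine hψ.comp (by fun_prop) fun t ht ↦ ?_
      have : closure {t : ℝ | ¬ t ≤ 1 / 2} ⊆ Ici (1 / 2) :=
        closure_minimal (fun t ht ↦ le_of_lt (not_le.1 ht)) isClosed_Ici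
      have h2 := this ht.2
      simp only [mem_Ici] at h2
      exact ⟨by linarith [ht.1.2], by linarith⟩
  · norm_num [h0]
  · have key : ∀ x ∈ Ico (0 : ℝ) 1, ∀ y ∈ Ico (0 : ℝ) 1, x ≤ 1 / 2 → ¬ y ≤ 1 / 2 →
        φ (2 * x) ≠ ψ (2 - 2 * y) := by
      intro x hx y hy hx2 hy2 h
      have hxI : 2 * x ∈ Icc (0 : ℝ) 1 := ⟨by linarith [hx.1], by linarith⟩
      have hyI : 2 - 2 * y ∈ Icc (0 : ℝ) 1 := ⟨by linarith [hy.2], by linarith⟩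
      have := hd ⟨⟨_, hxI, h⟩, ⟨_, hyI, rfl⟩⟩
      rcases this with h3 | h3
      · rw [h0] at h3
        have := hψi hyI (by simp) h3
        linarith [hy.2]
      · rw [mem_singleton_iff, h1] at h3
        have := hψi hyI (by simp) h3
        linarith
    intro x hx y hy h
    simp only at h
    split_ifs at h with h2 h3 h3
    · have := hφi ⟨by linarith [hx.1], by linarith⟩ ⟨by linarith [hy.1], by linarith⟩ h
      linarith
    · exact absurd h (key x hx y hy h2 h3)
    · exact absurd h.symm (key y hy x hx h3 h2)
    · have := hψi ⟨by linarith [hx.2], by linarith⟩ ⟨by linarith [hy.2], by linarith⟩ h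
      linarith

lemma IsArc.isJordan_union {A B : Set ℂ} {a b : ℂ} (hA : IsArc A a b) (hB : IsArc B a b)
    (h : A ∩ B ⊆ {a, b}) : IsJordan (A ∪ B) := by
  obtain ⟨φ, hφ, hφi, rfl, rfl, rfl⟩ := hA
  obtain ⟨ψ, hψ, hψi, h0, h1, rfl⟩ := hB
  exact ⟨_, isLoop_joinLoop hφ hψ hφi hψi h0.symm h1.symm h, range_joinLoop h0.symm h1.symm⟩

end Join

section JordanCurve

variable {J A B : Set ℂ} {a b : ℂ}

lemma Split.left_subset (h : Split J A B a b) : A ⊆ J := h.union ▸ subset_union_left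

lemma Split.right_subset (h : Split J A B a b) : B ⊆ J := h.symm.left_subset

lemma Split.left_mem (h : Split J A B a b) : a ∈ J := h.left_subset h.left.left_mem

lemma Split.right_mem (h : Split J A B a b) : b ∈ J := h.left_subset h.left.right_mem

/-- A Jordan curve separates the plane. -/
lemma IsJordan.not_isPreconnected_compl (hJ : IsJordan J) : ¬ IsPreconnected Jᶜ := by
  classical
  intro hpre
  obtain ⟨a, ha, b, hb, hab⟩ := hJ.exists_ne
  obtain ⟨A, B, hs⟩ := hJ.exists_split ha hb hab
  obtain ⟨γ, hγ⟩ := hs.left.symm.joinedIn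
  obtain ⟨δ, hδ⟩ := hs.right.symm.joinedIn
  obtain ⟨f, hf, hfe⟩ := exists_log_of_path γ (S := Aᶜ) fun t ht ↦ ht (hγ t)
  obtain ⟨g, hg, hge⟩ := exists_log_of_path δ (S := Bᶜ) fun t ht ↦ ht (hδ t)
  have hJc : Jᶜ = Aᶜ ∩ Bᶜ := by rw [← hs.union, compl_union]
  have hexp : ∀ z ∈ Jᶜ, Complex.exp (f z) = Complex.exp (g z) := fun z hz ↦ by
    have h1 := hfe z (hJc ▸ hz).1
    rw [hge z (hJc ▸ hz).2] at h1
    refine (mul_left_cancel₀ (fun h0 ↦ ?_) h1).symm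
    exact hz (sub_eq_zero.1 h0 ▸ hb)
  obtain ⟨w, hw⟩ : (Jᶜ : Set ℂ).Nonempty := by
    obtain ⟨w, hw⟩ := outside_nonempty hJ.isCompact
    exact ⟨w, hw.1⟩
  set c := f w - g w with hcdef
  have hc : Complex.exp c = 1 := by
    rw [hcdef, Complex.exp_sub, hexp w hw, div_self (Complex.exp_ne_zero _)]
  have hcz : ∀ z ∈ Jᶜ, f z = g z + c := fun z hz ↦ by
    have := sub_eq_sub_of_exp_eq hpre (hf.mono (by rw [hJc]; exact inter_subset_left))
      (hg.mono (by rw [hJc]; exact inter_subset_right)) hexp hz hw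
    linear_combination this
  let F : ℂ → ℂ := fun z ↦ if z ∈ Aᶜ then f z else g z + c
  have hFA : EqOn F f Aᶜ := fun z hz ↦ by simp only [F, if_pos hz]
  have hFB : EqOn F (fun z ↦ g z + c) Bᶜ := fun z hz ↦ by
    by_cases hzA : z ∈ Aᶜ
    · simp only [F, if_pos hzA]
      exact hcz z (by rw [hJc]; exact ⟨hzA, hz⟩)
    · simp only [F, if_neg hzA]
  have hF : ContinuousOn F (Aᶜ ∪ Bᶜ) :=
    (hf.congr hFA).union_of_isOpen ((hg.add continuousOn_const).congr hFB)
      hs.left.isCompact.isClosed.isOpen_compl hs.right.isCompact.isClosed.isOpen_compl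
  have hFe : ∀ z ∈ Aᶜ ∪ Bᶜ, z - a = (z - b) * Complex.exp (F z) := by
    rintro z (hz | hz)
    · rw [hFA hz, hfe z hz]
    · rw [hFB hz, hge z hz, Complex.exp_add, hc, mul_one]
  have hAB : Aᶜ ∪ Bᶜ = {a, b}ᶜ := by rw [← compl_inter, hs.inter]
  set r := dist a b / 2 with hr
  have hd : 0 < dist a b := dist_pos.2 hab
  have hr0 : 0 < r := by positivity
  obtain ⟨h, hh, hhe⟩ := exists_log_of_convex (convex_closedBall a r) (f := fun z ↦ z - b)
    (by fun_prop) (fun z hz h0 ↦ by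
      rw [sub_eq_zero.1 h0, mem_closedBall, dist_comm] at hz
      linarith)
  have hsub : sphere a r ⊆ Aᶜ ∪ Bᶜ := by
    rw [hAB]
    rintro z hz (rfl | rfl)
    · rw [mem_sphere, dist_self] at hz
      linarith
    · rw [mem_sphere, dist_comm] at hz
      linarith
  refine not_exists_log_on_sphere a hr0 (fun z ↦ h z + F z)
    ((hh.mono sphere_subset_closedBall).add (hF.mono hsub)) fun z hz ↦ ?_
  rw [Complex.exp_add, ← hhe z (sphere_subset_closedBall hz), hFe z (hsub hz)]

lemma IsJordan.exists_not_unsep (hJ : IsJordan J) : ∃ p ∉ J, ∃ q ∉ J, ¬ Unsep J p q := by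
  by_contra! h
  refine hJ.not_isPreconnected_compl (isPreconnected_of_forall_pair fun p hp q hq ↦ ?_)
  obtain ⟨C, hC, hpC, hqC, hd⟩ := h p hp q hq
  exact ⟨C, disjoint_left.1 hd, hpC, hqC, hC⟩

/-- A connected set meeting a set and its complement meets the frontier. -/
lemma _root_.IsPreconnected.inter_frontier_nonempty' {C S : Set ℂ} (hC : IsPreconnected C)
    (h1 : (C ∩ S).Nonempty) (h2 : (C \ S).Nonempty) : (C ∩ frontier S).Nonempty := by
  by_contra h
  rw [not_nonempty_iff_eq_empty] at h
  have hsub : C ⊆ interior S ∪ (closure S)ᶜ := by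
    intro z hz
    by_contra hn
    rw [mem_union, not_or, mem_compl_iff, not_not] at hn
    exact (h ▸ (show z ∈ C ∩ frontier S from ⟨hz, hn.2, hn.1⟩) : z ∈ (∅ : Set ℂ))
  obtain ⟨z, -, hz, hz'⟩ := hC _ _ isOpen_interior isClosed_closure.isOpen_compl hsub
    (by
      obtain ⟨z, hz, hzS⟩ := h1
      exact ⟨z, hz, (hsub hz).resolve_right fun h ↦ h (subset_closure hzS)⟩)
    (by
      obtain ⟨z, hz, hzS⟩ := h2
      exact ⟨z, hz, (hsub hz).resolve_left fun h ↦ hzS (interior_subset h)⟩)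
  exact hz' (subset_closure (interior_subset hz))

/-- Every point of a Jordan curve lies in the closure of each complementary component. -/
lemma IsJordan.subset_closure_component (hJ : IsJordan J) {p : ℂ} (hp : p ∉ J) :
    J ⊆ closure (connectedComponentIn Jᶜ p) := by
  intro x hx
  by_contra hxc
  obtain ⟨ε, hε, hball⟩ := Metric.isOpen_iff.1 isClosed_closure.isOpen_compl x hxc
  obtain ⟨A, B, a, b, hs, hA, hxB⟩ := hJ.exists_small_split hx hε
  have hcl := closure_connectedComponentIn_subset hJ.isCompact.isClosed p
  have ho : IsOpen (connectedComponentIn Jᶜ p) :=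
    hJ.isCompact.isClosed.isOpen_compl.connectedComponentIn
  obtain ⟨C, hC, hpC, hxC, hd⟩ := hs.right.unsep (fun h ↦ hp (hs.right_subset h)) hxB
  obtain ⟨z, hzC, hz⟩ := hC.inter_frontier_nonempty' (S := connectedComponentIn Jᶜ p)
    ⟨p, hpC, mem_connectedComponentIn hp⟩ ⟨x, hxC, fun h ↦ hxc (subset_closure h)⟩
  rw [ho.frontier_eq] at hz
  have hzJ := (hcl hz.1).resolve_left hz.2
  rw [← hs.union] at hzJ
  rcases hzJ with hzA | hzB
  · exact hball (hA hzA) hz.1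
  · exact disjoint_left.1 hd hzC hzB

/-- A component of the complement can be crossed between two points of the curve. -/
lemma IsJordan.exists_crossing (hJ : IsJordan J) {p : ℂ} (hp : p ∉ J) :
    ∃ a ∈ J, ∃ b ∈ J, a ≠ b ∧ ∃ α, IsCompact α ∧ IsPreconnected α ∧ a ∈ α ∧ b ∈ α ∧
      α ⊆ connectedComponentIn Jᶜ p ∪ {a, b} := by
  have hcl := hJ.subset_closure_component hp
  have ho : IsOpen (connectedComponentIn Jᶜ p) :=
    hJ.isCompact.isClosed.isOpen_compl.connectedComponentIn
  have key : ∀ x ∈ J, ∀ ε > 0, ∃ a ∈ J ∩ ball x ε, ∃ u ∈ connectedComponentIn Jᶜ p,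
      segment ℝ u a ⊆ connectedComponentIn Jᶜ p ∪ {a} := by
    intro x hx ε hε
    obtain ⟨u, hu, hux⟩ := Metric.mem_closure_iff.1 (hcl hx) ε hε
    obtain ⟨a, haJ, hau, ha⟩ := exists_first_hit hJ.isCompact.isClosed (u := u) hx
    refine ⟨a, ⟨haJ, (convex_ball x ε).segment_subset ?_ (mem_ball_self hε) hau⟩, u, hu, ?_⟩
    · rwa [mem_ball, dist_comm]
    intro z hz
    by_cases hza : z = a
    · exact .inr hza
    left
    rw [connectedComponentIn_eq hu]
    have hsub : segment ℝ u z ⊆ segment ℝ u a :=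
      (convex_segment u a).segment_subset (left_mem_segment ℝ u a) hz
    have hd : Disjoint (segment ℝ u z) J := disjoint_left.2 fun w hw hwJ ↦ by
      have hwa := ha w (hsub hw) hwJ
      subst hwa
      refine hza ?_
      have h1 := dist_add_dist_of_mem_segment hw
      have h2 := dist_add_dist_of_mem_segment hz
      have h3 : dist w z = 0 := by
        rw [dist_comm z w] at h2
        linarith [dist_nonneg (x := w) (y := z)]
      exact (dist_eq_zero.1 h3).symm
    exact (unsep_iff.1 (unsep_of_isPreconnected (convex_segment u z).isPreconnected hd
      (left_mem_segment ℝ u z) (right_mem_segment ℝ u z))).2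
  obtain ⟨x, hx, y, hy, hxy⟩ := hJ.exists_ne
  have hd := dist_pos.2 hxy
  obtain ⟨a, ⟨ha, hax⟩, u, hu, hua⟩ := key x hx (dist x y / 2) (by positivity)
  obtain ⟨b, ⟨hb, hby⟩, v, hv, hvb⟩ := key y hy (dist x y / 2) (by positivity)
  have hab : a ≠ b := by
    rintro rfl
    have h1 := dist_triangle_left x y a
    simp only [mem_ball] at hax hby
    linarith
  have hc : IsConnected (connectedComponentIn Jᶜ p) := isConnected_connectedComponentIn_iff.2 hp
  obtain ⟨γ, hγ⟩ := (ho.isConnected_iff_isPathConnected.1 hc).joinedIn u hu v hv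
  refine ⟨a, ha, b, hb, hab, segment ℝ u a ∪ range γ ∪ segment ℝ v b, ?_, ?_, ?_, ?_, ?_⟩
  · refine IsCompact.union (IsCompact.union ?_ (isCompact_range γ.continuous)) ?_
    · rw [segment_eq_image_lineMap]
      exact isCompact_Icc.image AffineMap.lineMap_continuous
    · rw [segment_eq_image_lineMap]
      exact isCompact_Icc.image AffineMap.lineMap_continuous
  · refine IsPreconnected.union v (.inr ⟨1, by simp⟩) (left_mem_segment ℝ v b)
      (IsPreconnected.union u (left_mem_segment ℝ u a) ⟨0, by simp⟩
        (convex_segment u a).isPreconnected (isPreconnected_range γ.continuous))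
      (convex_segment v b).isPreconnected
  · exact .inl (.inl (right_mem_segment ℝ u a))
  · exact .inr (right_mem_segment ℝ v b)
  · rintro z ((hz | ⟨t, rfl⟩) | hz)
    · rcases hua hz with h | h
      · exact .inl h
      · exact .inr (.inl h)
    · exact .inl (hγ t)
    · rcases hvb hz with h | h
      · exact .inl h
      · exact .inr (.inr h)

/-- The complement of a Jordan curve has at most two components. -/
lemma IsJordan.unsep_of_three (hJ : IsJordan J) {p₀ p₁ p₂ : ℂ} (h₀ : p₀ ∉ J) (h₁ : p₁ ∉ J)
    (h₂ : p₂ ∉ J) (h₀₁ : ¬ Unsep J p₀ p₁) (h₁₂ : ¬ Unsep J p₁ p₂) : Unsep J p₀ p₂ := by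
  obtain ⟨a, ha, b, hb, hab, α, hαc, hαp, haα, hbα, hα⟩ := hJ.exists_crossing h₁
  obtain ⟨A, B, hs⟩ := hJ.exists_split ha hb hab
  have key : ∀ {A B : Set ℂ}, Split J A B a b → Unsep (A ∪ α) p₀ p₂ := by
    intro A B hs
    obtain ⟨z, hzB, hz⟩ := hs.right.interior_nonempty
    have hzJ := hs.right_subset hzB
    have hzA : z ∉ A := fun h ↦ hz (hs.inter.subset ⟨h, hzB⟩)
    have hzα : z ∉ α := fun h ↦ (hα h).elim (fun h ↦ connectedComponentIn_subset _ _ h hzJ) hz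
    have side : ∀ p ∉ J, ¬ Unsep J p₁ p → Unsep (A ∪ α) p z := by
      intro p hp hps
      have hpre : IsPreconnected (insert z (connectedComponentIn Jᶜ p)) :=
        isPreconnected_connectedComponentIn.subset_closure (subset_insert _ _)
          (insert_subset (hJ.subset_closure_component hp hzJ) subset_closure)
      refine unsep_of_isPreconnected hpre (disjoint_left.2 ?_)
        (.inr (mem_connectedComponentIn hp)) (.inl rfl)
      rintro w (rfl | hw) (hwA | hwα)
      · exact hzA hwA
      · exact hzα hwα
      · exact connectedComponentIn_subset _ _ hw (hs.left_subset hwA)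
      · rcases hα hwα with h | h
        · exact hps ((unsep_iff.2 ⟨h₁, h⟩).trans (unsep_iff.2 ⟨hp, hw⟩).symm)
        · refine connectedComponentIn_subset _ _ hw ?_
          rcases h with rfl | rfl
          · exact hs.left_mem
          · exact hs.right_mem
    exact (side p₀ h₀ fun h ↦ h₀₁ h.symm).trans (side p₂ h₂ h₁₂).symm
  have hAB : (A ∪ α) ∩ (B ∪ α) = α := by
    rw [← inter_union_distrib_right, hs.inter, union_eq_right]
    rintro z (rfl | rfl) <;> assumption
  refine ((key hs).union (hs.left.isCompact.union hαc) (hs.right.isCompact.union hαc)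
    (by rwa [hAB]) (key hs.symm)).mono ?_
  rw [← hs.union]
  exact union_subset (subset_union_left.trans subset_union_left)
    (subset_union_left.trans subset_union_right)

lemma IsJordan.inside_nonempty (hJ : IsJordan J) : (inside J).Nonempty := by
  obtain ⟨p, hp, q, hq, h⟩ := hJ.exists_not_unsep
  rcases mem_inside_or_outside hp with hp' | hp'
  · exact ⟨p, hp'⟩
  rcases mem_inside_or_outside hq with hq' | hq'
  · exact ⟨q, hq'⟩
  exact absurd (unsep_of_mem_outside hJ.isCompact.isBounded hp' hq') h

lemma IsJordan.unsep_of_mem_inside (hJ : IsJordan J) {p q : ℂ} (hp : p ∈ inside J)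
    (hq : q ∈ inside J) : Unsep J p q := by
  obtain ⟨r, hr⟩ := outside_nonempty hJ.isCompact
  refine hJ.unsep_of_three (p₁ := r) hp.1 hr.1 hq.1 (fun h ↦ ?_) fun h ↦ ?_
  · exact disjoint_left.1 disjoint_inside_outside (h.mem_inside hp) hr
  · exact disjoint_left.1 disjoint_inside_outside hq (h.mem_outside hr)

lemma IsJordan.isConnected_inside (hJ : IsJordan J) : IsConnected (inside J) :=
  ⟨hJ.inside_nonempty, isPreconnected_of_unsep
    (fun _ hp _ hq ↦ hJ.unsep_of_mem_inside hp hq) fun _ hp _ h ↦ h.mem_inside hp⟩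

lemma IsJordan.subset_closure_inside (hJ : IsJordan J) : J ⊆ closure (inside J) := by
  obtain ⟨p, hp⟩ := hJ.inside_nonempty
  exact (hJ.subset_closure_component hp.1).trans
    (closure_mono fun q hq ↦ (unsep_iff.2 ⟨hp.1, hq⟩).mem_inside hp)

lemma IsJordan.subset_closure_outside (hJ : IsJordan J) : J ⊆ closure (outside J) := by
  obtain ⟨p, hp⟩ := outside_nonempty hJ.isCompact
  exact (hJ.subset_closure_component hp.1).trans
    (closure_mono fun q hq ↦ (unsep_iff.2 ⟨hp.1, hq⟩).mem_outside hp)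

/-- A compact set with connected interior and complement, bounded by a Jordan curve, is the
filled curve. -/
lemma IsJordan.fill_eq (hJ : IsJordan J) {D : Set ℂ} (hD : IsCompact D)
    (hip : IsPreconnected (interior D)) (hop : IsPreconnected Dᶜ)
    (hf : frontier D = J) : fill J = D := by
  have hDJ : D = J ∪ interior D := by
    rw [← hf, hD.isClosed.frontier_eq, sdiff_union_of_subset interior_subset]
  have hout : Dᶜ ⊆ outside J := by
    refine subset_outside_of_isPreconnected hop (fun h ↦ ?_) ?_
    · have := h.union hD.isBounded
      rw [compl_union_self] at this
      exact NormedSpace.unbounded_univ ℝ ℂ this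
    · rw [hDJ]
      exact disjoint_left.2 fun z hz hzJ ↦ hz (.inl hzJ)
  have hdJ : Disjoint (interior D) J := by
    rw [← hf]
    exact disjoint_interior_frontier
  have hin : interior D ⊆ inside J := by
    by_contra hcon
    obtain ⟨z, hz, hzn⟩ := not_subset.1 hcon
    have hzJ : z ∉ J := disjoint_left.1 hdJ hz
    have hzo := (mem_inside_or_outside hzJ).resolve_left hzn
    obtain ⟨w, hw⟩ := hJ.inside_nonempty
    have hwD : w ∈ D := by
      by_contra h
      exact disjoint_left.1 disjoint_inside_outside hw (hout h)
    rw [hDJ] at hwD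
    have hwi := hwD.resolve_left hw.1
    exact hzn ((unsep_of_isPreconnected hip hdJ hwi hz).mem_inside hw)
  apply Subset.antisymm
  · rw [fill_eq_compl]
    exact compl_subset_comm.1 hout
  · intro z hz
    rw [hDJ] at hz
    exact hz.imp id fun h ↦ hin h

end JordanCurve

section Theta

variable {J A B α : Set ℂ} {a b : ℂ}

/-- A crosscut `α` of the inside of `J`, from `a` to `b`, the two sides being `A` and `B`. -/
structure Crosscut (J A B α : Set ℂ) (a b : ℂ) : Prop where
  split : Split J A B a b
  arc : IsArc α a b
  subset : α \ {a, b} ⊆ inside J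

lemma Crosscut.symm (h : Crosscut J A B α a b) : Crosscut J B A α a b :=
  ⟨h.split.symm, h.arc, h.subset⟩

lemma Crosscut.inter (h : Crosscut J A B α a b) : A ∩ α ⊆ {a, b} := by
  rintro z ⟨hzA, hzα⟩
  by_contra hz
  exact (h.subset ⟨hzα, hz⟩).1 (h.split.left_subset hzA)

lemma Crosscut.isJordan_left (h : Crosscut J A B α a b) : IsJordan (A ∪ α) :=
  h.split.left.isJordan_union h.arc h.inter

lemma Crosscut.isJordan_right (h : Crosscut J A B α a b) : IsJordan (B ∪ α) :=
  h.symm.isJordan_left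

lemma Crosscut.pair_subset_arc (h : Crosscut J A B α a b) : {a, b} ⊆ α := by
  rintro z (rfl | rfl)
  exacts [h.arc.left_mem, h.arc.right_mem]

lemma Crosscut.subset_fill (h : Crosscut J A B α a b) : α ⊆ fill J := by
  intro z hz
  by_cases hz' : z ∈ ({a, b} : Set ℂ)
  · left
    rcases hz' with rfl | rfl
    exacts [h.split.left_mem, h.split.right_mem]
  · exact .inr (h.subset ⟨hz, hz'⟩)

lemma Crosscut.right_diff_subset_outside (h : Crosscut J A B α a b) (hJ : IsJordan J) :
    B \ {a, b} ∪ outside J ⊆ outside (A ∪ α) := by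
  have hd : Disjoint (outside J) (A ∪ α) :=
    disjoint_outside_fill.mono_right
      (union_subset (h.split.left_subset.trans PlaneTopology.subset_fill) h.subset_fill)
  have ho : outside J ⊆ outside (A ∪ α) :=
    subset_outside_of_isPreconnected (isConnected_outside hJ.isCompact).isPreconnected
      (not_isBounded_outside hJ.isCompact) hd
  refine union_subset (fun z hz ↦ ?_) ho
  have hzJ := h.split.right_subset hz.1
  refine subset_outside_of_isPreconnected (C := insert z (outside J)) ?_ ?_ ?_ (mem_insert _ _)
  · exact (isConnected_outside hJ.isCompact).isPreconnected.subset_closure (subset_insert _ _)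
      (insert_subset (hJ.subset_closure_outside hzJ) subset_closure)
  · exact fun hb ↦ not_isBounded_outside hJ.isCompact (hb.subset (subset_insert _ _))
  · refine disjoint_left.2 ?_
    rintro w (rfl | hw) hw'
    · rcases hw' with hw' | hw'
      · exact hz.2 (h.split.inter.subset ⟨hw', hz.1⟩)
      · exact hz.2 (h.symm.inter ⟨hz.1, hw'⟩)
    · exact disjoint_left.1 hd hw hw'

lemma Crosscut.inside_left_subset (h : Crosscut J A B α a b) (hJ : IsJordan J) :
    inside (A ∪ α) ⊆ inside J := by
  intro p hp
  have hpo : p ∉ outside (A ∪ α) := disjoint_left.1 disjoint_inside_outside hp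
  have hs := h.right_diff_subset_outside hJ
  have hpJ : p ∉ J := by
    rw [← h.split.union]
    rintro (hpA | hpB)
    · exact hp.1 (.inl hpA)
    · exact hpo (hs (.inl ⟨hpB, fun hh ↦ hp.1 (.inr (h.pair_subset_arc hh))⟩))
  exact (mem_inside_or_outside hpJ).resolve_right fun hh ↦ hpo (hs (.inr hh))

lemma Crosscut.inside_left_subset_outside (h : Crosscut J A B α a b) (hJ : IsJordan J) :
    inside (A ∪ α) ⊆ outside (B ∪ α) := by
  have hJ1 := h.isJordan_left
  have hd : Disjoint (inside (A ∪ α)) (B ∪ α) := by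
    refine disjoint_left.2 fun z hz hz' ↦ ?_
    rcases hz' with hz' | hz'
    · exact (h.inside_left_subset hJ hz).1 (h.split.right_subset hz')
    · exact hz.1 (.inr hz')
  obtain ⟨z, hzA, hz⟩ := h.split.left.interior_nonempty
  have hzo : z ∈ outside (B ∪ α) := h.symm.right_diff_subset_outside hJ (.inl ⟨hzA, hz⟩)
  obtain ⟨w, hwo, hwi⟩ := mem_closure_iff.1 (hJ1.subset_closure_inside (.inl hzA)) _
    (isOpen_outside (h.split.right.isCompact.union h.arc.isCompact).isClosed) hzo
  intro p hp
  exact (unsep_of_isPreconnected hJ1.isConnected_inside.isPreconnected hd hwi hp).mem_outside hwo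

lemma Crosscut.disjoint (h : Crosscut J A B α a b) (hJ : IsJordan J) :
    Disjoint (inside (A ∪ α)) (fill (B ∪ α)) :=
  disjoint_outside_fill.mono_left (h.inside_left_subset_outside hJ)

lemma Crosscut.fill_subset (h : Crosscut J A B α a b) (hJ : IsJordan J) :
    fill J ⊆ fill (A ∪ α) ∪ fill (B ∪ α) := by
  intro p hp
  by_contra hcon
  rw [mem_union, not_or, notMem_fill_iff, notMem_fill_iff] at hcon
  obtain ⟨q, hq⟩ := outside_nonempty hJ.isCompact
  have hAB : (A ∪ α) ∩ (B ∪ α) = α := by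
    rw [← inter_union_distrib_right, h.split.inter, union_eq_right]
    exact h.pair_subset_arc
  have hcA := h.isJordan_left.isCompact
  have hcB := h.isJordan_right.isCompact
  have h1 : Unsep (A ∪ α) p q := unsep_of_mem_outside hcA.isBounded hcon.1
    (h.right_diff_subset_outside hJ (.inr hq))
  have h2 : Unsep (B ∪ α) p q := unsep_of_mem_outside hcB.isBounded hcon.2
    (h.symm.right_diff_subset_outside hJ (.inr hq))
  have h3 := (h1.union hcA hcB (by rw [hAB]; exact h.arc.isPreconnected) h2).mono (L := J) (by
    rw [← h.split.union]
    exact union_subset (subset_union_left.trans subset_union_left)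
      (subset_union_left.trans subset_union_right))
  exact disjoint_left.1 disjoint_outside_fill (h3.symm.mem_outside hq) hp

end Theta

section ArcCharacterization

/-- A separable connected compact ordered space with endpoints, whose open rays are open, is an
interval. -/
lemma exists_homeomorph_unitInterval {X : Type*} [TopologicalSpace X] [CompactSpace X]
    [PreconnectedSpace X] [TopologicalSpace.SeparableSpace X] [LinearOrder X]
    (hIio : ∀ c : X, IsOpen (Iio c)) (hIoi : ∀ c : X, IsOpen (Ioi c)) {a b : X}
    (ha : ∀ x, a ≤ x) (hb : ∀ x, x ≤ b) (hab : a < b) :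
    ∃ e : X ≃ₜ unitInterval, e a = 0 ∧ e b = 1 := by
  have hdense : ∀ x y : X, x < y → (Ioo x y).Nonempty := by
    intro x y hxy
    by_contra h
    rw [not_nonempty_iff_eq_empty] at h
    have hc : IsClopen (Iio y) := by
      refine ⟨?_, hIio y⟩
      have : Iio y = (Ioi x)ᶜ := by
        ext z
        simp only [mem_Iio, mem_compl_iff, mem_Ioi, not_lt]
        refine ⟨fun hz ↦ not_lt.1 fun hxz ↦ ?_, fun hz ↦ hz.trans_lt hxy⟩
        exact (h ▸ (show z ∈ Ioo x y from ⟨hxz, hz⟩) : z ∈ (∅ : Set X))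
      rw [this]
      exact (hIoi x).isClosed_compl
    rcases isClopen_iff.1 hc with h | h
    · exact (h ▸ (show x ∈ Iio y from hxy) : x ∈ (∅ : Set X))
    · exact lt_irrefl y (h ▸ mem_univ y : y ∈ Iio y)
  obtain ⟨Q₀, hQ₀, hQ₀d⟩ := TopologicalSpace.exists_countable_dense X
  let Q : Set X := Q₀ ∩ Ioo a b
  have hQ : ∀ x y : X, x < y → ∃ q ∈ Q, x < q ∧ q < y := by
    intro x y hxy
    obtain ⟨q, hq, hqQ⟩ := hQ₀d.inter_open_nonempty (Ioo x y)
      ((hIoi x).inter (hIio y)) (hdense x y hxy)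
    exact ⟨q, ⟨hqQ, (ha x).trans_lt hq.1, hq.2.trans_le (hb y)⟩, hq.1, hq.2⟩
  have : Countable Q := (hQ₀.mono inter_subset_left).to_subtype
  have : DenselyOrdered Q := ⟨fun x y hxy ↦ by
    obtain ⟨q, hq, h1, h2⟩ := hQ x y hxy
    exact ⟨⟨q, hq⟩, h1, h2⟩⟩
  have : NoMinOrder Q := ⟨fun x ↦ by
    obtain ⟨q, hq, h1, h2⟩ := hQ a x x.2.2.1
    exact ⟨⟨q, hq⟩, h2⟩⟩
  have : NoMaxOrder Q := ⟨fun x ↦ by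
    obtain ⟨q, hq, h1, h2⟩ := hQ x b x.2.2.2
    exact ⟨⟨q, hq⟩, h1⟩⟩
  have : Nonempty Q := by
    obtain ⟨q, hq, h1, h2⟩ := hQ a b hab
    exact ⟨⟨q, hq⟩⟩
  have : Nonempty (Ioo (0 : ℚ) 1) := ⟨⟨1 / 2, by norm_num, by norm_num⟩⟩
  obtain ⟨φ₀⟩ := Order.iso_of_countable_dense Q (Ioo (0 : ℚ) 1)
  let φ : Q → unitInterval := fun q ↦ ⟨((φ₀ q : ℚ) : ℝ), by
    constructor
    · exact_mod_cast (φ₀ q).2.1.le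
    · exact_mod_cast (φ₀ q).2.2.le⟩
  have hφ : StrictMono φ := fun x y hxy ↦ by
    have := φ₀.strictMono hxy
    change (((φ₀ x : ℚ) : ℝ)) < ((φ₀ y : ℚ) : ℝ)
    exact_mod_cast this
  have hφd : ∀ x y : unitInterval, x < y → ∃ q, x < φ q ∧ φ q < y := by
    intro x y hxy
    obtain ⟨r, hr1, hr2⟩ := exists_rat_btwn (show (x : ℝ) < y from hxy)
    have h0 : (0 : ℝ) < r := x.2.1.trans_lt hr1
    have h1 : (r : ℝ) < 1 := hr2.trans_le y.2.2
    refine ⟨φ₀.symm ⟨r, by exact_mod_cast h0, by exact_mod_cast h1⟩, ?_, ?_⟩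
    · change (x : ℝ) < (φ₀ (φ₀.symm _) : ℚ)
      simpa using hr1
    · change ((φ₀ (φ₀.symm _) : ℚ) : ℝ) < y
      simpa using hr2
  let f : X → unitInterval := fun x ↦ ⨆ q : {q : Q // (q : X) < x}, φ q
  have hf1 : ∀ (x : X) (q : Q), x ≤ q → f x ≤ φ q := fun x q hx ↦
    iSup_le fun q' ↦ hφ.monotone (le_of_lt (show (q' : Q) < q from q'.2.trans_le hx))
  have hf2' : ∀ (x : X) (q : Q), (q : X) < x → φ q ≤ f x := fun x q hx ↦
    le_iSup (fun q : {q : Q // (q : X) < x} ↦ φ q) ⟨q, hx⟩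
  have hf2 : ∀ (x : X) (q : Q), (q : X) ≤ x → φ q ≤ f x := by
    intro x q hx
    by_contra! h
    obtain ⟨q', h1, h2⟩ := hφd _ _ h
    exact absurd (hf2' x q' ((show (q' : X) < q from hφ.lt_iff_lt.1 h2).trans_le hx))
      (not_le.2 h1)
  have hmono : StrictMono f := by
    intro x y hxy
    obtain ⟨q, hq, h1, h2⟩ := hQ x y hxy
    obtain ⟨q', hq', h1', h2'⟩ := hQ q y h2
    exact (hf1 x ⟨q, hq⟩ h1.le).trans_lt ((hφ (show (⟨q, hq⟩ : Q) < ⟨q', hq'⟩ from h1')).trans_le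
      (hf2 y ⟨q', hq'⟩ h2'.le))
  have hcont : Continuous f := by
    rw [OrderTopology.continuous_iff]
    refine fun r ↦ ⟨isOpen_iff_mem_nhds.2 fun x hx ↦ ?_, isOpen_iff_mem_nhds.2 fun x hx ↦ ?_⟩
    · obtain ⟨q, h1, h2⟩ := hφd _ _ hx
      have : (q : X) < x := not_le.1 fun h ↦ absurd (hf1 x q h) (not_le.2 h2)
      exact mem_of_superset ((hIoi _).mem_nhds this) fun y hy ↦ h1.trans_le (hf2 y q hy.le)
    · obtain ⟨q, h1, h2⟩ := hφd _ _ hx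
      have : x < (q : X) := not_le.1 fun h ↦ absurd (hf2 x q h) (not_le.2 h1)
      exact mem_of_superset ((hIio _).mem_nhds this) fun y hy ↦ (hf1 y q hy.le).trans_lt h2
  have hfa : f a = 0 := by
    by_contra h
    obtain ⟨q, h1, h2⟩ := hφd 0 (f a) (lt_of_le_of_ne (f a).2.1 fun h' ↦ h h'.symm)
    exact absurd (hf1 a q (ha _)) (not_le.2 h2)
  have hfb : f b = 1 := by
    by_contra h
    obtain ⟨q, h1, h2⟩ := hφd (f b) 1 (lt_of_le_of_ne (f b).2.2 h)
    exact absurd (hf2 b q (hb _)) (not_le.2 h1)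
  have hsurj : Function.Surjective f := by
    intro y
    have := (isPreconnected_range hcont).ordConnected.out ⟨a, hfa⟩ ⟨b, hfb⟩
    exact this ⟨y.2.1, y.2.2⟩
  exact ⟨Continuous.homeoOfEquivCompactToT2 (f := Equiv.ofBijective f ⟨hmono.injective, hsurj⟩)
    hcont, hfa, hfb⟩

lemma isPreconnected_compl_of_cut {X : Type*} [TopologicalSpace X] [PreconnectedSpace X]
    [T1Space X] {c : X} {T S : Set X} (hT : IsOpen T) (hS : IsOpen S) (hTS : T ∪ S = {c}ᶜ)
    (hd : Disjoint T S) : IsPreconnected Sᶜ := by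
  have hc : c ∈ Sᶜ := fun h ↦ (hTS ▸ (Or.inr h : c ∈ T ∪ S) : c ∈ ({c} : Set X)ᶜ) rfl
  have key : ∀ u v : Set X, IsClosed u → IsClosed v → Sᶜ ⊆ u ∪ v → Sᶜ ∩ (u ∩ v) = ∅ → c ∈ u →
      Sᶜ ⊆ u := by
    intro u v hu hv huv he hcu
    have hcl : IsClopen (Sᶜ ∩ v) := by
      refine ⟨hS.isClosed_compl.inter hv, ?_⟩
      have : Sᶜ ∩ v = ((Sᶜ ∩ u) ∪ Tᶜ)ᶜ := by
        ext z
        constructor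
        · rintro ⟨hz, hzv⟩ (⟨-, hzu⟩ | hzT)
          · exact (he ▸ (show z ∈ Sᶜ ∩ (u ∩ v) from ⟨hz, hzu, hzv⟩) : z ∈ (∅ : Set X))
          · have hzc : z ≠ c := by
              rintro rfl
              exact (he ▸ (show z ∈ Sᶜ ∩ (u ∩ v) from ⟨hz, hcu, hzv⟩) : z ∈ (∅ : Set X))
            have : z ∈ T ∪ S := hTS ▸ hzc
            exact this.elim hzT hz
        · intro hz
          rw [mem_compl_iff, mem_union, not_or, mem_compl_iff, not_not] at hz
          have hzS : z ∈ Sᶜ := disjoint_left.1 hd hz.2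
          exact ⟨hzS, (huv hzS).resolve_left fun h ↦ hz.1 ⟨hzS, h⟩⟩
      rw [this]
      exact ((hS.isClosed_compl.inter hu).union hT.isClosed_compl).isOpen_compl
    rcases isClopen_iff.1 hcl with h | h
    · intro z hz
      refine (huv hz).resolve_right fun hzv ↦ ?_
      exact (h ▸ (show z ∈ Sᶜ ∩ v from ⟨hz, hzv⟩) : z ∈ (∅ : Set X))
    · have hcv : c ∈ v := (h ▸ mem_univ c : c ∈ Sᶜ ∩ v).2
      exact absurd (show c ∈ Sᶜ ∩ (u ∩ v) from ⟨hc, hcu, hcv⟩) (he ▸ notMem_empty c)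
  rw [isPreconnected_iff_subset_of_disjoint_closed]
  intro u v hu hv huv he
  rcases huv hc with h | h
  · exact .inl (key u v hu hv huv he h)
  · exact .inr (key v u hv hu (by rwa [union_comm]) (by rwa [inter_comm v u]) h)

/-- A separable compact connected space in which every other point separates `a` from `b` is an
interval. -/
lemma exists_homeomorph_of_cutPoints {X : Type*} [TopologicalSpace X] [CompactSpace X]
    [PreconnectedSpace X] [TopologicalSpace.SeparableSpace X] [T1Space X] {a b : X} (hab : a ≠ b)
    (h : ∀ c, c ≠ a → c ≠ b → ∃ T S : Set X, IsOpen T ∧ IsOpen S ∧ T ∪ S = {c}ᶜ ∧ Disjoint T S ∧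
      a ∈ T ∧ b ∈ S) :
    ∃ e : X ≃ₜ unitInterval, e a = 0 ∧ e b = 1 := by
  classical
  have h' : ∀ c, ∃ T S : Set X, IsOpen T ∧ IsOpen S ∧ T ∪ S = {c}ᶜ ∧ Disjoint T S ∧
      (c ≠ a → a ∈ T) ∧ (c ≠ b → b ∈ S) := by
    intro c
    by_cases hca : c = a
    · exact ⟨∅, {c}ᶜ, isOpen_empty, isOpen_compl_singleton, by simp, by simp,
        fun h ↦ absurd hca h, fun h ↦ h.symm⟩
    by_cases hcb : c = b
    · exact ⟨{c}ᶜ, ∅, isOpen_compl_singleton, isOpen_empty, by simp, by simp,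
        fun h ↦ h.symm, fun h ↦ absurd hcb h⟩
    obtain ⟨T, S, h1, h2, h3, h4, h5, h6⟩ := h c hca hcb
    exact ⟨T, S, h1, h2, h3, h4, fun _ ↦ h5, fun _ ↦ h6⟩
  choose T S hT hS hTS hd ha hb using h'
  have hST : ∀ c, S c ∪ T c = {c}ᶜ := fun c ↦ by rw [union_comm, hTS]
  have hor : ∀ c x, x ≠ c → x ∈ T c ∨ x ∈ S c := fun c x hx ↦ by
    have : x ∈ T c ∪ S c := hTS c ▸ hx
    exact this
  have hcT : ∀ c, c ∉ T c := fun c hc ↦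
    ((hTS c).subset (Or.inl hc)) rfl
  have hcS : ∀ c, c ∉ S c := fun c hc ↦
    ((hTS c).subset (Or.inr hc)) rfl
  have split : ∀ (c : X) (C : Set X), IsPreconnected C → c ∉ C → ∀ x ∈ C, ∀ y ∈ C,
      x ∈ T c → y ∈ T c := by
    intro c C hC hcC x hx y hy hxT
    refine (hor c y fun h ↦ hcC (h ▸ hy)).resolve_right fun hyS ↦ ?_
    obtain ⟨z, -, hz⟩ := hC (T c) (S c) (hT c) (hS c)
      (fun z hz ↦ hor c z fun h ↦ hcC (h ▸ hz)) ⟨x, hx, hxT⟩ ⟨y, hy, hyS⟩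
    exact disjoint_left.1 (hd c) hz.1 hz.2
  have k1 : ∀ c d, d ∈ T c → c ∈ S d := by
    intro c d hdc
    have hpre : IsPreconnected (T c)ᶜ := isPreconnected_compl_of_cut (hS c) (hT c) (hST c) (hd c).symm
    have hdb : d ≠ b := by
      rintro rfl
      by_cases hcd : c = d
      · exact hcT c (hcd ▸ hdc)
      · exact disjoint_left.1 (hd c) hdc (hb c hcd)
    have hbc : b ∈ (T c)ᶜ := fun hbT ↦ by
      by_cases hcd : c = b
      · exact hcT c (hcd ▸ hbT)
      · exact disjoint_left.1 (hd c) hbT (hb c hcd)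
    refine (hor d c fun h ↦ hcT c (h ▸ hdc)).resolve_left fun hcd ↦ ?_
    exact disjoint_left.1 (hd d)
      (split d _ hpre (fun h ↦ h hdc) c (hcT c) b hbc hcd) (hb d hdb)
  have k2 : ∀ c d, d ∈ S c → c ∈ T d := by
    intro c d hdc
    have hpre : IsPreconnected (S c)ᶜ := isPreconnected_compl_of_cut (hT c) (hS c) (hTS c) (hd c)
    have hda : d ≠ a := by
      rintro rfl
      by_cases hcd : c = d
      · exact hcS c (hcd ▸ hdc)
      · exact disjoint_left.1 (hd c) (ha c hcd) hdc
    have hac : a ∈ (S c)ᶜ := fun haS ↦ by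
      by_cases hca : c = a
      · exact hcS c (hca ▸ haS)
      · exact disjoint_left.1 (hd c) (ha c hca) haS
    exact split d _ hpre (fun h ↦ h hdc) a hac c (hcS c) (ha d hda)
  have trans : ∀ x y z, x ∈ T y → y ∈ T z → x ∈ T z := by
    intro x y z hxy hyz
    have hpre : IsPreconnected (S y)ᶜ := isPreconnected_compl_of_cut (hT y) (hS y) (hTS y) (hd y)
    exact split z _ hpre (fun h ↦ h (k1 z y hyz)) y (hcS y) x (disjoint_left.1 (hd y) hxy) hyz
  let L : LinearOrder X :=
    { le := fun x y ↦ x = y ∨ x ∈ T y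
      lt := fun x y ↦ x ∈ T y
      le_refl := fun x ↦ .inl rfl
      le_trans := by
        rintro x y z (rfl | hxy) (rfl | hyz)
        · exact .inl rfl
        · exact .inr hyz
        · exact .inr hxy
        · exact .inr (trans x y z hxy hyz)
      lt_iff_le_not_ge := by
        intro x y
        constructor
        · intro hxy
          refine ⟨.inr hxy, ?_⟩
          rintro (rfl | hyx)
          · exact hcT _ hxy
          · exact disjoint_left.1 (hd y) hxy (k1 x y hyx)
        · rintro ⟨rfl | hxy, hn⟩
          · exact absurd (.inl rfl) hn
          · exact hxy
      le_antisymm := by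
        rintro x y (rfl | hxy) (hyx | hyx)
        · rfl
        · rfl
        · exact hyx.symm
        · exact absurd (k1 x y hyx) (disjoint_left.1 (hd y) hxy)
      le_total := by
        intro x y
        by_cases hxy : x = y
        · exact .inl (.inl hxy)
        rcases hor y x hxy with h | h
        · exact .inl (.inr h)
        · exact .inr (.inr (k2 y x h))
      toDecidableLE := Classical.decRel _ }
  refine exists_homeomorph_unitInterval (X := X) (fun c ↦ hT c) (fun c ↦ ?_) (a := a) (b := b)
    (fun x ↦ ?_) (fun x ↦ ?_) (ha b hab.symm)
  · have : Ioi c = S c := Set.ext fun x ↦ ⟨fun hx ↦ k1 x c hx, fun hx ↦ k2 c x hx⟩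
    rw [this]
    exact hS c
  · by_cases hx : x = a
    · exact .inl hx.symm
    · exact .inr (ha x hx)
  · by_cases hx : x = b
    · exact .inl hx
    · exact .inr (k2 x b (hb x hx))

/-- A plane continuum in which every other point separates `a` from `b` is an arc. -/
lemma isArc_of_cutPoints {X : Set ℂ} (hX : IsCompact X) (hXp : IsPreconnected X) {a b : ℂ}
    (ha : a ∈ X) (hb : b ∈ X) (hab : a ≠ b)
    (h : ∀ c ∈ X, c ≠ a → c ≠ b → ∃ U V, IsOpen U ∧ IsOpen V ∧ a ∈ U ∧ b ∈ V ∧ X \ {c} ⊆ U ∪ V ∧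
      ∀ z ∈ X, z ≠ c → z ∈ U → z ∉ V) : IsArc X a b := by
  have : CompactSpace X := isCompact_iff_compactSpace.1 hX
  have : PreconnectedSpace X := isPreconnected_iff_preconnectedSpace.1 hXp
  obtain ⟨e, hea, heb⟩ := exists_homeomorph_of_cutPoints (X := X) (a := ⟨a, ha⟩) (b := ⟨b, hb⟩)
    (fun h ↦ hab (congrArg Subtype.val h)) (by
      rintro ⟨c, hc⟩ hca hcb
      obtain ⟨U, V, hU, hV, haU, hbV, hsub, hd⟩ := h c hc (fun h ↦ hca (Subtype.ext h))
        (fun h ↦ hcb (Subtype.ext h))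
      refine ⟨Subtype.val ⁻¹' U ∩ {⟨c, hc⟩}ᶜ, Subtype.val ⁻¹' V ∩ {⟨c, hc⟩}ᶜ,
        (hU.preimage continuous_subtype_val).inter isOpen_compl_singleton,
        (hV.preimage continuous_subtype_val).inter isOpen_compl_singleton, ?_, ?_,
        ⟨haU, fun h ↦ hca h.symm⟩, ⟨hbV, fun h ↦ hcb h.symm⟩⟩
      · ext x
        rw [← union_inter_distrib_right]
        refine ⟨fun hx ↦ hx.2, fun hx ↦ ⟨?_, hx⟩⟩
        exact hsub ⟨x.2, fun h ↦ hx (Subtype.ext h)⟩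
      · exact disjoint_left.2 fun x hx hx' ↦
          hd x x.2 (fun h ↦ hx.2 (Subtype.ext h)) hx.1 hx'.1)
  refine ⟨fun t ↦ e.symm (projIcc 0 1 zero_le_one t), ?_, ?_, ?_, ?_, ?_⟩
  · exact (continuous_subtype_val.comp (e.symm.continuous.comp continuous_projIcc)).continuousOn
  · intro s hs t ht hst
    have := e.symm.injective (Subtype.ext hst)
    rw [projIcc_of_mem _ hs, projIcc_of_mem _ ht] at this
    exact congrArg Subtype.val this
  · simp only [projIcc_left]
    change ((e.symm 0 : X) : ℂ) = a
    rw [← hea, e.symm_apply_apply]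
  · simp only [projIcc_right]
    change ((e.symm 1 : X) : ℂ) = b
    rw [← heb, e.symm_apply_apply]
  · ext z
    constructor
    · rintro ⟨t, -, rfl⟩
      exact Subtype.prop _
    · intro hz
      exact ⟨e ⟨z, hz⟩, (e ⟨z, hz⟩).2, by simp⟩

end ArcCharacterization

section PathToArc

/-- Closed subsets of `[0,1]` containing the endpoints, across whose gaps `γ` does not move. -/
def GapClosed (γ : ℝ → ℂ) : Set (Set ℝ) :=
  {C | C ⊆ Icc 0 1 ∧ IsClosed C ∧ 0 ∈ C ∧ 1 ∈ C ∧
    ∀ s ∈ C, ∀ t ∈ C, s < t → (∀ z ∈ C, ¬ (s < z ∧ z < t)) → γ s = γ t}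

lemma exists_minimal_gapClosed {γ : ℝ → ℂ} (hγ : Continuous γ) :
    ∃ C, Minimal (· ∈ GapClosed γ) C := by
  refine zorn_superset _ fun c hc hchain ↦ ?_
  rcases c.eq_empty_or_nonempty with rfl | hne
  · refine ⟨Icc 0 1, ⟨subset_rfl, isClosed_Icc, by simp, by simp, fun s hs t ht hst h ↦ ?_⟩, by simp⟩
    exact absurd ⟨by linarith, by linarith⟩
      (h ((s + t) / 2) ⟨by linarith [hs.1, ht.1], by linarith [hs.2, ht.2]⟩)
  refine ⟨⋂₀ c, ⟨?_, isClosed_sInter fun C hC ↦ (hc hC).2.1, fun C hC ↦ (hc hC).2.2.1,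
    fun C hC ↦ (hc hC).2.2.2.1, ?_⟩, fun C hC ↦ sInter_subset_of_mem hC⟩
  · obtain ⟨C, hC⟩ := hne
    exact (sInter_subset_of_mem hC).trans (hc hC).1
  intro s hs t ht hst hgap
  refine eq_of_forall_dist_le fun ε hε ↦ ?_
  obtain ⟨δ₁, hδ₁, h1⟩ := Metric.continuous_iff.1 hγ s (ε / 2) (by positivity)
  obtain ⟨δ₂, hδ₂, h2⟩ := Metric.continuous_iff.1 hγ t (ε / 2) (by positivity)
  obtain ⟨η, hη, hη1⟩ : ∃ η > 0, η < min (min δ₁ δ₂) ((t - s) / 2) :=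
    exists_between (by simp [hδ₁, hδ₂, hst])
  rw [lt_min_iff, lt_min_iff] at hη1
  obtain ⟨⟨hη1, hη2⟩, hη3⟩ := hη1
  obtain ⟨C, hC, hCe⟩ : ∃ C ∈ c, C ∩ Icc (s + η) (t - η) = ∅ := by
    by_contra! hcon
    have := IsCompact.nonempty_sInter_of_directed_nonempty_isCompact_isClosed
      (S := (fun C ↦ C ∩ Icc (s + η) (t - η)) '' c) (hS := (hne.image _).to_subtype) ?_ ?_ ?_ ?_
    · obtain ⟨z, hz⟩ := this
      simp only [sInter_image, mem_iInter] at hz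
      obtain ⟨C, hC⟩ := hne
      have hzI := (hz C hC).2
      exact hgap z (fun C hC ↦ (hz C hC).1) ⟨by linarith [hzI.1], by linarith [hzI.2]⟩
    · rintro _ ⟨C, hC, rfl⟩ _ ⟨C', hC', rfl⟩
      rcases hchain.total hC hC' with h | h
      · exact ⟨_, ⟨C, hC, rfl⟩, subset_rfl, inter_subset_inter_left _ h⟩
      · exact ⟨_, ⟨C', hC', rfl⟩, inter_subset_inter_left _ h, subset_rfl⟩
    · rintro _ ⟨C, hC, rfl⟩
      exact hcon C hC
    · rintro _ ⟨C, hC, rfl⟩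
      exact isCompact_Icc.inter_left (hc hC).2.1
    · rintro _ ⟨C, hC, rfl⟩
      exact (hc hC).2.1.inter isClosed_Icc
  obtain ⟨s', ⟨hs'C, hs'⟩, hs'max⟩ := (isCompact_Icc.inter_left (hc hC).2.1 :
    IsCompact (C ∩ Icc s (s + η))).exists_isGreatest ⟨s, hs C hC, by simp [hη.le]⟩
  obtain ⟨t', ⟨ht'C, ht'⟩, ht'min⟩ := (isCompact_Icc.inter_left (hc hC).2.1 :
    IsCompact (C ∩ Icc (t - η) t)).exists_isLeast ⟨t, ht C hC, by simp [hη.le]⟩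
  have heq : γ s' = γ t' := by
    refine (hc hC).2.2.2.2 s' hs'C t' ht'C (by linarith [hs'.2, ht'.1]) ?_
    rintro z hzC ⟨hz1, hz2⟩
    rcases le_or_gt z (s + η) with h | h
    · exact absurd (hs'max ⟨hzC, by linarith [hs'.1], h⟩) (not_le.2 hz1)
    rcases le_or_gt (t - η) z with h' | h'
    · exact absurd (ht'min ⟨hzC, h', by linarith [ht'.2]⟩) (not_le.2 hz2)
    exact (hCe ▸ (show z ∈ C ∩ Icc (s + η) (t - η) from ⟨hzC, h.le, h'.le⟩) : z ∈ (∅ : Set ℝ))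
  have e1 := h1 s' (by rw [Real.dist_eq, abs_lt]; constructor <;> linarith [hs'.1, hs'.2])
  have e2 := h2 t' (by rw [Real.dist_eq, abs_lt]; constructor <;> linarith [ht'.1, ht'.2])
  rw [heq] at e1
  have := dist_triangle_left (γ s) (γ t) (γ t')
  linarith

/-- A path with distinct ends contains an arc with the same ends. -/
lemma exists_isArc_subset {γ : ℝ → ℂ} (hγ : Continuous γ) (hne : γ 0 ≠ γ 1) :
    ∃ A ⊆ γ '' Icc 0 1, IsArc A (γ 0) (γ 1) := by
  obtain ⟨C, hCm⟩ := exists_minimal_gapClosed hγ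
  obtain ⟨hCI, hCc, h0, h1, hgap⟩ := hCm.prop
  have hCk : IsCompact C := isCompact_Icc.of_isClosed_subset hCc hCI
  have fib : ∀ u ∈ C, ∀ v ∈ C, γ u = γ v → ∀ z ∈ C, ¬ (u < z ∧ z < v) := by
    intro u hu v hv huv z hz huzv
    have hmem : C \ Ioo u v ∈ GapClosed γ := by
      have hn : ∀ w ∈ C, w ≤ u → w ∈ C \ Ioo u v := fun w hw hwu ↦ ⟨hw, fun h ↦ not_lt.2 hwu h.1⟩
      have hn' : ∀ w ∈ C, v ≤ w → w ∈ C \ Ioo u v := fun w hw hwu ↦ ⟨hw, fun h ↦ not_lt.2 hwu h.2⟩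
      refine ⟨sdiff_subset.trans hCI, hCc.sdiff isOpen_Ioo, hn 0 h0 (hCI hu).1,
        hn' 1 h1 (hCI hv).2, ?_⟩
      rintro s ⟨hs, hs'⟩ t ⟨ht, ht'⟩ hst hst'
      by_cases hz' : ∃ w ∈ C, s < w ∧ w < t
      · obtain ⟨w, hw, hsw, hwt⟩ := hz'
        have hwI : w ∈ Ioo u v := by
          by_contra h
          exact hst' w ⟨hw, h⟩ ⟨hsw, hwt⟩
        have hsu : s ≤ u := not_lt.1 fun h ↦ hs' ⟨h, hsw.trans hwI.2⟩
        have hvt : v ≤ t := not_lt.1 fun h ↦ ht' ⟨hwI.1.trans hwt, h⟩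
        have hsu' : s = u := hsu.antisymm (not_lt.1 fun h ↦
          hst' u (hn u hu le_rfl) ⟨h, hwI.1.trans hwt⟩)
        have hvt' : t = v := le_antisymm (not_lt.1 fun h ↦
          hst' v (hn' v hv le_rfl) ⟨hsw.trans hwI.2, h⟩) hvt
        rw [hsu', hvt', huv]
      · push Not at hz'
        exact hgap s hs t ht hst fun w hw h ↦ absurd h.2 (not_lt.2 (hz' w hw h.1))
    exact (hCm.le_of_le hmem sdiff_subset hz).2 huzv
  refine ⟨γ '' C, image_mono hCI, ?_⟩
  have hcomp : ∀ s : Set ℂ, IsClosed s → IsCompact (C ∩ γ ⁻¹' s) := fun s hs ↦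
    hCk.inter_right (hs.preimage hγ)
  refine isArc_of_cutPoints (hCk.image hγ) ?_ ⟨0, h0, rfl⟩ ⟨1, h1, rfl⟩ hne ?_
  · have key : ∀ u v : Set ℂ, IsClosed u → IsClosed v → γ '' C ⊆ u ∪ v → γ '' C ∩ (u ∩ v) = ∅ →
        γ 0 ∈ u → γ '' C ⊆ u := by
      rintro u v hu hv huv he h0u _ ⟨x, hx, rfl⟩
      by_contra hxu
      have hxv := (huv ⟨x, hx, rfl⟩).resolve_left hxu
      obtain ⟨t, ⟨htC, htv⟩, htmin⟩ := (hcomp v hv).exists_isLeast ⟨x, hx, hxv⟩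
      obtain ⟨s, ⟨⟨hsC, hsu⟩, hst⟩, hsmax⟩ := ((hcomp u hu).inter_right
        (isClosed_Iic (a := t))).exists_isGreatest ⟨0, ⟨h0, h0u⟩, (hCI htC).1⟩
      have hne : s ≠ t := by
        rintro rfl
        exact (he ▸ (show γ s ∈ γ '' C ∩ (u ∩ v) from ⟨⟨s, hsC, rfl⟩, hsu, htv⟩) :
          γ s ∈ (∅ : Set ℂ))
      have heq := hgap s hsC t htC (lt_of_le_of_ne hst hne) (by
        rintro z hz ⟨h1, h2⟩
        rcases huv ⟨z, hz, rfl⟩ with h | h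
        · exact absurd (hsmax ⟨⟨hz, h⟩, h2.le⟩) (not_le.2 h1)
        · exact absurd (htmin ⟨hz, h⟩) (not_le.2 h2))
      exact (he ▸ (show γ s ∈ γ '' C ∩ (u ∩ v) from ⟨⟨s, hsC, rfl⟩, hsu, by
        rw [heq]; exact htv⟩) : γ s ∈ (∅ : Set ℂ))
    rw [isPreconnected_iff_subset_of_disjoint_closed]
    intro u v hu hv huv he
    rcases huv ⟨0, h0, rfl⟩ with h | h
    · exact .inl (key u v hu hv huv he h)
    · exact .inr (key v u hv hu (by rwa [union_comm]) (by rwa [inter_comm v u]) h)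
  · rintro c ⟨r, hr, hrc⟩ hca hcb
    obtain ⟨r₁, ⟨hr₁C, hr₁c⟩, hr₁min⟩ := (hcomp {c} isClosed_singleton).exists_isLeast ⟨r, hr, hrc⟩
    obtain ⟨r₂, ⟨hr₂C, hr₂c⟩, hr₂max⟩ :=
      (hcomp {c} isClosed_singleton).exists_isGreatest ⟨r, hr, hrc⟩
    have hr₁₂ : r₁ ≤ r₂ := hr₁min ⟨hr₂C, hr₂c⟩
    have hP : IsCompact (γ '' (C ∩ Iic r₁)) := (hCk.inter_right isClosed_Iic).image hγ
    have hN : IsCompact (γ '' (C ∩ Ici r₂)) := (hCk.inter_right isClosed_Ici).image hγ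
    have hcov : ∀ x ∈ C, x ≤ r₁ ∨ r₂ ≤ x := by
      intro x hx
      by_contra! h
      exact fib r₁ hr₁C r₂ hr₂C (by rw [hr₁c, hr₂c]) x hx h
    have hPN : ∀ z, z ≠ c → z ∈ γ '' (C ∩ Iic r₁) → z ∉ γ '' (C ∩ Ici r₂) := by
      rintro _ hz ⟨x, ⟨hx, hxr⟩, rfl⟩ ⟨y, ⟨hy, hyr⟩, hxy⟩
      have h1 : x ≠ r₁ := fun h ↦ hz (h ▸ hr₁c)
      have h2 : y ≠ r₁ := fun h ↦ hz (by rw [← hxy, h]; exact hr₁c)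
      exact fib x hx y hy hxy.symm r₁ hr₁C ⟨lt_of_le_of_ne hxr h1,
        lt_of_le_of_ne (hr₁₂.trans hyr) h2.symm⟩
    refine ⟨(γ '' (C ∩ Ici r₂))ᶜ, (γ '' (C ∩ Iic r₁))ᶜ, hN.isClosed.isOpen_compl,
      hP.isClosed.isOpen_compl, ?_, ?_, ?_, ?_⟩
    · exact hPN _ hca.symm ⟨0, ⟨h0, (hCI hr₁C).1⟩, rfl⟩
    · exact fun h ↦ hPN _ hcb.symm h ⟨1, ⟨h1, (hCI hr₂C).2⟩, rfl⟩
    · rintro z ⟨-, hz⟩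
      by_cases h : z ∈ γ '' (C ∩ Iic r₁)
      · exact .inl (hPN z hz h)
      · exact .inr h
    · rintro _ ⟨x, hx, rfl⟩ hz hzN hzP
      rcases hcov x hx with h | h
      · exact hzP ⟨x, ⟨hx, h⟩, rfl⟩
      · exact hzN ⟨x, ⟨hx, h⟩, rfl⟩

lemma _root_.JoinedIn.exists_isArc {S : Set ℂ} {a b : ℂ} (h : JoinedIn S a b) (hab : a ≠ b) :
    ∃ A ⊆ S, IsArc A a b := by
  obtain ⟨γ, hγ⟩ := h
  obtain ⟨A, hA, hA'⟩ := exists_isArc_subset γ.continuous_extend (by simpa using hab)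
  rw [γ.extend_zero, γ.extend_one] at hA'
  refine ⟨A, hA.trans ?_, hA'⟩
  rintro _ ⟨t, ht, rfl⟩
  rw [γ.extend_apply ht]
  exact hγ _

end PathToArc

section Accessibility

/-- Concatenation of infinitely many paths shrinking to a point. -/
lemma joinedIn_of_seq {S : Set ℂ} {x : ℂ} (hx : x ∈ S) (y : ℕ → ℂ)
    (h : ∀ n, JoinedIn (S ∩ ball x ((1 / 2) ^ n)) (y n) (y (n + 1))) : JoinedIn S (y 0) x := by
  choose P hP using h
  let G : ℕ → ℝ → ℂ := fun n s ↦ (P n).extend (2 ^ (n + 1) * (s - (1 - (1 / 2) ^ n))) - y n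
  have hPm : ∀ n s, (P n).extend s ∈ S ∩ ball x ((1 / 2) ^ n) := by
    intro n s
    have : (P n).extend s ∈ range (P n).extend := ⟨s, rfl⟩
    rw [Path.extend_range] at this
    obtain ⟨t, ht⟩ := this
    rw [← ht]
    exact hP n t
  have hy : ∀ n, dist (y n) x < (1 / 2) ^ n := fun n ↦ by
    have := (hPm n 0).2
    rwa [Path.extend_zero] at this
  have hGc : ∀ n, Continuous (G n) := fun n ↦ by
    have := (P n).continuous_extend
    fun_prop
  have hGb : ∀ n s, ‖G n s‖ ≤ 2 * (1 / 2) ^ n := fun n s ↦ by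
    have h1 := (hPm n (2 ^ (n + 1) * (s - (1 - (1 / 2) ^ n)))).2
    have h2 := hy n
    rw [mem_ball] at h1
    rw [← dist_eq_norm]
    linarith [dist_triangle_right ((P n).extend (2 ^ (n + 1) * (s - (1 - (1 / 2) ^ n)))) (y n) x]
  have hsum : Summable fun n : ℕ ↦ (2 : ℝ) * (1 / 2) ^ n :=
    (summable_geometric_of_lt_one (by norm_num) (by norm_num)).mul_left 2
  have hF : Continuous fun s ↦ y 0 + ∑' n, G n s :=
    continuous_const.add (continuous_tsum hGc hsum hGb)
  have hpow : ∀ n : ℕ, (2 : ℝ) ^ (n + 1) * (1 / 2) ^ (n + 1) = 1 := fun n ↦ by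
    rw [← mul_pow]
    norm_num
  have hG1 : ∀ n s, 1 - (1 / 2) ^ (n + 1) ≤ s → G n s = y (n + 1) - y n := by
    intro n s hs
    simp only [G]
    rw [Path.extend_of_one_le]
    have h2 : (0 : ℝ) < 2 ^ (n + 1) := by positivity
    have h3 : (1 / 2 : ℝ) ^ n = 2 * (1 / 2) ^ (n + 1) := by ring
    calc (1 : ℝ) = 2 ^ (n + 1) * (1 / 2) ^ (n + 1) := (hpow n).symm
      _ ≤ _ := by gcongr; rw [h3]; linarith
  have hG0 : ∀ n s, s ≤ 1 - (1 / 2) ^ n → G n s = 0 := by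
    intro n s hs
    simp only [G]
    rw [Path.extend_of_le_zero, sub_self]
    exact mul_nonpos_of_nonneg_of_nonpos (by positivity) (by linarith)
  have hx1 : y 0 + ∑' n, G n 1 = x := by
    have h1 : ∀ n, G n 1 = y (n + 1) - y n := fun n ↦ hG1 n 1 (by
      have : (0 : ℝ) < (1 / 2) ^ (n + 1) := by positivity
      linarith)
    have hs : Summable fun n ↦ G n 1 := hsum.of_norm_bounded (fun n ↦ hGb n 1)
    have ht := hs.hasSum.tendsto_sum_nat
    simp only [h1, Finset.sum_range_sub] at ht
    have hyx : Tendsto y atTop (𝓝 x) := by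
      rw [tendsto_iff_dist_tendsto_zero]
      exact squeeze_zero (fun _ ↦ dist_nonneg) (fun n ↦ (hy n).le)
        (tendsto_pow_atTop_nhds_zero_of_lt_one (by norm_num) (by norm_num))
    have := tendsto_nhds_unique ht (hyx.sub_const (y 0))
    simp only [h1, this]
    ring
  refine JoinedIn.ofLine (f := fun s ↦ y 0 + ∑' n, G n s) hF.continuousOn ?_ ?_ ?_
  · have : ∀ n, G n 0 = 0 := fun n ↦ hG0 n 0 (by
      have : (1 / 2 : ℝ) ^ n ≤ 1 := pow_le_one₀ (by norm_num) (by norm_num)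
      linarith)
    simp [this]
  · exact hx1
  · rintro _ ⟨s, hs, rfl⟩
    rcases eq_or_lt_of_le hs.2 with rfl | hs1
    · simpa only [hx1] using hx
    have hex : ∃ N : ℕ, s < 1 - (1 / 2) ^ (N + 1) := by
      obtain ⟨N, hN⟩ := exists_pow_lt_of_lt_one (sub_pos.2 hs1) (show (1 / 2 : ℝ) < 1 by norm_num)
      refine ⟨N, ?_⟩
      have : (1 / 2 : ℝ) ^ (N + 1) ≤ (1 / 2) ^ N :=
        pow_le_pow_of_le_one (by norm_num) (by norm_num) (by omega)
      linarith
    classical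
    let N := Nat.find hex
    have hN : s < 1 - (1 / 2) ^ (N + 1) := Nat.find_spec hex
    have hlow : ∀ n < N, 1 - (1 / 2) ^ (n + 1) ≤ s := fun n hn ↦ not_lt.1 (Nat.find_min hex hn)
    have hhigh : ∀ n, n ∉ Finset.range (N + 1) → G n s = 0 := by
      intro n hn
      rw [Finset.mem_range, not_lt] at hn
      refine hG0 n s (hN.le.trans ?_)
      have : (1 / 2 : ℝ) ^ n ≤ (1 / 2) ^ (N + 1) :=
        pow_le_pow_of_le_one (by norm_num) (by norm_num) hn
      linarith
    have hval : (∑' n, G n s) = y N - y 0 + G N s := by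
      rw [tsum_eq_sum hhigh, Finset.sum_range_succ, ← Finset.sum_range_sub]
      congr 1
      exact Finset.sum_congr rfl fun n hn ↦ hG1 n s (hlow n (Finset.mem_range.1 hn))
    simp only [hval]
    convert (hPm N (2 ^ (N + 1) * (s - (1 - (1 / 2) ^ N)))).1 using 1
    simp only [G]
    ring

variable {J : Set ℂ}

/-- Nearby points of one complementary component are joined by a small connected set. -/
lemma IsJordan.exists_locally_unsep (hJ : IsJordan J) {x : ℂ} (hx : x ∈ J) {ε : ℝ} (hε : 0 < ε) :
    ∃ δ > 0, ∀ p ∈ ball x δ, ∀ q ∈ ball x δ, Unsep J p q → Unsep (J ∪ (ball x ε)ᶜ) p q := by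
  obtain ⟨A, B, a, b, hs, hA, hxB⟩ := hJ.exists_small_split hx hε
  obtain ⟨δ₀, hδ₀, hball⟩ := Metric.isOpen_iff.1 hs.right.isCompact.isClosed.isOpen_compl x hxB
  refine ⟨min δ₀ ε, lt_min hδ₀ hε, fun p hp q hq hpq ↦ ?_⟩
  have hd : Disjoint (ball x (min δ₀ ε)) (B ∪ sphere x ε) := by
    refine disjoint_left.2 fun z hz hz' ↦ ?_
    rcases hz' with hz' | hz'
    · exact hball (ball_subset_ball (min_le_left _ _) hz) hz'
    · exact (ball_subset_ball (min_le_right _ _) hz : dist z x < ε).ne hz'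
  have h2 : Unsep (B ∪ sphere x ε) p q :=
    unsep_of_isPreconnected (convex_ball x _).isPreconnected hd hp hq
  have hAB : J ∩ (B ∪ sphere x ε) = B := by
    apply Subset.antisymm
    · rintro z ⟨hzJ, hz | hz⟩
      · exact hz
      · rw [← hs.union] at hzJ
        refine hzJ.resolve_left fun hzA ↦ ?_
        exact (hA hzA : dist z x < ε).ne hz
    · exact fun z hz ↦ ⟨hs.right_subset hz, .inl hz⟩
  obtain ⟨C, hC, hpC, hqC, hCd⟩ := hpq.union hJ.isCompact
    (hs.right.isCompact.union (isCompact_sphere x ε))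
    (by rw [hAB]; exact hs.right.isPreconnected) h2
  refine ⟨C, hC, hpC, hqC, disjoint_left.2 ?_⟩
  rintro z hz (hzJ | hzb)
  · exact disjoint_left.1 hCd hz (.inl hzJ)
  · obtain ⟨w, hwC, hw⟩ := hC.inter_frontier_nonempty' (S := ball x ε)
      ⟨p, hpC, ball_subset_ball (min_le_right _ _) hp⟩ ⟨z, hz, hzb⟩
    rw [frontier_ball x hε.ne'] at hw
    exact disjoint_left.1 hCd hwC (.inr (.inr hw))

lemma Unsep.joinedIn {K : Set ℂ} (hK : IsClosed K) {p q : ℂ} (h : Unsep K p q) :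
    JoinedIn Kᶜ p q := by
  obtain ⟨hp, hq⟩ := unsep_iff.1 h
  have ho : IsOpen (connectedComponentIn Kᶜ p) := hK.isOpen_compl.connectedComponentIn
  have hc : IsConnected (connectedComponentIn Kᶜ p) := isConnected_connectedComponentIn_iff.2 hp
  exact ((ho.isConnected_iff_isPathConnected.1 hc).joinedIn p (mem_connectedComponentIn hp) q
    hq).mono (connectedComponentIn_subset _ _)

lemma _root_.JoinedIn.mono_component {K : Set ℂ} {p q : ℂ} (h : JoinedIn Kᶜ p q) :
    JoinedIn (connectedComponentIn Kᶜ p) p q := by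
  obtain ⟨γ, hγ⟩ := h
  refine ⟨γ, fun t ↦ ?_⟩
  refine (isPreconnected_range γ.continuous).subset_connectedComponentIn ⟨0, by simp⟩ ?_ ⟨t, rfl⟩
  rintro _ ⟨t, rfl⟩
  exact hγ t

/-- Every point of a Jordan curve is accessible from each complementary component. -/
lemma IsJordan.joinedIn_component (hJ : IsJordan J) {x p : ℂ} (hx : x ∈ J) (hp : p ∉ J) :
    JoinedIn (insert x (connectedComponentIn Jᶜ p)) p x := by
  choose δ hδ hδu using fun n : ℕ ↦
    hJ.exists_locally_unsep hx (show (0 : ℝ) < (1 / 2) ^ n by positivity)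
  have hex : ∀ n, ∃ y ∈ connectedComponentIn Jᶜ p, dist x y < min (δ n) (δ (n - 1)) := fun n ↦
    Metric.mem_closure_iff.1 (hJ.subset_closure_component hp hx) _ (lt_min (hδ _) (hδ _))
  choose y hy hyd using hex
  have hpy : ∀ n, Unsep J p (y n) := fun n ↦ unsep_iff.2 ⟨hp, hy n⟩
  have hstep : ∀ n, JoinedIn (insert x (connectedComponentIn Jᶜ p) ∩ ball x ((1 / 2) ^ n))
      (y n) (y (n + 1)) := by
    intro n
    have h1 : y n ∈ ball x (δ n) := by
      rw [mem_ball, dist_comm]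
      exact (hyd n).trans_le (min_le_left _ _)
    have h2 : y (n + 1) ∈ ball x (δ n) := by
      rw [mem_ball, dist_comm]
      exact (hyd (n + 1)).trans_le (min_le_right _ _)
    have h3 := hδu n _ h1 _ h2 ((hpy n).symm.trans (hpy (n + 1)))
    have h4 := (h3.joinedIn (hJ.isCompact.isClosed.union isOpen_ball.isClosed_compl)).mono_component
    refine h4.mono fun z hz ↦ ?_
    have hz' := connectedComponentIn_subset _ _ hz
    rw [compl_union, compl_compl] at hz'
    refine ⟨.inr ?_, hz'.2⟩
    have : Unsep (J ∪ (ball x ((1 / 2) ^ n))ᶜ) (y n) z := unsep_iff.2 ⟨h3.left_notMem, hz⟩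
    exact (unsep_iff.1 ((hpy n).trans (this.mono subset_union_left))).2
  have h0 := ((hpy 0).joinedIn hJ.isCompact.isClosed).mono_component
  exact (h0.mono (subset_insert _ _)).trans (joinedIn_of_seq (mem_insert _ _) y hstep)

lemma IsJordan.exists_crosscut_arc (hJ : IsJordan J) {a b : ℂ} (ha : a ∈ J) (hb : b ∈ J)
    (hab : a ≠ b) : ∃ α, IsArc α a b ∧ α \ {a, b} ⊆ inside J := by
  obtain ⟨p, hp⟩ := hJ.inside_nonempty
  have hsub : connectedComponentIn Jᶜ p ⊆ inside J := fun q hq ↦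
    (unsep_iff.2 ⟨hp.1, hq⟩).mem_inside hp
  have h1 := (hJ.joinedIn_component ha hp.1).mono
    (insert_subset_insert hsub |>.trans (insert_subset_insert (subset_insert b _)))
  have h2 := (hJ.joinedIn_component hb hp.1).mono
    (insert_subset_insert hsub |>.trans (subset_insert a _))
  obtain ⟨α, hα, hα'⟩ := (h1.symm.trans h2).exists_isArc hab
  refine ⟨α, hα', fun z hz ↦ ?_⟩
  rcases hα hz.1 with h | h | h
  · exact absurd (.inl h) hz.2
  · exact absurd (.inr h) hz.2
  · exact h

end Accessibility

section Mesh

/-- A property of Jordan curves that holds for a curve as soon as it holds for the two curves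
into which some crosscut divides it. -/
def CutClosed (Q : Set ℂ → Prop) : Prop :=
  ∀ J a b α, IsJordan J → a ∈ J → b ∈ J → IsArc α a b → α \ {a, b} ⊆ inside J →
    (∀ A B, Split J A B a b → Q (A ∪ α)) → Q J

lemma CutClosed.imp {Q P : Set ℂ → Prop} (hQ : CutClosed Q)
    (hP : ∀ J J', IsJordan J → IsJordan J' → inside J' ⊆ inside J → P J → P J') :
    CutClosed fun J ↦ P J → Q J := fun J a b α hJ ha hb hα hαJ h hPJ ↦
  hQ J a b α hJ ha hb hα hαJ fun A B hAB ↦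
    have hc : Crosscut J A B α a b := ⟨hAB, hα, hαJ⟩
    h A B hAB (hP J _ hJ hc.isJordan_left (hc.inside_left_subset hJ) hPJ)

lemma IsJordan.subset_of_inside_subset {J C : Set ℂ} (hJ : IsJordan J) (hC : IsClosed C)
    (h : inside J ⊆ C) : J ⊆ C :=
  hJ.subset_closure_inside.trans (hC.closure_subset_iff.2 h)

/-- Nearby points of a Jordan curve are joined by a small arc of the curve. -/
lemma IsJordan.exists_small_arc {J : Set ℂ} (hJ : IsJordan J) {ε : ℝ} (hε : 0 < ε) :
    ∃ δ > 0, ∀ a ∈ J, ∀ b ∈ J, a ≠ b → dist a b < δ → ∃ A B, Split J A B a b ∧ A ⊆ ball a ε := by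
  obtain ⟨γ, hγ, rfl⟩ := hJ
  have huc : UniformContinuousOn γ (Icc (-1) 3) :=
    isCompact_Icc.uniformContinuousOn_of_continuous hγ.cont.continuousOn
  obtain ⟨ω, hω, h⟩ := Metric.uniformContinuousOn_iff.1 huc ε hε
  set S : Set (ℝ × ℝ) := {x | x.1 ∈ Icc 0 1 ∧ x.1 + ω ≤ x.2 ∧ x.2 ≤ x.1 + 1 - ω} with hS
  have hSc : IsCompact S := by
    have h1 : IsClosed {x : ℝ × ℝ | x.1 + ω ≤ x.2} := isClosed_le (by fun_prop) (by fun_prop)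
    have h2 : IsClosed {x : ℝ × ℝ | x.2 ≤ x.1 + 1 - ω} := isClosed_le (by fun_prop) (by fun_prop)
    refine ((isCompact_Icc (a := (0 : ℝ)) (b := 1)).prod (isCompact_Icc (a := (0 : ℝ)) (b := 2))).of_isClosed_subset
      ((isClosed_Icc.preimage continuous_fst).inter (h1.inter h2)) ?_
    rintro ⟨x, y⟩ ⟨h1, h2, h3⟩
    simp only [mem_Icc] at h1 h2 h3
    exact ⟨h1, by constructor <;> linarith⟩
  obtain ⟨δ, hδ, hδS⟩ : ∃ δ > 0, ∀ x ∈ S, δ ≤ dist (γ x.1) (γ x.2) := by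
    rcases S.eq_empty_or_nonempty with he | hne
    · exact ⟨1, one_pos, by simp [he]⟩
    obtain ⟨x, hx, hmin⟩ := hSc.exists_isMinOn hne
      (f := fun x : ℝ × ℝ ↦ dist (γ x.1) (γ x.2))
      ((hγ.cont.comp continuous_fst).dist (hγ.cont.comp continuous_snd)).continuousOn
    refine ⟨_, dist_pos.2 fun heq ↦ ?_, fun y hy ↦ hmin hy⟩
    have := hγ.injOn (s := x.1) (t := x.2) (by linarith [hx.2.2])
      ⟨le_rfl, by linarith [hx.2.1]⟩ ⟨by linarith [hx.2.1], le_rfl⟩ heq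
    linarith [hx.2.1]
  refine ⟨δ, hδ, ?_⟩
  rintro _ ⟨x, rfl⟩ b hb hab hd
  obtain ⟨s, hs, hsx⟩ := hγ.exists_mem_Ico 0 x
  rw [← hsx] at hab hd ⊢
  obtain ⟨y, rfl⟩ := hb
  obtain ⟨t, ht, hty⟩ := hγ.exists_mem_Ico s y
  rw [← hty] at hab hd ⊢
  have hs' : s ∈ Icc (0 : ℝ) 1 := ⟨hs.1, by linarith [hs.2]⟩
  have hst : s < t := lt_of_le_of_ne ht.1 (by rintro rfl; exact hab rfl)
  by_cases h1 : s + ω ≤ t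
  · by_cases h2 : t ≤ s + 1 - ω
    · exact absurd hd (not_lt.2 (hδS (s, t) ⟨hs', h1, h2⟩))
    · refine ⟨_, _, (hγ.split hst ht.2).symm, ?_⟩
      rintro _ ⟨z, hz, rfl⟩
      rw [← hγ.add_one s]
      refine h z ⟨by linarith [hz.1, hs'.1], by linarith [hz.2, hs'.2]⟩ (s + 1)
        ⟨by linarith [hs'.1], by linarith [hs'.2]⟩ ?_
      rw [Real.dist_eq, abs_lt]
      constructor <;> linarith [hz.1, hz.2]
  · refine ⟨_, _, hγ.split hst ht.2, ?_⟩
    rintro _ ⟨z, hz, rfl⟩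
    refine h z ⟨by linarith [hz.1, hs'.1], by linarith [hz.2, hs'.2, ht.2]⟩ s
      ⟨by linarith [hs'.1], by linarith [hs'.2]⟩ ?_
    rw [Real.dist_eq, abs_lt]
    constructor <;> linarith [hz.1, hz.2]

/-- The line at height `c` parallel to `e`, parametrized by arc length when `‖e‖ = 1`. -/
noncomputable def line (e : ℂ) (c t : ℝ) : ℂ := (t + c * Complex.I) * e

/-- The height of a point above the line through `0` parallel to `e`, when `‖e‖ = 1`. -/
noncomputable def height (e z : ℂ) : ℝ := (z * (starRingEnd ℂ) e).im

variable {e : ℂ} {c : ℝ}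

lemma continuous_line : Continuous (line e c) := by unfold line; fun_prop

lemma continuous_height : Continuous (height e) := by
  unfold height
  exact Complex.continuous_im.comp (continuous_id.mul continuous_const)

lemma dist_line (he : ‖e‖ = 1) (s t : ℝ) : dist (line e c s) (line e c t) = |s - t| := by
  rw [dist_eq_norm, line, line, ← sub_mul, norm_mul, he, mul_one, add_sub_add_right_eq_sub,
    ← Complex.ofReal_sub, Complex.norm_real, Real.norm_eq_abs]

lemma line_injective (he : ‖e‖ = 1) : Function.Injective (line e c) := fun s t h ↦ by
  have := dist_line (c := c) he s t
  rw [h, dist_self] at this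
  linarith [abs_eq_zero.1 this.symm]

lemma mul_conj_of_norm (he : ‖e‖ = 1) : e * (starRingEnd ℂ) e = 1 := by
  rw [Complex.mul_conj, Complex.normSq_eq_norm_sq, he]; norm_num

lemma height_line (he : ‖e‖ = 1) (t : ℝ) : height e (line e c t) = c := by
  rw [height, line, mul_assoc, mul_conj_of_norm he]
  simp

lemma exists_line_eq (he : ‖e‖ = 1) {z : ℂ} (hz : height e z = c) : ∃ t, line e c t = z := by
  refine ⟨(z * (starRingEnd ℂ) e).re, ?_⟩
  rw [line, ← hz, height, Complex.re_add_im, mul_assoc, mul_comm _ e, mul_conj_of_norm he, mul_one]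

lemma abs_height_sub_le (he : ‖e‖ = 1) (z w : ℂ) : |height e z - height e w| ≤ dist z w := by
  rw [height, height, ← Complex.sub_im, ← sub_mul, dist_eq_norm]
  refine (Complex.abs_im_le_norm _).trans ?_
  rw [norm_mul, RCLike.norm_conj, he, mul_one]

lemma isArc_line (he : ‖e‖ = 1) {u v : ℝ} (huv : u < v) :
    IsArc (line e c '' Icc u v) (line e c u) (line e c v) :=
  isArc_image huv continuous_line.continuousOn (line_injective he).injOn

/-- The interval `(u, v)` of a line is a component of the part of the line inside `J`. -/
structure IsGap (e : ℂ) (c : ℝ) (J : Set ℂ) (u v : ℝ) : Prop where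
  lt : u < v
  subset : line e c '' Ioo u v ⊆ inside J
  left : line e c u ∈ J
  right : line e c v ∈ J

variable {J : Set ℂ} {u v : ℝ}

lemma IsGap.eq_of_mem {u' v' t : ℝ} (h : IsGap e c J u v) (h' : IsGap e c J u' v')
    (ht : t ∈ Ioo u v) (ht' : t ∈ Ioo u' v') : u = u' ∧ v = v' := by
  have key : ∀ x, line e c x ∈ J → x ∉ Ioo u v ∧ x ∉ Ioo u' v' := fun x hx ↦
    ⟨fun h1 ↦ (h.subset ⟨x, h1, rfl⟩).1 hx, fun h1 ↦ (h'.subset ⟨x, h1, rfl⟩).1 hx⟩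
  have h1 := (key _ h.left).2
  have h2 := (key _ h.right).2
  have h3 := (key _ h'.left).1
  have h4 := (key _ h'.right).1
  simp only [mem_Ioo, not_and_or, not_lt] at *
  constructor
  · rcases h1 with h1 | h1 <;> rcases h3 with h3 | h3 <;> linarith [ht.1, ht.2]
  · rcases h2 with h2 | h2 <;> rcases h4 with h4 | h4 <;> linarith [ht.1, ht.2]

lemma exists_isGap (hJ : IsJordan J) (he : ‖e‖ = 1) {t : ℝ} (ht : line e c t ∈ inside J) :
    ∃ u v, IsGap e c J u v ∧ t ∈ Ioo u v := by
  have ho : IsOpen (line e c ⁻¹' inside J) :=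
    (isOpen_inside hJ.isCompact.isClosed).preimage continuous_line
  have hb : Bornology.IsBounded (line e c ⁻¹' inside J) := by
    have hb := ((isCompact_fill hJ.isCompact).isBounded.subset inside_subset_fill)
    rw [Metric.isBounded_iff] at hb ⊢
    obtain ⟨C, hC⟩ := hb
    exact ⟨C, fun x hx y hy ↦ by
      have := hC hx hy
      rwa [dist_line he] at this⟩
  obtain ⟨R, hR⟩ := hb.subset_closedBall t
  have hR0 : 0 ≤ R := by simpa using (hR ht)
  have hout : ∀ x, x ∉ closedBall t R → x ∈ (line e c ⁻¹' inside J)ᶜ := fun x hx h ↦ hx (hR h)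
  obtain ⟨u, ⟨hu, huJ⟩, humax⟩ :=
    ((isCompact_Icc (a := t - (R + 1)) (b := t)).inter_right ho.isClosed_compl).exists_isGreatest
      ⟨t - (R + 1), ⟨le_rfl, by linarith⟩, hout _ (by
        rw [mem_closedBall, Real.dist_eq, not_le]
        rw [abs_of_nonpos] <;> linarith)⟩
  obtain ⟨v, ⟨hv, hvJ⟩, hvmin⟩ :=
    ((isCompact_Icc (a := t) (b := t + (R + 1))).inter_right ho.isClosed_compl).exists_isLeast
      ⟨t + (R + 1), ⟨by linarith, le_rfl⟩, hout _ (by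
        rw [mem_closedBall, Real.dist_eq, not_le]
        rw [abs_of_nonneg] <;> linarith)⟩
  have hut : u < t := lt_of_le_of_ne hu.2 (by rintro rfl; exact huJ ht)
  have htv : t < v := lt_of_le_of_ne hv.1 (by rintro rfl; exact hvJ ht)
  have hsub : line e c '' Ioo u v ⊆ inside J := by
    rintro _ ⟨x, hx, rfl⟩
    by_contra hxJ
    rcases le_total x t with h | h
    · exact absurd (humax ⟨⟨by linarith [hu.1, hx.1], h⟩, hxJ⟩) (not_le.2 hx.1)
    · exact absurd (hvmin ⟨⟨h, by linarith [hv.2, hx.2]⟩, hxJ⟩) (not_le.2 hx.2)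
  have hcl : line e c '' Icc u v ⊆ fill J := by
    rw [← closure_Ioo (hut.trans htv).ne]
    refine (image_closure_subset_closure_image continuous_line).trans ?_
    exact (isCompact_fill hJ.isCompact).isClosed.closure_subset_iff.2
      (hsub.trans inside_subset_fill)
  exact ⟨u, v, ⟨hut.trans htv, hsub,
    (hcl ⟨u, ⟨le_rfl, (hut.trans htv).le⟩, rfl⟩).resolve_right huJ,
    (hcl ⟨v, ⟨(hut.trans htv).le, le_rfl⟩, rfl⟩).resolve_right hvJ⟩, hut, htv⟩

lemma IsGap.inter_subset (h : IsGap e c J u v) : J ∩ line e c '' Icc u v ⊆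
    {line e c u, line e c v} := by
  rintro _ ⟨hz, t, ht, rfl⟩
  rcases eq_or_lt_of_le ht.1 with rfl | h1
  · simp
  rcases eq_or_lt_of_le ht.2 with rfl | h2
  · simp
  exact absurd hz (h.subset ⟨t, ⟨h1, h2⟩, rfl⟩).1

/-- A component of the part of a line inside `J` that separates, inside `J`, two points far from
the line. -/
structure IsBadGap (e : ℂ) (c η : ℝ) (J : Set ℂ) (x : ℝ × ℝ) : Prop where
  gap : IsGap e c J x.1 x.2
  sep : ∃ p ∈ inside J, ∃ q ∈ inside J, c + η ≤ height e p ∧ height e q ≤ c - η ∧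
    ¬ Unsep (J ∪ line e c '' Icc x.1 x.2) p q

variable {η : ℝ}

lemma IsJordan.isPreconnected (hJ : IsJordan J) : IsPreconnected J := by
  obtain ⟨γ, hγ, rfl⟩ := hJ
  exact isPreconnected_range hγ.cont

lemma finite_setOf_isBadGap (hJ : IsJordan J) (he : ‖e‖ = 1) (hη : 0 < η) :
    {x | IsBadGap e c η J x}.Finite := by
  obtain ⟨δ', hδ', hs⟩ := hJ.exists_small_arc (half_pos hη)
  set δ := min δ' (η / 2)
  have hδ : 0 < δ := lt_min hδ' (half_pos hη)
  have hlen : ∀ x, IsBadGap e c η J x → δ ≤ x.2 - x.1 := by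
    rintro ⟨u, v⟩ ⟨hg, p, hp, q, hq, hpc, hqc, hsep⟩
    by_contra! hlt
    simp only at hg hsep hlt
    refine hsep ?_
    have hd : ∀ t ∈ Icc u v, dist (line e c t) (line e c u) < δ := fun t ht ↦ by
      rw [dist_line he, abs_lt]
      constructor <;> linarith [ht.1, ht.2]
    obtain ⟨A, B, hAB, hA⟩ := hs _ hg.left _ hg.right
      ((line_injective he).ne hg.lt.ne)
      (by rw [dist_comm]; exact (hd v ⟨hg.lt.le, le_rfl⟩).trans_le (min_le_left _ _))
    have hsub : A ∪ line e c '' Icc u v ⊆ closedBall (line e c u) (η / 2) := by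
      refine union_subset (hA.trans ball_subset_closedBall) ?_
      rintro _ ⟨t, ht, rfl⟩
      exact (hd t ht).le.trans (min_le_right _ _)
    have hfar : ∀ z, η ≤ |height e z - c| → z ∈ outside (A ∪ line e c '' Icc u v) := by
      intro z hz
      refine mem_outside_of_notMem_closedBall (half_pos hη).le hsub fun h ↦ ?_
      have := abs_height_sub_le he z (line e c u)
      rw [height_line he] at this
      rw [mem_closedBall] at h
      linarith
    have hAc : IsCompact (A ∪ line e c '' Icc u v) :=
      hAB.left.isCompact.union (isCompact_Icc.image continuous_line)
    have h1 := unsep_of_mem_outside hAc.isBounded (hfar p ((by linarith : η ≤ _).trans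
      (le_abs_self _))) (hfar q ((by linarith : η ≤ _).trans (neg_le_abs _)))
    refine (Unsep.union hJ.isCompact hAc ?_ (hJ.unsep_of_mem_inside hp hq) h1).mono
      (union_subset_union_right _ subset_union_right)
    have : J ∩ (A ∪ line e c '' Icc u v) = A := by
      refine Subset.antisymm ?_ (subset_inter hAB.left_subset subset_union_left)
      rintro z ⟨hzJ, hz | hz⟩
      · exact hz
      · rcases hg.inter_subset ⟨hzJ, hz⟩ with rfl | rfl
        exacts [hAB.left.left_mem, hAB.left.right_mem]
    rw [this]
    exact hAB.left.isPreconnected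
  have hb : Bornology.IsBounded (line e c ⁻¹' J) := by
    have hb := hJ.isCompact.isBounded
    rw [Metric.isBounded_iff] at hb ⊢
    obtain ⟨C, hC⟩ := hb
    exact ⟨C, fun x hx y hy ↦ by
      have := hC hx hy
      rwa [dist_line he] at this⟩
  obtain ⟨R, hR⟩ := hb.subset_closedBall 0
  refine Finite.of_finite_image (f := fun x : ℝ × ℝ ↦ ⌊x.2 / δ⌋)
    ((finite_Icc ⌊-R / δ⌋ ⌊R / δ⌋).subset ?_) ?_
  · rintro _ ⟨x, hx, rfl⟩
    have := hR hx.gap.right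
    rw [mem_closedBall, dist_zero_right, Real.norm_eq_abs, abs_le] at this
    exact ⟨Int.floor_mono (by gcongr; exact this.1), Int.floor_mono (by gcongr; exact this.2)⟩
  · rintro ⟨u, v⟩ hx ⟨u', v'⟩ hx' hxx
    have hl := hlen _ hx
    have hl' := hlen _ hx'
    simp only at hl hl' hxx
    have habs := Int.abs_sub_lt_one_of_floor_eq_floor hxx
    rw [← sub_div, abs_div, abs_of_pos hδ, div_lt_one hδ, abs_lt] at habs
    have : max (max u u') (min v v' - δ) < min v v' := by
      refine max_lt (max_lt ?_ ?_) (by linarith) <;> refine lt_min ?_ ?_ <;>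
        linarith [hx.gap.lt, hx'.gap.lt]
    obtain ⟨t, ht1, ht2⟩ := exists_between this
    rw [max_lt_iff, max_lt_iff] at ht1
    rw [lt_min_iff] at ht2
    obtain ⟨h1, h2⟩ := hx.gap.eq_of_mem hx'.gap (t := t) ⟨ht1.1.1, ht2.1⟩ ⟨ht1.1.2, ht2.2⟩
    simp only at h1 h2
    rw [h1, h2]

lemma Crosscut.isBadGap_of_left {A B : Set ℂ} (hJ : IsJordan J) (he : ‖e‖ = 1)
    (h : Crosscut J A B (line e c '' Icc u v) (line e c u) (line e c v)) {x : ℝ × ℝ}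
    (hx : IsBadGap e c η (A ∪ line e c '' Icc u v) x) : IsBadGap e c η J x ∧ x ≠ (u, v) := by
  obtain ⟨u', v'⟩ := x
  obtain ⟨hg, p, hp, q, hq, hpc, hqc, hsep⟩ := hx
  simp only at hg hsep
  have huv : u < v := by
    by_contra! hvu
    rcases eq_or_lt_of_le hvu with rfl | hlt
    · exact h.arc.ne rfl
    · have := h.arc.left_mem
      rw [Icc_eq_empty (not_le.2 hlt), image_empty] at this
      exact this
  have hin := h.inside_left_subset hJ
  have hdis : ∀ t ∈ Icc u v, t ∉ Ioo u' v' := fun t ht ht' ↦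
    (hg.subset ⟨t, ht', rfl⟩).1 (.inr ⟨t, ht, rfl⟩)
  have hends : ∀ t, (u' ≤ t ∧ t ≤ v') → t ∈ Icc u v → t = u ∨ t = v := by
    intro t ht htI
    by_contra! hne
    have h1 := lt_of_le_of_ne htI.1 (Ne.symm hne.1)
    have h2 := lt_of_le_of_ne htI.2 hne.2
    have hm : max u u' < min v v' :=
      max_lt (lt_min huv (h1.trans_le ht.2)) (lt_min (ht.1.trans_lt h2) hg.lt)
    obtain ⟨w, hw1, hw2⟩ := exists_between hm
    rw [max_lt_iff] at hw1
    rw [lt_min_iff] at hw2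
    exact hdis w ⟨hw1.1.le, hw2.1.le⟩ ⟨hw1.2, hw2.2⟩
  have hmem : ∀ t, (u' ≤ t ∧ t ≤ v') → line e c t ∈ A ∪ line e c '' Icc u v →
      line e c t ∈ J := by
    rintro t ht (hA | ⟨w, hw, hwt⟩)
    · exact h.split.left_subset hA
    · rw [line_injective he hwt] at hw
      rcases hends t ht hw with rfl | rfl
      exacts [h.split.left_mem, h.split.right_mem]
  have hgap : IsGap e c J u' v' := ⟨hg.lt, hg.subset.trans hin,
    hmem _ ⟨le_rfl, hg.lt.le⟩ hg.left, hmem _ ⟨hg.lt.le, le_rfl⟩ hg.right⟩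
  refine ⟨⟨hgap, p, hin hp, q, hin hq, hpc, hqc, fun hun ↦ hsep ?_⟩, ?_⟩
  · simp only at hun
    have hc1 : IsCompact (J ∪ line e c '' Icc u' v') :=
      hJ.isCompact.union (isCompact_Icc.image continuous_line)
    have hout := h.inside_left_subset_outside hJ
    have h1 : Unsep ((A ∪ line e c '' Icc u v) ∪ (B ∪ line e c '' Icc u v)) p q := by
      refine Unsep.union h.isJordan_left.isCompact h.isJordan_right.isCompact ?_
        (h.isJordan_left.unsep_of_mem_inside hp hq)
        (unsep_of_mem_outside h.isJordan_right.isCompact.isBounded (hout hp) (hout hq))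
      rw [← inter_union_distrib_right, h.split.inter, union_eq_right.2 h.pair_subset_arc]
      exact h.arc.isPreconnected
    rw [← union_union_distrib_right, h.split.union] at h1
    refine (Unsep.union hc1 (hJ.isCompact.union h.arc.isCompact) ?_ hun h1).mono ?_
    · rw [← union_inter_distrib_left, union_eq_left.2]
      · exact hJ.isPreconnected
      rintro _ ⟨⟨t, ht, rfl⟩, t', ht', htt'⟩
      rw [line_injective he htt'] at ht'
      rcases hends t ht ht' with rfl | rfl
      exacts [h.split.left_mem, h.split.right_mem]
    · rintro z ((hz | hz) | hz)
      exacts [.inl (.inl (h.split.left_subset hz)), .inr (.inr hz), .inl (.inr hz)]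
  · rintro ⟨⟩
    exact hdis ((u + v) / 2) ⟨by linarith, by linarith⟩ ⟨by linarith, by linarith⟩

lemma unsep_union_gaps (hJ : IsJordan J) (he : ‖e‖ = 1) {K : Set ℂ} (hK : IsCompact K)
    (hJK : J ⊆ K) {p q : ℂ} (hp : Unsep K p q) (F : Finset (ℝ × ℝ))
    (hF : ∀ x ∈ F, IsGap e c J x.1 x.2 ∧ Unsep (J ∪ line e c '' Icc x.1 x.2) p q ∧
      K ∩ line e c '' Ioo x.1 x.2 = ∅) :
    Unsep (K ∪ ⋃ x ∈ F, line e c '' Icc x.1 x.2) p q := by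
  classical
  induction F using Finset.induction_on with
  | empty => simpa using hp
  | insert x F hxF ih =>
    obtain ⟨hg, hun, hd⟩ := hF x (Finset.mem_insert_self _ _)
    have ih := ih fun y hy ↦ hF y (Finset.mem_insert_of_mem hy)
    have hcF : IsCompact (K ∪ ⋃ x ∈ F, line e c '' Icc x.1 x.2) :=
      hK.union (F.isCompact_biUnion fun x _ ↦ isCompact_Icc.image continuous_line)
    refine (Unsep.union hcF (hJ.isCompact.union (isCompact_Icc.image continuous_line))
      ?_ ih hun).mono ?_
    · have : (K ∪ ⋃ x ∈ F, line e c '' Icc x.1 x.2) ∩ (J ∪ line e c '' Icc x.1 x.2) = J := by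
        refine Subset.antisymm ?_ fun z hz ↦ ⟨.inl (hJK hz), .inl hz⟩
        rintro z ⟨hz, hzJ | ⟨t, ht, rfl⟩⟩
        · exact hzJ
        rcases eq_or_lt_of_le ht.1 with rfl | h1
        · exact hg.left
        rcases eq_or_lt_of_le ht.2 with rfl | h2
        · exact hg.right
        rcases hz with hz | hz
        · exact absurd ⟨hz, t, ⟨h1, h2⟩, rfl⟩ (eq_empty_iff_forall_notMem.1 hd (line e c t))
        · simp only [mem_iUnion] at hz
          obtain ⟨y, hy, t', ht', htt⟩ := hz
          rw [line_injective he htt] at ht'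
          have hgy := (hF y (Finset.mem_insert_of_mem hy)).1
          rcases eq_or_lt_of_le ht'.1 with rfl | h1'
          · exact hgy.left
          rcases eq_or_lt_of_le ht'.2 with rfl | h2'
          · exact hgy.right
          have := hg.eq_of_mem hgy ⟨h1, h2⟩ ⟨h1', h2'⟩
          exact absurd (Prod.ext this.1 this.2 ▸ hy) hxF
      rw [this]
      exact hJ.isPreconnected
    · rintro z (hz | hz)
      · exact .inl (.inl hz)
      · simp only [mem_iUnion, Finset.mem_insert] at hz
        obtain ⟨y, rfl | hy, hz⟩ := hz
        · exact .inr (.inr hz)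
        · exact .inl (.inr (mem_biUnion hy hz))

/-- Two points inside `J` on opposite sides of a line are separated by a component of the part of
the line inside `J`. -/
lemma IsJordan.exists_separating_gap (hJ : IsJordan J) (he : ‖e‖ = 1) {p q : ℂ}
    (hp : p ∈ inside J) (hq : q ∈ inside J) (hpc : c < height e p) (hqc : height e q < c) :
    ∃ u v, IsGap e c J u v ∧ ¬ Unsep (J ∪ line e c '' Icc u v) p q := by
  by_contra! hall
  obtain ⟨γ, hγ⟩ := ((isOpen_inside hJ.isCompact.isClosed).isConnected_iff_isPathConnected.1
    hJ.isConnected_inside).joinedIn p hp q hq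
  set P := range γ with hP
  have hPc : IsCompact P := isCompact_range γ.continuous
  have hPi : P ⊆ inside J := by rintro _ ⟨t, rfl⟩; exact hγ t
  have hline : Topology.IsClosedEmbedding (line e c) :=
    (Isometry.of_dist_eq fun s t ↦ by rw [dist_line he, Real.dist_eq]).isClosedEmbedding
  have hTc : IsCompact (line e c ⁻¹' P) := hline.isCompact_preimage hPc
  have hgap : ∀ t ∈ line e c ⁻¹' P, ∃ x : ℝ × ℝ, IsGap e c J x.1 x.2 ∧ t ∈ Ioo x.1 x.2 :=
    fun t ht ↦ by
      obtain ⟨u, v, h1, h2⟩ := exists_isGap hJ he (hPi ht)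
      exact ⟨(u, v), h1, h2⟩
  obtain ⟨F, hFg, hFc⟩ : ∃ F : Finset (ℝ × ℝ), (∀ x ∈ F, IsGap e c J x.1 x.2) ∧
      line e c ⁻¹' P ⊆ ⋃ x ∈ F, Ioo x.1 x.2 := by
    obtain ⟨F, hF, hFf, hFs⟩ := hTc.elim_finite_subcover_image
      (b := {x : ℝ × ℝ | IsGap e c J x.1 x.2}) (c := fun x ↦ Ioo x.1 x.2)
      (fun _ _ ↦ isOpen_Ioo) fun t ht ↦ by
        obtain ⟨x, h1, h2⟩ := hgap t ht
        exact mem_biUnion h1 h2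
    exact ⟨hFf.toFinset, fun x hx ↦ hF (hFf.mem_toFinset.1 hx), by simpa using hFs⟩
  set K := J ∪ line e c '' (line e c ⁻¹' fill J \ ⋃ x ∈ F, Ioo x.1 x.2) with hK
  have hKc : IsCompact K := by
    refine hJ.isCompact.union (IsCompact.image ?_ continuous_line)
    exact (hline.isCompact_preimage (isCompact_fill hJ.isCompact)).diff
      (isOpen_biUnion fun _ _ ↦ isOpen_Ioo)
  have hKP : Unsep K p q := by
    refine ⟨P, isPreconnected_range γ.continuous, ⟨0, by simp⟩, ⟨1, by simp⟩,
      disjoint_left.2 ?_⟩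
    rintro z hz (hzJ | ⟨t, ⟨-, ht⟩, rfl⟩)
    · exact (hPi hz).1 hzJ
    · exact ht (hFc hz)
  obtain ⟨C, hC, hpC, hqC, hd⟩ := unsep_union_gaps (c := c) hJ he hKc subset_union_left hKP F
    fun x hx ↦ ⟨hFg x hx, hall _ _ (hFg x hx), by
      rw [eq_empty_iff_forall_notMem]
      rintro _ ⟨hz | ⟨t', ⟨-, ht'⟩, htt⟩, t, ht, rfl⟩
      · exact ((hFg x hx).subset ⟨t, ht, rfl⟩).1 hz
      · rw [line_injective he htt] at ht'
        exact ht' (mem_biUnion hx ht)⟩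
  obtain ⟨z, hzC, hz⟩ : ∃ z ∈ C, height e z = c := by
    have := (hC.image _ continuous_height.continuousOn).ordConnected.out ⟨q, hqC, rfl⟩
      ⟨p, hpC, rfl⟩ ⟨hqc.le, hpc.le⟩
    exact this
  have hzi : z ∈ inside J := Unsep.mem_inside
    (unsep_of_isPreconnected hC (hd.mono_right (subset_union_left.trans subset_union_left))
      hpC hzC) hp
  obtain ⟨t, rfl⟩ := exists_line_eq he hz
  refine disjoint_left.1 hd hzC ?_
  by_cases ht : t ∈ ⋃ x ∈ F, Ioo x.1 x.2
  · simp only [mem_iUnion] at ht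
    obtain ⟨x, hx, ht⟩ := ht
    exact .inr (mem_biUnion hx ⟨t, Ioo_subset_Icc_self ht, rfl⟩)
  · exact .inl (.inr ⟨t, ⟨.inr hzi, ht⟩, rfl⟩)

/-- No two points inside `J` lie far from the line on opposite sides. -/
def Thin (e : ℂ) (c η : ℝ) (J : Set ℂ) : Prop :=
  ∀ p ∈ inside J, ∀ q ∈ inside J, c + η ≤ height e p → c - η < height e q

lemma CutClosed.of_thin {Q : Set ℂ → Prop} (hQ : CutClosed Q) (he : ‖e‖ = 1) (hη : 0 < η)
    (h : ∀ J, IsJordan J → Thin e c η J → Q J) : ∀ J, IsJordan J → Q J := by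
  suffices ∀ n J, IsJordan J → {x | IsBadGap e c η J x}.ncard = n → Q J from
    fun J hJ ↦ this _ J hJ rfl
  intro n
  induction n using Nat.strong_induction_on with
  | _ n ih =>
  intro J hJ hn
  have hfin := finite_setOf_isBadGap (c := c) hJ he hη
  by_cases hbad : ∃ x, IsBadGap e c η J x
  · obtain ⟨x, hx⟩ := hbad
    have key : ∀ A B, Crosscut J A B (line e c '' Icc x.1 x.2) (line e c x.1) (line e c x.2) →
        Q (A ∪ line e c '' Icc x.1 x.2) := by
      intro A B hcr
      refine ih _ ?_ _ hcr.isJordan_left rfl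
      rw [← hn]
      refine ncard_lt_ncard ⟨fun y hy ↦ (hcr.isBadGap_of_left hJ he hy).1, fun hsub ↦ ?_⟩ hfin
      exact (hcr.isBadGap_of_left hJ he (hsub hx)).2 rfl
    have hsub : line e c '' Icc x.1 x.2 \ {line e c x.1, line e c x.2} ⊆ inside J := by
      rintro _ ⟨⟨t, ht, rfl⟩, hne⟩
      simp only [mem_insert_iff, mem_singleton_iff, not_or] at hne
      refine hx.gap.subset ⟨t, ⟨lt_of_le_of_ne ht.1 ?_, lt_of_le_of_ne ht.2 ?_⟩, rfl⟩
      · rintro rfl; exact hne.1 rfl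
      · rintro rfl; exact hne.2 rfl
    have hα := isArc_line (c := c) he hx.gap.lt
    exact hQ J _ _ _ hJ hx.gap.left hx.gap.right hα hsub fun A B hAB ↦ key A B ⟨hAB, hα, hsub⟩
  · refine h J hJ fun p hp q hq hpc ↦ ?_
    by_contra! hqc
    obtain ⟨u, v, hg, hsep⟩ := hJ.exists_separating_gap (c := c) he hp hq (by linarith)
      (by linarith)
    exact hbad ⟨(u, v), hg, p, hp, q, hq, hpc, hqc, hsep⟩

lemma CutClosed.of_forall_thin {Q : Set ℂ → Prop} (hQ : CutClosed Q) (he : ‖e‖ = 1)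
    (hη : 0 < η) (S : Finset ℝ) (h : ∀ J, IsJordan J → (∀ c ∈ S, Thin e c η J) → Q J) :
    ∀ J, IsJordan J → Q J := by
  classical
  induction S using Finset.induction_on generalizing Q with
  | empty => exact fun J hJ ↦ h J hJ (by simp)
  | insert c S hcS ih =>
    refine hQ.of_thin he hη (c := c) fun J hJ hth ↦ ?_
    refine ih (Q := fun J ↦ Thin e c η J → Q J) (hQ.imp ?_) (fun J hJ hS hc ↦ h J hJ ?_) J hJ hth
    · exact fun J J' _ _ hsub hJ p hp q hq ↦ hJ p (hsub hp) q (hsub hq)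
    · intro d hd
      rcases Finset.mem_insert.1 hd with rfl | hd
      exacts [hc, hS d hd]

lemma CutClosed.of_height_lt {Q : Set ℂ → Prop} (hQ : CutClosed Q) (he : ‖e‖ = 1)
    (hη : 0 < η) {R : ℝ} (h : ∀ J, IsJordan J → J ⊆ closedBall 0 R →
      (∀ p ∈ inside J, ∀ q ∈ inside J, height e p < height e q + 4 * η) → Q J) :
    ∀ J, IsJordan J → J ⊆ closedBall 0 R → Q J := by
  have himp : CutClosed fun J ↦ J ⊆ closedBall 0 R → Q J := by
    refine hQ.imp fun J J' hJ hJ' hsub hJR ↦ ?_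
    obtain ⟨z, hz, -⟩ := hJ.exists_ne
    have hR : 0 ≤ R := dist_nonneg.trans (hJR hz)
    exact hJ'.subset_of_inside_subset isClosed_closedBall
      (hsub.trans (inside_subset_fill.trans (fill_subset_closedBall hR hJR)))
  refine himp.of_forall_thin he hη ((Finset.Icc ⌊-R / η⌋ ⌊R / η⌋).image fun k : ℤ ↦ (k : ℝ) * η)
    fun J hJ hS hJR ↦ h J hJ hJR fun p hp q hq ↦ ?_
  by_contra! hpq
  obtain ⟨z, hz, -⟩ := hJ.exists_ne
  have hR : 0 ≤ R := dist_nonneg.trans (hJR hz)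
  have hb : ∀ z ∈ inside J, |height e z| ≤ R := fun z hz ↦ by
    have := abs_height_sub_le he z 0
    have h0 : height e 0 = 0 := by simp [height]
    rw [h0, sub_zero] at this
    exact this.trans (fill_subset_closedBall hR hJR (inside_subset_fill hz))
  have hbp := abs_le.1 (hb p hp)
  have hbq := abs_le.1 (hb q hq)
  set k := ⌊(height e q + 2 * η) / η⌋ with hk
  have h1 : (k : ℝ) * η ≤ height e q + 2 * η := by
    rw [← le_div_iff₀ hη]; exact Int.floor_le _
  have h2 : height e q + 2 * η < (k + 1) * η := by
    rw [← div_lt_iff₀ hη]; exact Int.lt_floor_add_one _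
  have := hS (k * η) (Finset.mem_image.2 ⟨k, Finset.mem_Icc.2
    ⟨Int.floor_mono (by gcongr; linarith), Int.floor_mono (by gcongr; linarith)⟩, rfl⟩) p hp q hq
    (by linarith)
  linarith

/-- A property that is inherited under gluing along crosscuts and holds for small Jordan curves
holds for all Jordan curves. -/
theorem CutClosed.of_small {Q : Set ℂ → Prop} (hQ : CutClosed Q) {ε : ℝ} (hε : 0 < ε)
    (h : ∀ J, IsJordan J → (∀ p ∈ fill J, ∀ q ∈ fill J, dist p q ≤ ε) → Q J) {J : Set ℂ}
    (hJ : IsJordan J) : Q J := by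
  obtain ⟨R, hR⟩ := hJ.isCompact.isBounded.subset_closedBall 0
  have hη : 0 < ε / 8 := by positivity
  have h1 : ‖(1 : ℂ)‖ = 1 := norm_one
  refine hQ.of_height_lt h1 hη (fun J hJ hJR hre ↦ ?_) J hJ hR
  have hcl : CutClosed fun J ↦ (∀ p ∈ inside J, ∀ q ∈ inside J,
      height 1 p < height 1 q + 4 * (ε / 8)) → Q J :=
    hQ.imp fun J J' _ _ hsub hJ p hp q hq ↦ hJ p (hsub hp) q (hsub hq)
  refine hcl.of_height_lt Complex.norm_I hη (fun J hJ _ him hre ↦ h J hJ ?_) J hJ hJR hre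
  have key : ∀ p ∈ inside J, ∀ q ∈ inside J, dist p q ≤ ε := by
    intro p hp q hq
    have e1 := hre p hp q hq
    have e2 := hre q hq p hp
    have e3 := him p hp q hq
    have e4 := him q hq p hp
    simp only [height, map_one, mul_one, Complex.conj_I, mul_neg, Complex.neg_im,
      Complex.mul_I_im] at e1 e2 e3 e4
    rw [dist_eq_norm]
    refine (Complex.norm_le_abs_re_add_abs_im _).trans ?_
    rw [Complex.sub_re, Complex.sub_im]
    have : |p.re - q.re| ≤ ε / 2 := abs_le.2 ⟨by linarith, by linarith⟩
    have : |p.im - q.im| ≤ ε / 2 := abs_le.2 ⟨by linarith, by linarith⟩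
    linarith
  have hsub : fill J ⊆ closure (inside J) :=
    union_subset hJ.subset_closure_inside subset_closure
  have hcl : IsClosed {x : ℂ × ℂ | dist x.1 x.2 ≤ ε} := isClosed_le (by fun_prop) (by fun_prop)
  intro p hp q hq
  have : (p, q) ∈ closure (inside J ×ˢ inside J) := by
    rw [closure_prod_eq]
    exact ⟨hsub hp, hsub hq⟩
  exact hcl.closure_subset_iff.2 (fun x hx ↦ key _ hx.1 _ hx.2) this

end Mesh

section Schoenflies

lemma IsJordan.fill_subset_of_inside_subset {J J' : Set ℂ} (hJ : IsJordan J) (hJ' : IsJordan J')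
    (h : inside J ⊆ inside J') : fill J ⊆ fill J' :=
  union_subset (hJ.subset_of_inside_subset (isCompact_fill hJ'.isCompact).isClosed
    (h.trans inside_subset_fill)) (h.trans inside_subset_fill)

/-- The part of the plane bounded by one of a pair of loops. -/
abbrev cell (δ : Bool → ℝ → ℂ) (b : Bool) : Set ℂ := fill (range (δ b))

/-- Simultaneous subdivisions, of the same combinatorial shape, of the two Jordan domains bounded
by a pair of loops. -/
structure Subdiv (γ : Bool → ℝ → ℂ) (S : Set (Bool → ℝ → ℂ)) : Prop where
  finite : S.Finite
  loop : ∀ δ ∈ S, ∀ b, IsLoop (δ b)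
  cover : ∀ b, cell γ b ⊆ ⋃ δ ∈ S, cell δ b
  inside : ∀ δ ∈ S, ∀ b, inside (range (δ b)) ⊆ inside (range (γ b))
  disj : ∀ δ ∈ S, ∀ δ' ∈ S, δ ≠ δ' → ∀ b, Disjoint (PlaneTopology.inside (range (δ b))) (cell δ' b)
  agree : ∀ δ ∈ S, ∀ b s t, δ b s = γ b t → δ (!b) s = γ (!b) t
  compat : ∀ δ ∈ S, ∀ δ' ∈ S, ∀ b s t, δ b s = δ' b t → δ (!b) s = δ' (!b) t

variable {γ : Bool → ℝ → ℂ} {S : Set (Bool → ℝ → ℂ)}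

lemma Subdiv.cell_subset (h : Subdiv γ S) (hγ : ∀ b, IsLoop (γ b)) {δ : Bool → ℝ → ℂ}
    (hδ : δ ∈ S) (b : Bool) : cell δ b ⊆ cell γ b :=
  (h.loop δ hδ b).isJordan.fill_subset_of_inside_subset (hγ b).isJordan (h.inside δ hδ b)

lemma subdiv_singleton (hγ : ∀ b, IsLoop (γ b)) : Subdiv γ {γ} where
  finite := finite_singleton γ
  loop := by simpa using ⟨hγ false, hγ true⟩
  cover := by simp
  inside := by simp
  disj := by
    rintro δ rfl δ' rfl h
    exact absurd rfl h
  agree := by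
    rintro δ rfl b s t h
    exact ((hγ _).eq_iff _ _).2 (((hγ b).eq_iff _ _).1 h)
  compat := by
    rintro δ rfl δ' rfl b s t h
    exact ((hγ _).eq_iff _ _).2 (((hγ b).eq_iff _ _).1 h)

lemma Subdiv.bind (h : Subdiv γ S)
    {T : (Bool → ℝ → ℂ) → Set (Bool → ℝ → ℂ)} (hT : ∀ δ ∈ S, Subdiv δ (T δ)) :
    Subdiv γ (⋃ δ ∈ S, T δ) where
  finite := h.finite.biUnion fun δ hδ ↦ (hT δ hδ).finite
  loop := by
    intro ε hε
    simp only [mem_iUnion] at hε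
    obtain ⟨δ, hδ, hε⟩ := hε
    exact (hT δ hδ).loop ε hε
  cover := by
    intro b x hx
    obtain ⟨δ, hδ, hx⟩ := mem_iUnion₂.1 (h.cover b hx)
    obtain ⟨ε, hε, hx⟩ := mem_iUnion₂.1 ((hT δ hδ).cover b hx)
    exact mem_biUnion (mem_biUnion hδ hε) hx
  inside := by
    intro ε hε b
    simp only [mem_iUnion] at hε
    obtain ⟨δ, hδ, hε⟩ := hε
    exact ((hT δ hδ).inside ε hε b).trans (h.inside δ hδ b)
  disj := by
    intro ε hε ε' hε' hne b
    simp only [mem_iUnion] at hε hε'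
    obtain ⟨δ, hδ, hε⟩ := hε
    obtain ⟨δ', hδ', hε'⟩ := hε'
    by_cases hd : δ = δ'
    · subst hd
      exact (hT δ hδ).disj ε hε ε' hε' hne b
    · exact (h.disj δ hδ δ' hδ' hd b).mono ((hT δ hδ).inside ε hε b)
        ((hT δ' hδ').cell_subset (h.loop δ' hδ') hε' b)
  agree := by
    intro ε hε b s t hst
    simp only [mem_iUnion] at hε
    obtain ⟨δ, hδ, hε⟩ := hε
    have h1 : γ b t ∈ cell δ b :=
      (hT δ hδ).cell_subset (h.loop δ hδ) hε b (hst ▸ .inl ⟨s, rfl⟩)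
    have h2 : γ b t ∉ PlaneTopology.inside (range (δ b)) := fun hin ↦
      (h.inside δ hδ b hin).1 ⟨t, rfl⟩
    obtain ⟨r, hr⟩ := h1.resolve_right h2
    exact ((hT δ hδ).agree ε hε b s r (hst.trans hr.symm)).trans (h.agree δ hδ b r t hr)
  compat := by
    intro ε hε ε' hε' b s t hst
    simp only [mem_iUnion] at hε hε'
    obtain ⟨δ, hδ, hε⟩ := hε
    obtain ⟨δ', hδ', hε'⟩ := hε'
    by_cases hd : δ = δ'
    · subst hd
      exact (hT δ hδ).compat ε hε ε' hε' b s t hst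
    have h1 : ε b s ∈ cell δ b :=
      (hT δ hδ).cell_subset (h.loop δ hδ) hε b (.inl ⟨s, rfl⟩)
    have h2 : ε b s ∈ cell δ' b :=
      (hT δ' hδ').cell_subset (h.loop δ' hδ') hε' b (hst ▸ .inl ⟨t, rfl⟩)
    obtain ⟨r, hr⟩ := h1.resolve_right fun hin ↦
      disjoint_left.1 (h.disj δ hδ δ' hδ' hd b) hin h2
    obtain ⟨r', hr'⟩ := h2.resolve_right fun hin ↦
      disjoint_left.1 (h.disj δ' hδ' δ hδ (Ne.symm hd) b) hin h1
    rw [(hT δ hδ).agree ε hε b s r hr.symm, (hT δ' hδ').agree ε' hε' b t r' (hst ▸ hr'.symm)]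
    exact h.compat δ hδ δ' hδ' b r r' (hr.trans hr'.symm)

lemma exists_joinLoop_eq (φ ψ : Bool → ℝ → ℂ) (x : ℝ) : ∃ y ∈ Icc (0 : ℝ) 1,
    (∀ c, joinLoop (φ c) (ψ c) x = φ c y) ∨ ∀ c, joinLoop (φ c) (ψ c) x = ψ c y := by
  have hf0 := Int.fract_nonneg x
  have hf1 := Int.fract_lt_one x
  by_cases h : Int.fract x ≤ 1 / 2
  · exact ⟨2 * Int.fract x, ⟨by linarith, by linarith⟩, .inl fun c ↦ by
      simp only [joinLoop, Function.comp, if_pos h]⟩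
  · exact ⟨2 - 2 * Int.fract x, ⟨by linarith, by linarith⟩, .inr fun c ↦ by
      simp only [joinLoop, Function.comp, if_neg h]⟩

/-- Crosscuts with corresponding ends, one in each coordinate, give a subdivision into two cells. -/
lemma subdiv_pair (hγ : ∀ b, IsLoop (γ b)) {s t : ℝ} (hst : s < t) (hts : t < s + 1)
    {α : Bool → Set ℂ} (hα : ∀ b, IsArc (α b) (γ b s) (γ b t))
    (hαi : ∀ b, α b \ {γ b s, γ b t} ⊆ inside (range (γ b))) :
    ∃ δ₁ δ₂, Subdiv γ {δ₁, δ₂} ∧ (∀ b, range (δ₁ b) = γ b '' Icc s t ∪ α b) ∧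
      ∀ b, range (δ₂ b) = γ b '' Icc t (s + 1) ∪ α b := by
  choose ψ hψc hψi hψ0 hψ1 hψα using hα
  have hcr : ∀ b, Crosscut (range (γ b)) (γ b '' Icc s t) (γ b '' Icc t (s + 1)) (α b)
      (γ b s) (γ b t) := fun b ↦
    ⟨(hγ b).split hst hts, ⟨ψ b, hψc b, hψi b, hψ0 b, hψ1 b, hψα b⟩, hαi b⟩
  set a₁ : ℝ → ℝ := fun x ↦ (t - s) * x + s with ha₁
  set a₂ : ℝ → ℝ := fun x ↦ (t - (s + 1)) * x + (s + 1) with ha₂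
  have hi₁ : a₁ '' Icc 0 1 = Icc s t := by
    rw [ha₁, image_affine_Icc' (sub_pos.2 hst)]; simp
  have hi₂ : a₂ '' Icc 0 1 = Icc t (s + 1) := by
    have : a₂ = (fun x ↦ (s + 1 - t) * x + t) ∘ fun x ↦ 1 - x := by
      ext x; simp only [ha₂, Function.comp]; ring
    rw [this, image_comp, image_const_sub_Icc, image_affine_Icc' (sub_pos.2 hts)]
    simp
  have hinj₁ : Function.Injective a₁ := fun x y h ↦ by
    simpa [ha₁, (sub_pos.2 hst).ne'] using h
  have hinj₂ : Function.Injective a₂ := fun x y h ↦ by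
    simpa [ha₂, (sub_neg.2 hts).ne] using h
  have hc₁ : Continuous a₁ := by fun_prop
  have hc₂ : Continuous a₂ := by fun_prop
  have hl₁ : ∀ b, IsLoop (joinLoop (γ b ∘ a₁) (ψ b)) := fun b ↦ by
    refine isLoop_joinLoop ((hγ b).cont.comp hc₁).continuousOn (hψc b) ?_ (hψi b) ?_ ?_ ?_
    · exact ((hγ b).injOn hts).comp hinj₁.injOn (mapsTo_iff_image_subset.2 hi₁.subset)
    · simp [ha₁, hψ0]
    · simp [ha₁, hψ1]
    · rw [image_comp, hi₁, hψα]
      simpa [ha₁] using (hcr b).inter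
  have hl₂ : ∀ b, IsLoop (joinLoop (γ b ∘ a₂) (ψ b)) := fun b ↦ by
    refine isLoop_joinLoop ((hγ b).cont.comp hc₂).continuousOn (hψc b) ?_ (hψi b) ?_ ?_ ?_
    · exact ((hγ b).injOn (by linarith)).comp hinj₂.injOn
        (mapsTo_iff_image_subset.2 hi₂.subset)
    · simp [ha₂, hψ0, (hγ b).add_one]
    · simp [ha₂, hψ1]
    · rw [image_comp, hi₂, hψα]
      simpa [ha₂, (hγ b).add_one] using (hcr b).symm.inter
  have hr₁ : ∀ b, range (joinLoop (γ b ∘ a₁) (ψ b)) = γ b '' Icc s t ∪ α b := fun b ↦ by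
    rw [range_joinLoop (by simp [ha₁, hψ0]) (by simp [ha₁, hψ1]), image_comp, hi₁, hψα]
  have hr₂ : ∀ b, range (joinLoop (γ b ∘ a₂) (ψ b)) = γ b '' Icc t (s + 1) ∪ α b := fun b ↦ by
    rw [range_joinLoop (by simp [ha₂, hψ0, (hγ b).add_one]) (by simp [ha₂, hψ1]), image_comp, hi₂,
      hψα]
  set δ₁ : Bool → ℝ → ℂ := fun b ↦ joinLoop (γ b ∘ a₁) (ψ b) with hδ₁
  set δ₂ : Bool → ℝ → ℂ := fun b ↦ joinLoop (γ b ∘ a₂) (ψ b) with hδ₂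
  have hpt : ∀ δ ∈ ({δ₁, δ₂} : Set (Bool → ℝ → ℂ)), ∀ x,
      (∃ r, ∀ c, δ c x = γ c r) ∨ ∃ r ∈ Icc (0 : ℝ) 1, ∀ c, δ c x = ψ c r := by
    rintro δ (rfl | rfl) x
    · obtain ⟨y, hy, h | h⟩ := exists_joinLoop_eq (fun b ↦ γ b ∘ a₁) ψ x
      exacts [.inl ⟨_, h⟩, .inr ⟨y, hy, h⟩]
    · obtain ⟨y, hy, h | h⟩ := exists_joinLoop_eq (fun b ↦ γ b ∘ a₂) ψ x
      exacts [.inl ⟨_, h⟩, .inr ⟨y, hy, h⟩]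
  have hγγ : ∀ b r r', γ b r = γ b r' → γ (!b) r = γ (!b) r' := fun b r r' h ↦
    ((hγ _).eq_iff _ _).2 (((hγ b).eq_iff _ _).1 h)
  have hψγ : ∀ b, ∀ r ∈ Icc (0 : ℝ) 1, ∀ r', ψ b r = γ b r' → ψ (!b) r = γ (!b) r' := by
    intro b r hr r' h
    have hmem : γ b r' ∈ ({γ b s, γ b t} : Set ℂ) := by
      by_contra hne
      exact (hαi b ⟨by rw [← hψα, ← h]; exact ⟨r, hr, rfl⟩, hne⟩).1 ⟨r', rfl⟩
    rcases hmem with h1 | h1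
    · rw [h1, ← hψ0] at h
      rw [hψi b hr (by simp) h, hψ0]
      exact hγγ b _ _ h1.symm
    · rw [mem_singleton_iff] at h1
      rw [h1, ← hψ1] at h
      rw [hψi b hr (by simp) h, hψ1]
      exact hγγ b _ _ h1.symm
  refine ⟨δ₁, δ₂, ⟨by simp, ?_, ?_, ?_, ?_, ?_, ?_⟩, hr₁, hr₂⟩
  · rintro δ (rfl | rfl)
    exacts [hl₁, hl₂]
  · intro b
    rw [biUnion_pair, cell, cell, cell, hr₁, hr₂]
    exact (hcr b).fill_subset (hγ b).isJordan
  · rintro δ (rfl | rfl) b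
    · rw [hr₁]
      exact (hcr b).inside_left_subset (hγ b).isJordan
    · rw [hr₂]
      exact (hcr b).symm.inside_left_subset (hγ b).isJordan
  · rintro δ (rfl | rfl) δ' (rfl | rfl) hne b
    · exact absurd rfl hne
    · rw [cell, hr₁, hr₂]
      exact (hcr b).disjoint (hγ b).isJordan
    · rw [cell, hr₁, hr₂]
      exact (hcr b).symm.disjoint (hγ b).isJordan
    · exact absurd rfl hne
  · intro δ hδ b x y h
    rcases hpt δ hδ x with ⟨r, hr⟩ | ⟨r, hrI, hr⟩
    · rw [hr] at h ⊢
      exact hγγ b _ _ h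
    · rw [hr] at h ⊢
      exact hψγ b r hrI _ h
  · intro δ hδ δ' hδ' b x y h
    rcases hpt δ hδ x with ⟨r, hr⟩ | ⟨r, hrI, hr⟩ <;>
      rcases hpt δ' hδ' y with ⟨r', hr'⟩ | ⟨r', hrI', hr'⟩ <;> rw [hr, hr'] at h ⊢
    · exact hγγ b _ _ h
    · exact (hψγ b r' hrI' _ h.symm).symm
    · exact hψγ b r hrI _ h
    · rw [hψi b hrI hrI' h]

lemma exists_subdiv_small_coord (b : Bool) {ε : ℝ} (hε : 0 < ε) (hγ : ∀ b, IsLoop (γ b)) :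
    ∃ S, Subdiv γ S ∧ ∀ δ ∈ S, ∀ p ∈ cell δ b, ∀ q ∈ cell δ b, dist p q ≤ ε := by
  have hQ : CutClosed fun J ↦ ∀ γ : Bool → ℝ → ℂ, (∀ b, IsLoop (γ b)) → range (γ b) = J →
      ∃ S, Subdiv γ S ∧ ∀ δ ∈ S, ∀ p ∈ cell δ b, ∀ q ∈ cell δ b, dist p q ≤ ε := by
    intro J x y α hJ hx hy hα hαJ h γ hγ hγJ
    subst hγJ
    obtain ⟨s, t, hst, hts, rfl, rfl⟩ := (hγ b).exists_params hx hy hα.ne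
    have hex : ∀ c, ∃ β, IsArc β (γ c s) (γ c t) ∧
        β \ {γ c s, γ c t} ⊆ inside (range (γ c)) ∧ (c = b → β = α) := by
      intro c
      by_cases hc : c = b
      · subst hc
        exact ⟨α, hα, hαJ, fun _ ↦ rfl⟩
      · obtain ⟨β, h1, h2⟩ := (hγ c).isJordan.exists_crosscut_arc (mem_range_self s)
          (mem_range_self t) ((hγ c).isArc hst hts).ne
        exact ⟨β, h1, h2, fun h ↦ absurd h hc⟩
    choose β hβ hβi hβb using hex
    obtain ⟨δ₁, δ₂, hS, hr₁, hr₂⟩ := subdiv_pair hγ hst hts hβ hβi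
    have hsp := (hγ b).split hst hts
    have hT : ∀ δ ∈ ({δ₁, δ₂} : Set (Bool → ℝ → ℂ)), ∃ T, Subdiv δ T ∧
        ∀ δ ∈ T, ∀ p ∈ cell δ b, ∀ q ∈ cell δ b, dist p q ≤ ε := by
      rintro δ (rfl | rfl)
      · exact h _ _ hsp δ (hS.loop δ (by simp)) (by rw [hr₁, hβb b rfl])
      · exact h _ _ hsp.symm δ (hS.loop δ (by simp)) (by rw [hr₂, hβb b rfl])
    choose! T hT hTs using hT
    refine ⟨_, hS.bind hT, fun δ hδ ↦ ?_⟩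
    obtain ⟨δ', hδ', hδ⟩ := mem_iUnion₂.1 hδ
    exact hTs δ' hδ' δ hδ
  refine hQ.of_small hε (fun J _ hJ γ hγ hγJ ↦ ⟨_, subdiv_singleton hγ, ?_⟩)
    (hγ b).isJordan γ hγ rfl
  rintro δ rfl
  rw [cell, hγJ]
  exact hJ

lemma exists_subdiv_small {ε : ℝ} (hε : 0 < ε) (hγ : ∀ b, IsLoop (γ b)) :
    ∃ S, Subdiv γ S ∧ ∀ δ ∈ S, ∀ b, ∀ p ∈ cell δ b, ∀ q ∈ cell δ b, dist p q ≤ ε := by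
  obtain ⟨S, hS, hSs⟩ := exists_subdiv_small_coord false hε hγ
  have hT : ∀ δ ∈ S, ∃ T, Subdiv δ T ∧
      ∀ δ' ∈ T, ∀ p ∈ cell δ' true, ∀ q ∈ cell δ' true, dist p q ≤ ε := fun δ hδ ↦
    exists_subdiv_small_coord true hε (hS.loop δ hδ)
  choose! T hT hTs using hT
  refine ⟨_, hS.bind hT, fun δ hδ ↦ ?_⟩
  obtain ⟨δ', hδ', hδ⟩ := mem_iUnion₂.1 hδ
  rintro (_ | _)
  · have hsub := (hT δ' hδ').cell_subset (hS.loop δ' hδ') hδ false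
    exact fun p hp q hq ↦ hSs δ' hδ' p (hsub hp) q (hsub hq)
  · exact hTs δ' hδ' δ hδ

lemma Subdiv.exists_refinement (hS : Subdiv γ S) {ε : ℝ} (hε : 0 < ε) :
    ∃ S', Subdiv γ S' ∧ (∀ δ ∈ S', ∀ b, ∀ p ∈ cell δ b, ∀ q ∈ cell δ b, dist p q ≤ ε) ∧
      ∀ δ ∈ S', ∃ δ' ∈ S, ∀ b, cell δ b ⊆ cell δ' b := by
  have hT : ∀ δ ∈ S, ∃ T, Subdiv δ T ∧
      ∀ δ' ∈ T, ∀ b, ∀ p ∈ cell δ' b, ∀ q ∈ cell δ' b, dist p q ≤ ε := fun δ hδ ↦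
    exists_subdiv_small hε (hS.loop δ hδ)
  choose! T hT hTs using hT
  refine ⟨_, hS.bind hT, fun δ hδ ↦ ?_, fun δ hδ ↦ ?_⟩
  · obtain ⟨δ', hδ', hδ⟩ := mem_iUnion₂.1 hδ
    exact hTs δ' hδ' δ hδ
  · obtain ⟨δ', hδ', hδ⟩ := mem_iUnion₂.1 hδ
    exact ⟨δ', hδ', fun b ↦ (hT δ' hδ').cell_subset (hS.loop δ' hδ') hδ b⟩

/-- Cells of a subdivision that meet in one coordinate meet in the other. -/
lemma Subdiv.adjacent (hS : Subdiv γ S) {δ δ' : Bool → ℝ → ℂ} (hδ : δ ∈ S) (hδ' : δ' ∈ S)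
    {b : Bool} (h : (cell δ b ∩ cell δ' b).Nonempty) :
    (cell δ (!b) ∩ cell δ' (!b)).Nonempty := by
  by_cases hd : δ = δ'
  · subst hd
    exact ⟨_, .inl ⟨0, rfl⟩, .inl ⟨0, rfl⟩⟩
  obtain ⟨x, hx, hx'⟩ := h
  obtain ⟨s, rfl⟩ := hx.resolve_right fun hin ↦
    disjoint_left.1 (hS.disj δ hδ δ' hδ' hd b) hin hx'
  obtain ⟨t, ht⟩ := hx'.resolve_right fun hin ↦
    disjoint_left.1 (hS.disj δ' hδ' δ hδ (Ne.symm hd) b) hin hx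
  exact ⟨_, .inl ⟨s, rfl⟩, .inl ⟨t, (hS.compat δ hδ δ' hδ' b s t ht.symm).symm⟩⟩

lemma exists_homeomorph_of_image {X Y : Type*} [TopologicalSpace X] [TopologicalSpace Y]
    [T2Space Y] {K : Set X} (hK : IsCompact K) {f : X → Y} (hf : Continuous f) (hi : InjOn f K)
    {L : Set Y} (hL : f '' K = L) : Nonempty (K ≃ₜ L) := by
  have := isCompact_iff_compactSpace.1 hK
  subst hL
  exact ⟨(hf.continuousOn.mapsToRestrict (mapsTo_image f K)).homeoOfEquivCompactToT2
    (f := Equiv.Set.imageOfInjOn f K hi)⟩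

/-- The closed regions bounded by two Jordan curves are homeomorphic. -/
theorem nonempty_homeomorph_fill {J J' : Set ℂ} (hJ : IsJordan J) (hJ' : IsJordan J') :
    Nonempty (fill J ≃ₜ fill J') := by
  obtain ⟨γ₀, hγ₀, rfl⟩ := hJ
  obtain ⟨γ₁, hγ₁, rfl⟩ := hJ'
  set γ : Bool → ℝ → ℂ := fun b ↦ cond b γ₁ γ₀ with hγdef
  have hγ : ∀ b, IsLoop (γ b) := by
    rintro (_ | _)
    exacts [hγ₀, hγ₁]
  have hstep : ∀ (n : ℕ) (S : {S // Subdiv γ S}), ∃ S' : {S // Subdiv γ S},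
      (∀ δ ∈ S'.1, ∀ b, ∀ p ∈ cell δ b, ∀ q ∈ cell δ b, dist p q ≤ 1 / ((n : ℝ) + 1)) ∧
      ∀ δ ∈ S'.1, ∃ δ' ∈ S.1, ∀ b, cell δ b ⊆ cell δ' b := by
    rintro n ⟨S, hS⟩
    obtain ⟨S', h1, h2⟩ := hS.exists_refinement (Nat.one_div_pos_of_nat (n := n))
    exact ⟨⟨S', h1⟩, h2⟩
  choose next hnext1 hnext2 using hstep
  let S : ℕ → {S // Subdiv γ S} := fun n ↦ Nat.rec ⟨_, subdiv_singleton hγ⟩ next n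
  let F : ℕ → Set (ℂ × ℂ) := fun n ↦ ⋃ δ ∈ (S n).1, cell δ false ×ˢ cell δ true
  have hSsmall : ∀ n, ∀ δ ∈ (S (n + 1)).1, ∀ b, ∀ p ∈ cell δ b, ∀ q ∈ cell δ b,
      dist p q ≤ 1 / ((n : ℝ) + 1) := fun n ↦ hnext1 n (S n)
  have hcell : ∀ n, ∀ δ ∈ (S n).1, ∀ b, IsCompact (cell δ b) := fun n δ hδ b ↦
    isCompact_fill ((S n).2.loop δ hδ b).isJordan.isCompact
  have hFc : ∀ n, IsCompact (F n) := fun n ↦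
    (S n).2.finite.isCompact_biUnion fun δ hδ ↦ (hcell n δ hδ _).prod (hcell n δ hδ _)
  have hFa : ∀ n, F (n + 1) ⊆ F n := by
    rintro n x hx
    obtain ⟨δ, hδ, hx⟩ := mem_iUnion₂.1 hx
    obtain ⟨δ', hδ', hsub⟩ := hnext2 n (S n) δ hδ
    exact mem_biUnion hδ' ⟨hsub _ hx.1, hsub _ hx.2⟩
  set Φ := ⋂ n, F n with hΦ
  have hΦc : IsCompact Φ :=
    (hFc 0).of_isClosed_subset (isClosed_iInter fun n ↦ (hFc n).isClosed) (iInter_subset _ 0)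
  have hF0 : F 0 = cell γ false ×ˢ cell γ true := by
    change (⋃ δ ∈ ({γ} : Set (Bool → ℝ → ℂ)), cell δ false ×ˢ cell δ true) = _
    simp
  have key : ∀ (b : Bool) (f : Bool → ℂ × ℂ → ℂ), (∀ b, Continuous (f b)) →
      (∀ δ x, x ∈ cell δ false ×ˢ cell δ true ↔ ∀ b, f b x ∈ cell δ b) →
      (∀ x y, x = y ↔ ∀ b, f b x = f b y) → (∀ p : Bool → ℂ, ∃ x, ∀ b, f b x = p b) →
      Nonempty (Φ ≃ₜ cell γ b) := by
    intro b f hf hfmem hfext hfsurj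
    refine exists_homeomorph_of_image hΦc (hf b) ?_ ?_
    · intro x hx y hy hxy
      have hdist : ∀ n : ℕ, dist (f (!b) x) (f (!b) y) ≤ 2 * (1 / ((n : ℝ) + 1)) := by
        intro n
        obtain ⟨δ, hδ, hx⟩ := mem_iUnion₂.1 (mem_iInter.1 hx (n + 1))
        obtain ⟨δ', hδ', hy⟩ := mem_iUnion₂.1 (mem_iInter.1 hy (n + 1))
        rw [hfmem] at hx hy
        obtain ⟨z, hz, hz'⟩ := (S (n + 1)).2.adjacent hδ hδ' (b := b)
          ⟨f b x, hx b, by rw [hxy]; exact hy b⟩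
        have h1 := hSsmall n δ hδ _ _ (hx (!b)) _ hz
        have h2 := hSsmall n δ' hδ' _ _ hz' _ (hy (!b))
        linarith [dist_triangle (f (!b) x) z (f (!b) y)]
      have hlim : Tendsto (fun n : ℕ ↦ 2 * (1 / ((n : ℝ) + 1))) atTop (𝓝 0) := by
        simpa using (tendsto_one_div_add_atTop_nhds_zero_nat (𝕜 := ℝ)).const_mul 2
      have h0 := dist_le_zero.1 (ge_of_tendsto' hlim hdist)
      refine (hfext x y).2 fun c ↦ ?_
      rcases Bool.eq_or_eq_not c b with rfl | rfl
      exacts [hxy, h0]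
    · apply Subset.antisymm
      · rintro _ ⟨x, hx, rfl⟩
        have := mem_iInter.1 hx 0
        rw [hF0, hfmem] at this
        exact this b
      · intro p hp
        have hne : (⋂ n, F n ∩ f b ⁻¹' {p}).Nonempty := by
          refine IsCompact.nonempty_iInter_of_sequence_nonempty_isCompact_isClosed _
            (fun n ↦ inter_subset_inter_left _ (hFa n)) (fun n ↦ ?_)
            ((hFc 0).inter_right (isClosed_singleton.preimage (hf b)))
            fun n ↦ (hFc n).isClosed.inter (isClosed_singleton.preimage (hf b))
          obtain ⟨δ, hδ, hpδ⟩ := mem_iUnion₂.1 ((S n).2.cover b hp)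
          obtain ⟨x, hx⟩ := hfsurj fun c ↦ if c = b then p else δ c 0
          refine ⟨x, mem_biUnion hδ ((hfmem _ _).2 fun c ↦ ?_), by simp [hx]⟩
          rw [hx]
          split_ifs with hc
          · rw [hc]; exact hpδ
          · exact .inl ⟨0, rfl⟩
        obtain ⟨x, hx⟩ := hne
        rw [mem_iInter] at hx
        exact ⟨x, mem_iInter.2 fun n ↦ (hx n).1, (hx 0).2⟩
  have hkey : ∀ b, Nonempty (Φ ≃ₜ cell γ b) := fun b ↦ by
    refine key b (fun c x ↦ cond c x.2 x.1) ?_ ?_ ?_ ?_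
    · rintro (_ | _)
      exacts [continuous_fst, continuous_snd]
    · simp [Bool.forall_bool, mem_prod]
    · simp [Bool.forall_bool, Prod.ext_iff]
    · exact fun p ↦ ⟨(p false, p true), by simp [Bool.forall_bool]⟩
  obtain ⟨e₀⟩ := hkey false
  obtain ⟨e₁⟩ := hkey true
  exact ⟨e₀.symm.trans e₁⟩

end Schoenflies

section CutPairs

variable {K T R : Set ℂ} {a b : ℂ}

/-- In a continuum without cut points in which every pair of points is a cut, the pieces cut out
by a pair are arcs. -/
lemma isArc_of_cutPairs (hK : IsCompact K)
    (h₁ : ∀ T R, IsClosed T → IsClosed R → T ∪ R = K → (T ∩ R).Subsingleton → T = K ∨ R = K)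
    (h₂ : ∀ a ∈ K, ∀ b ∈ K, a ≠ b → ∃ T R, IsClosed T ∧ IsClosed R ∧ T ∪ R = K ∧ T ∩ R = {a, b} ∧
      (T \ {a, b}).Nonempty ∧ (R \ {a, b}).Nonempty)
    (hab : a ≠ b) (hT : IsClosed T) (hR : IsClosed R) (hTR : T ∪ R = K) (hi : T ∩ R = {a, b})
    (hTne : (T \ {a, b}).Nonempty) (hRne : (R \ {a, b}).Nonempty) : IsArc T a b := by
  have hTK : T ⊆ K := hTR ▸ subset_union_left
  have hRK : R ⊆ K := hTR ▸ subset_union_right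
  have haTR : a ∈ T ∩ R := by rw [hi]; simp
  have hbTR : b ∈ T ∩ R := by rw [hi]; simp
  refine isArc_of_cutPoints (hK.of_isClosed_subset hT hTK) ?_ haTR.1 hbTR.1 hab ?_
  · have key : ∀ X Y a b, IsClosed X → IsClosed Y → X ∪ Y = T → Disjoint X Y → T ∩ R = {a, b} →
        a ∈ X → Y ⊆ {b} := by
      intro X Y a b hX hY hXY hd hi ha
      have haY : a ∉ Y := disjoint_left.1 hd ha
      have hYR : Y ∩ R ⊆ {b} := by
        rintro z ⟨hzY, hzR⟩
        have : z ∈ ({a, b} : Set ℂ) := hi ▸ ⟨hXY ▸ .inr hzY, hzR⟩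
        rcases this with rfl | h
        exacts [absurd hzY haY, h]
      rcases h₁ Y (X ∪ R) hY (hX.union hR) (by rw [← union_assoc, union_comm Y, hXY, hTR])
        (subsingleton_singleton.anti (by
          rintro z ⟨hzY, hzX | hzR⟩
          exacts [absurd hzY (disjoint_left.1 hd hzX), hYR ⟨hzY, hzR⟩])) with h | h
      · exact absurd (h.symm ▸ hTK (hXY ▸ .inl ha)) haY
      · intro z hz
        have : z ∈ X ∪ R := h.symm ▸ hTK (hXY ▸ .inr hz)
        exact hYR ⟨hz, this.resolve_left fun h ↦ disjoint_left.1 hd h hz⟩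
    rw [isPreconnected_closed_iff]
    have main : ∀ X Y, IsClosed X → IsClosed Y → X ∪ Y = T → Disjoint X Y → a ∈ X →
        Y.Nonempty → False := by
      intro X Y hX hY hXY hd ha hYne
      have hYb := key X Y a b hX hY hXY hd hi ha
      obtain ⟨z, hz⟩ := hYne
      have hbY : b ∈ Y := hYb hz ▸ hz
      have hXa := key Y X b a hY hX (by rw [union_comm, hXY]) hd.symm (by rw [hi, pair_comm]) hbY
      obtain ⟨w, hw, hwne⟩ := hTne
      rw [← hXY] at hw
      rcases hw with hw | hw
      · exact hwne (.inl (hXa hw))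
      · exact hwne (.inr (hYb hw))
    intro t t' ht ht' hTt hne hne'
    by_contra hemp
    have hd : Disjoint (T ∩ t) (T ∩ t') := disjoint_left.2 fun z hz hz' ↦
      hemp ⟨z, hz.1, hz.2, hz'.2⟩
    have hu : T ∩ t ∪ T ∩ t' = T := by
      rw [← inter_union_distrib_left, inter_eq_left.2 hTt]
    rcases (hu.symm ▸ haTR.1 : a ∈ T ∩ t ∪ T ∩ t') with ha | ha
    · exact main _ _ (hT.inter ht) (hT.inter ht') hu hd ha hne'
    · exact main _ _ (hT.inter ht') (hT.inter ht) (by rw [union_comm, hu]) hd.symm ha hne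
  · intro c hcT hca hcb
    obtain ⟨n, hnR, hn⟩ := hRne
    have hcR : c ∉ R := fun h ↦ by
      have : c ∈ ({a, b} : Set ℂ) := hi ▸ ⟨hcT, h⟩
      rcases this with h | h
      exacts [hca h, hcb h]
    have hnT : n ∉ T := fun h ↦ hn (hi ▸ ⟨h, hnR⟩)
    obtain ⟨P, Q, hP, hQ, hPQ, hPQi, hPne, hQne⟩ := h₂ c (hTK hcT) n (hRK hnR)
      (by rintro rfl; exact hcR hnR)
    have hna : a ≠ n := by rintro rfl; exact hn (.inl rfl)
    have hnb : b ≠ n := by rintro rfl; exact hn (.inr rfl)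
    have haPQ : ¬ (a ∈ P ∧ a ∈ Q) := fun h ↦ by
      have : a ∈ ({c, n} : Set ℂ) := hPQi ▸ h
      rcases this with h | h
      exacts [hca h.symm, hna h]
    have hbPQ : ¬ (b ∈ P ∧ b ∈ Q) := fun h ↦ by
      have : b ∈ ({c, n} : Set ℂ) := hPQi ▸ h
      rcases this with h | h
      exacts [hcb h.symm, hnb h]
    have same : ∀ P Q, IsClosed P → IsClosed Q → P ∪ Q = K → P ∩ Q = {c, n} →
        (Q \ {c, n}).Nonempty → a ∉ Q → b ∉ Q → False := by
      intro P Q hP hQ hPQ hPQi hQne haQ hbQ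
      have piece : ∀ T R c, IsClosed T → IsClosed R → T ∪ R = K → T ∩ R = {a, b} →
          P ∩ Q ∩ T ⊆ {c} → Q ∩ T ⊆ {c} := by
        intro T R c hT hR hTR hi hc
        have hQTR : ∀ z ∈ Q, z ∈ T → z ∉ R := fun z hzQ hzT hzR ↦ by
          have : z ∈ ({a, b} : Set ℂ) := hi ▸ ⟨hzT, hzR⟩
          rcases this with rfl | h
          exacts [haQ hzQ, hbQ ((h : z = b) ▸ hzQ)]
        rcases h₁ (Q ∩ T) (P ∪ Q ∩ R) (hQ.inter hT) (hP.union (hQ.inter hR)) (by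
            rw [union_left_comm, ← inter_union_distrib_left, hTR, ← hPQ,
              inter_eq_left.2 subset_union_right])
          (subsingleton_singleton.anti (by
            rintro z ⟨⟨hzQ, hzT⟩, hzP | ⟨-, hzR⟩⟩
            exacts [hc ⟨⟨hzP, hzQ⟩, hzT⟩, absurd hzR (hQTR z hzQ hzT)])) with h | h
        · have : a ∈ Q ∩ T := by
            rw [h, ← hTR]
            exact .inl (hi.symm.subset (.inl rfl)).1
          exact absurd this.1 haQ
        · rintro z ⟨hzQ, hzT⟩
          have : z ∈ P ∪ Q ∩ R := by
            rw [h, ← hPQ]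
            exact .inr hzQ
          rcases this with hzP | hzR
          exacts [hc ⟨⟨hzP, hzQ⟩, hzT⟩, absurd hzR.2 (hQTR z hzQ hzT)]
      have e1 := piece T R c hT hR hTR hi (by
        rw [hPQi]
        rintro z ⟨h | h, hzT⟩
        exacts [h, absurd hzT ((h : z = n) ▸ hnT)])
      have e2 := piece R T n hR hT (by rw [union_comm, hTR]) (by rw [inter_comm, hi]) (by
        rw [hPQi]
        rintro z ⟨h | h, hzR⟩
        exacts [absurd hzR (h ▸ hcR), h])
      obtain ⟨z, hzQ, hz⟩ := hQne
      have : z ∈ T ∪ R := by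
        rw [hTR, ← hPQ]
        exact .inr hzQ
      rcases this with h | h
      · exact hz (.inl (e1 ⟨hzQ, h⟩))
      · exact hz (.inr (e2 ⟨hzQ, h⟩))
    have hcover : ∀ z ∈ T, z ≠ c → z ∉ P ∨ z ∉ Q := fun z hz hzc ↦ by
      by_contra! h
      have : z ∈ ({c, n} : Set ℂ) := hPQi ▸ h
      rcases this with h | h
      exacts [hzc h, hnT ((h : z = n) ▸ hz)]
    have hor : ∀ z ∈ K, z ∈ P ∨ z ∈ Q := fun z hz ↦ hPQ.symm.subset hz
    by_cases haP : a ∈ P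
    · have haQ : a ∉ Q := fun h ↦ haPQ ⟨haP, h⟩
      by_cases hbQ : b ∈ Q
      · refine ⟨Qᶜ, Pᶜ, hQ.isOpen_compl, hP.isOpen_compl, haQ, fun h ↦ hbPQ ⟨h, hbQ⟩,
          fun z hz ↦ (hcover z hz.1 hz.2).symm, fun z hz _ hzQ hzP ↦ ?_⟩
        exact (hor z (hTK hz)).elim hzP hzQ
      · exact (same P Q hP hQ hPQ hPQi hQne haQ hbQ).elim
    · by_cases hbP : b ∈ P
      · have hbQ : b ∉ Q := fun h ↦ hbPQ ⟨hbP, h⟩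
        refine ⟨Pᶜ, Qᶜ, hP.isOpen_compl, hQ.isOpen_compl, haP, hbQ,
          fun z hz ↦ hcover z hz.1 hz.2, fun z hz _ hzP hzQ ↦ ?_⟩
        exact (hor z (hTK hz)).elim hzP hzQ
      · exact (same Q P hQ hP (by rw [union_comm, hPQ]) (by rw [inter_comm, hPQi]) hPne haP
          hbP).elim

lemma isJordan_of_cutPairs (hK : IsCompact K)
    (h₁ : ∀ T R, IsClosed T → IsClosed R → T ∪ R = K → (T ∩ R).Subsingleton → T = K ∨ R = K)
    (h₂ : ∀ a ∈ K, ∀ b ∈ K, a ≠ b → ∃ T R, IsClosed T ∧ IsClosed R ∧ T ∪ R = K ∧ T ∩ R = {a, b} ∧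
      (T \ {a, b}).Nonempty ∧ (R \ {a, b}).Nonempty)
    (hne : K.Nontrivial) : IsJordan K := by
  obtain ⟨a, ha, b, hb, hab⟩ := hne
  obtain ⟨T, R, hT, hR, hTR, hi, hTne, hRne⟩ := h₂ a ha b hb hab
  have e1 := isArc_of_cutPairs hK h₁ h₂ hab hT hR hTR hi hTne hRne
  have e2 := isArc_of_cutPairs hK h₁ h₂ hab hR hT (by rw [union_comm, hTR])
    (by rw [inter_comm, hi]) hRne hTne
  have hJ := e1.isJordan_union e2 hi.subset
  rwa [hTR] at hJ

end CutPairs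

section Moore

variable {U V K : Set ℂ}

lemma mem_closure_of_joinedIn {x p : ℂ} (hU : IsOpen U) (hp : p ∈ U)
    (h : JoinedIn (insert x U) p x) : x ∈ closure U := by
  by_contra hx
  obtain ⟨γ, hγ⟩ := h
  obtain ⟨z, -, hz, hz'⟩ := (isPreconnected_range γ.continuous) U (closure U)ᶜ hU
    isClosed_closure.isOpen_compl (by
      rintro _ ⟨t, rfl⟩
      rcases hγ t with h | h
      exacts [.inr (by rwa [h]), .inl h])
    ⟨p, ⟨0, by simp⟩, hp⟩ ⟨x, ⟨1, by simp⟩, hx⟩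
  exact hz' (subset_closure hz)

lemma joinedIn_pair {x y p q : ℂ} (hU : IsOpen U) (hUc : IsPreconnected U) (hp : p ∈ U)
    (hq : q ∈ U) (hx : JoinedIn (insert x U) p x) (hy : JoinedIn (insert y U) q y) :
    JoinedIn (U ∪ {x, y}) x y := by
  have hpq : JoinedIn U p q :=
    (hU.isConnected_iff_isPathConnected.1 ⟨⟨p, hp⟩, hUc⟩).joinedIn p hp q hq
  refine (hx.mono ?_).symm.trans ((hpq.mono subset_union_left).trans (hy.mono ?_)) <;>
    rw [insert_subset_iff] <;> exact ⟨by simp, subset_union_left⟩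

/-- A compact set all of whose points are accessible from both of two disjoint domains
that make up its complement is a Jordan curve. -/
theorem isJordan_of_joinedIn (hK : IsCompact K) (hU : IsOpen U) (hV : IsOpen V)
    (hUc : IsConnected U) (hVc : IsConnected V) (hUV : Disjoint U V) (hcompl : Kᶜ = U ∪ V)
    (haU : ∀ x ∈ K, ∃ p ∈ U, JoinedIn (insert x U) p x)
    (haV : ∀ x ∈ K, ∃ p ∈ V, JoinedIn (insert x V) p x) : IsJordan K := by
  have hUK : ∀ z ∈ U, z ∉ K := fun z hz ↦ hcompl.symm.subset (.inl hz)
  have hVK : ∀ z ∈ V, z ∉ K := fun z hz ↦ hcompl.symm.subset (.inr hz)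
  obtain ⟨p, hp⟩ := hUc.nonempty
  obtain ⟨q, hq⟩ := hVc.nonempty
  have hmeet : ∀ C, IsPreconnected C → (C ∩ U).Nonempty → (C ∩ V).Nonempty →
      (C ∩ K).Nonempty := by
    intro C hC h1 h2
    by_contra hemp
    obtain ⟨z, -, hz⟩ := hC U V hU hV (by
      rw [← hcompl]
      exact fun z hz hzK ↦ hemp ⟨z, hz, hzK⟩) h1 h2
    exact disjoint_left.1 hUV hz.1 hz.2
  have hsep : ¬ Unsep K p q := by
    rintro ⟨C, hC, hpC, hqC, hd⟩
    obtain ⟨z, hz, hzK⟩ := hmeet C hC ⟨p, hpC, hp⟩ ⟨q, hqC, hq⟩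
    exact disjoint_left.1 hd hz hzK
  have hpart : ∀ L ⊆ K, L ≠ K → Unsep L p q := by
    intro L hL hne
    obtain ⟨x, hxK, hxL⟩ := exists_of_ssubset (hL.ssubset_of_ne hne)
    obtain ⟨p', hp', hx⟩ := haU x hxK
    obtain ⟨q', hq', hx'⟩ := haV x hxK
    have h1 : IsPreconnected (insert x U) := hUc.isPreconnected.subset_closure
      (subset_insert _ _)
      (insert_subset (mem_closure_of_joinedIn hU hp' hx) subset_closure)
    have h2 : IsPreconnected (insert x V) := hVc.isPreconnected.subset_closure
      (subset_insert _ _)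
      (insert_subset (mem_closure_of_joinedIn hV hq' hx') subset_closure)
    refine ⟨insert x U ∪ insert x V, h1.union x (by simp) (by simp) h2, .inl (.inr hp),
      .inr (.inr hq), disjoint_left.2 ?_⟩
    rintro z ((rfl | hz) | (rfl | hz)) hzL
    exacts [hxL hzL, hUK z hz (hL hzL), hxL hzL, hVK z hz (hL hzL)]
  refine isJordan_of_cutPairs hK ?_ ?_ ?_
  · intro T R hT hR hTR hsub
    by_contra! hne
    have hTK : T ⊆ K := hTR ▸ subset_union_left
    have hRK : R ⊆ K := hTR ▸ subset_union_right
    refine hsep ?_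
    rw [← hTR]
    exact Unsep.union (hK.of_isClosed_subset hT hTK) (hK.of_isClosed_subset hR hRK)
      hsub.isPreconnected (hpart T hTK hne.1) (hpart R hRK hne.2)
  · intro a ha b hb hab
    obtain ⟨p₁, hp₁, h1⟩ := haU a ha
    obtain ⟨p₂, hp₂, h2⟩ := haU b hb
    obtain ⟨q₁, hq₁, h3⟩ := haV a ha
    obtain ⟨q₂, hq₂, h4⟩ := haV b hb
    obtain ⟨A, hAs, hA⟩ := (joinedIn_pair hU hUc.isPreconnected hp₁ hp₂ h1 h2).exists_isArc hab
    obtain ⟨B, hBs, hB⟩ := (joinedIn_pair hV hVc.isPreconnected hq₁ hq₂ h3 h4).exists_isArc hab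
    have hABi : A ∩ B ⊆ {a, b} := by
      rintro z ⟨hzA, hzB⟩
      rcases hAs hzA with hz | hz
      · rcases hBs hzB with hz' | hz'
        exacts [absurd hz' (disjoint_left.1 hUV hz), hz']
      · exact hz
    have hC := hA.isJordan_union hB hABi
    have hCK : ∀ z ∈ K, z ∈ A ∪ B → z ∈ ({a, b} : Set ℂ) := by
      rintro z hzK (hz | hz)
      · exact (hAs hz).resolve_left fun h ↦ hUK z h hzK
      · exact (hBs hz).resolve_left fun h ↦ hVK z h hzK
    have habC : ∀ z ∈ ({a, b} : Set ℂ), z ∈ K ∧ z ∈ A ∪ B := by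
      rintro z (rfl | rfl)
      exacts [⟨ha, .inl hA.left_mem⟩, ⟨hb, .inl hA.right_mem⟩]
    obtain ⟨x, hxA, hx⟩ := hA.interior_nonempty
    obtain ⟨y, hyB, hy⟩ := hB.interior_nonempty
    have hxU := (hAs hxA).resolve_right hx
    have hyV := (hBs hyB).resolve_right hy
    have hmeet' : ∀ W, IsPreconnected W → A ∪ B ⊆ closure W → (W ∩ K).Nonempty := by
      intro W hW hcl
      refine hmeet W hW ?_ ?_
      · rw [inter_comm]
        exact mem_closure_iff.1 (hcl (.inl hxA)) U hU hxU
      · rw [inter_comm]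
        exact mem_closure_iff.1 (hcl (.inr hyB)) V hV hyV
    obtain ⟨m, hmi, hmK⟩ := hmeet' _ hC.isConnected_inside.isPreconnected hC.subset_closure_inside
    obtain ⟨n, hno, hnK⟩ := hmeet' _ (isConnected_outside hC.isCompact).isPreconnected
      hC.subset_closure_outside
    refine ⟨K \ outside (A ∪ B), K \ inside (A ∪ B),
      hK.isClosed.sdiff (isOpen_outside hC.isCompact.isClosed),
      hK.isClosed.sdiff (isOpen_inside hC.isCompact.isClosed), ?_, ?_,
      ⟨m, ⟨hmK, disjoint_left.1 disjoint_inside_outside hmi⟩, fun h ↦ hmi.1 (habC m h).2⟩,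
      ⟨n, ⟨hnK, disjoint_right.1 disjoint_inside_outside hno⟩, fun h ↦ hno.1 (habC n h).2⟩⟩
    · rw [← sdiff_inter, inter_comm, disjoint_inside_outside.inter_eq, sdiff_empty]
    · ext z
      constructor
      · rintro ⟨⟨hzK, hzo⟩, -, hzi⟩
        refine hCK z hzK ?_
        by_contra hz
        exact (mem_inside_or_outside hz).elim hzi hzo
      · intro hz
        obtain ⟨hzK, hzC⟩ := habC z hz
        exact ⟨⟨hzK, fun h ↦ h.1 hzC⟩, hzK, fun h ↦ h.1 hzC⟩
  · rw [← not_subsingleton_iff]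
    intro hsub
    refine hsep ?_
    rcases hsub.eq_empty_or_singleton with rfl | ⟨x, rfl⟩
    · exact ⟨univ, isPreconnected_univ, trivial, trivial, by simp⟩
    · have := unsep_image (convex_singleton (0 : ℝ)) isCompact_singleton (φ := fun _ ↦ x)
        continuousOn_const (by simp) (p := p) (q := q)
      rw [image_singleton] at this
      exact this (hUK p hp) (hVK q hq)

end Moore

section Disk

variable {J D : Set ℂ}

lemma compl_fill : (fill J)ᶜ = outside J := by rw [fill_eq_compl, compl_compl]

lemma IsJordan.interior_fill (hJ : IsJordan J) : interior (fill J) = inside J := by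
  refine Subset.antisymm (fun z hz ↦ ?_)
    (interior_maximal inside_subset_fill (isOpen_inside hJ.isCompact.isClosed))
  refine (interior_subset hz).resolve_left fun hzJ ↦ ?_
  obtain ⟨w, hw, hw'⟩ :=
    mem_closure_iff.1 (hJ.subset_closure_outside hzJ) _ isOpen_interior hz
  exact disjoint_left.1 disjoint_outside_fill hw' (interior_subset hw)

lemma IsJordan.frontier_fill (hJ : IsJordan J) : frontier (fill J) = J := by
  rw [(isCompact_fill hJ.isCompact).isClosed.frontier_eq, hJ.interior_fill, fill,
    union_sdiff_right, sdiff_eq_left]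
  exact disjoint_inside.symm

lemma isJordan_image_sphere {f : ℂ → ℂ} (hf : ContinuousOn f (sphere 0 1))
    (hi : InjOn f (sphere 0 1)) : IsJordan (f '' sphere 0 1) := by
  have hmem : ∀ t : ℝ, Complex.exp (2 * Real.pi * t * Complex.I) ∈ sphere (0 : ℂ) 1 := fun t ↦ by
    rw [mem_sphere_zero_iff_norm]
    exact_mod_cast Complex.norm_exp_ofReal_mul_I (2 * Real.pi * t)
  refine ⟨fun t ↦ f (Complex.exp (2 * Real.pi * t * Complex.I)), ⟨?_, fun s t ↦ ?_⟩, ?_⟩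
  · exact hf.comp_continuous (by fun_prop) hmem
  · rw [hi.eq_iff (hmem s) (hmem t), Complex.exp_eq_exp_iff_exists_int]
    refine exists_congr fun n ↦ ?_
    have h : (2 * Real.pi * t * Complex.I + n * (2 * Real.pi * Complex.I) : ℂ)
        = (2 * Real.pi * Complex.I) * (t + n) := by ring
    have h' : (2 * Real.pi * s * Complex.I : ℂ) = (2 * Real.pi * Complex.I) * s := by ring
    rw [h, h', mul_right_inj' Complex.two_pi_I_ne_zero]
    exact_mod_cast Iff.rfl
  · ext z
    constructor
    · rintro ⟨t, rfl⟩
      exact mem_image_of_mem f (hmem t)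
    · rintro ⟨w, hw, rfl⟩
      refine ⟨w.arg / (2 * Real.pi), congrArg f ?_⟩
      have h : (2 * Real.pi * ((w.arg / (2 * Real.pi) : ℝ) : ℂ) * Complex.I : ℂ)
          = w.arg * Complex.I := by
        push_cast
        have : (Real.pi : ℂ) ≠ 0 := by exact_mod_cast Real.pi_ne_zero
        field_simp
      rw [h]
      have := Complex.norm_mul_exp_arg_mul_I w
      rwa [mem_sphere_zero_iff_norm.1 hw, Complex.ofReal_one, one_mul] at this

lemma isJordan_sphere : IsJordan (sphere (0 : ℂ) 1) := by
  simpa using isJordan_image_sphere (f := id) continuousOn_id (injOn_id _)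

lemma fill_sphere : fill (sphere (0 : ℂ) 1) = closedBall 0 1 := by
  refine isJordan_sphere.fill_eq (isCompact_closedBall 0 1) ?_ ?_
    (frontier_closedBall 0 one_ne_zero)
  · rw [interior_closedBall 0 one_ne_zero]
    exact (convex_ball 0 1).isPreconnected
  · convert isPreconnected_lt_norm one_pos using 1
    ext z
    simp

/-- A topological disk in the plane is the filled-in boundary of a Jordan curve. -/
lemma exists_isJordan_fill_eq (e : closedBall (0 : ℂ) 1 ≃ₜ D) :
    ∃ J, IsJordan J ∧ fill J = D := by
  classical
  set f : ℂ → ℂ := fun z ↦ if h : z ∈ closedBall 0 1 then e ⟨z, h⟩ else 0 with hfdef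
  have hfe : ∀ z (h : z ∈ closedBall 0 1), f z = e ⟨z, h⟩ := fun z h ↦ by simp only [hfdef, dif_pos h]
  have hf : ContinuousOn f (closedBall 0 1) := by
    rw [continuousOn_iff_continuous_domRestrict]
    convert continuous_subtype_val.comp e.continuous using 1
    ext z : 1
    exact hfe z z.2
  have hi : InjOn f (closedBall 0 1) := fun z hz w hw h ↦ by
    rw [hfe z hz, hfe w hw] at h
    simpa using e.injective (Subtype.ext h)
  have him : f '' closedBall 0 1 = D := by
    ext z
    constructor
    · rintro ⟨w, hw, rfl⟩
      rw [hfe w hw]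
      exact (e ⟨w, hw⟩).2
    · intro hz
      refine ⟨e.symm ⟨z, hz⟩, (e.symm ⟨z, hz⟩).2, ?_⟩
      rw [hfe _ (e.symm ⟨z, hz⟩).2]
      simp
  have hD : IsCompact D := him ▸ (isCompact_closedBall 0 1).image_of_continuousOn hf
  have hJ := isJordan_image_sphere (hf.mono sphere_subset_closedBall)
    (hi.mono sphere_subset_closedBall)
  refine ⟨_, hJ, ?_⟩
  have hJD : f '' sphere 0 1 ⊆ D := by
    rw [← him]
    exact image_mono sphere_subset_closedBall
  have hDJ : D \ f '' sphere 0 1 = f '' ball 0 1 := by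
    rw [← him, ← hi.image_sdiff_subset sphere_subset_closedBall, closedBall_sdiff_sphere]
  have hu : ∀ p ∈ Dᶜ, ∀ q ∈ Dᶜ, Unsep D p q := fun p hp q hq ↦ by
    rw [← him] at hp hq ⊢
    exact unsep_image (convex_closedBall 0 1) (isCompact_closedBall 0 1) hf hi hp hq
  have hout : Dᶜ ⊆ outside (f '' sphere 0 1) := by
    refine subset_outside_of_isPreconnected
      (isPreconnected_of_unsep hu fun _ _ _ h ↦ h.right_notMem) (fun hb ↦ ?_)
      (disjoint_compl_left.mono_right hJD)
    have := hb.union hD.isBounded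
    rw [compl_union_self] at this
    exact NormedSpace.unbounded_univ ℝ ℂ this
  have hin : inside (f '' sphere 0 1) ⊆ D \ f '' sphere 0 1 := fun z hz ↦
    ⟨by_contra fun h ↦ disjoint_left.1 disjoint_inside_outside hz (hout h), hz.1⟩
  have hin' : D \ f '' sphere 0 1 ⊆ inside (f '' sphere 0 1) := by
    obtain ⟨p, hp⟩ := hJ.inside_nonempty
    refine fun q hq ↦ Unsep.mem_inside (unsep_of_isPreconnected ?_ disjoint_sdiff_left
      (hin hp) hq) hp
    rw [hDJ]
    exact (convex_ball 0 1).isPreconnected.image _ (hf.mono ball_subset_closedBall)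
  rw [fill, hin.antisymm hin', union_sdiff_cancel hJD]

theorem nonempty_homeomorph_closedBall_iff :
    Nonempty (D ≃ₜ closedBall (0 : ℂ) 1) ↔ ∃ J, IsJordan J ∧ fill J = D := by
  refine ⟨fun ⟨e⟩ ↦ exists_isJordan_fill_eq e.symm, ?_⟩
  rintro ⟨J, hJ, rfl⟩
  rw [← fill_sphere]
  exact nonempty_homeomorph_fill hJ isJordan_sphere

lemma IsJordan.joinedIn_insert {U : Set ℂ} {x : ℂ} (hJ : IsJordan J) (hx : x ∈ J)
    (hUJ : Disjoint U J) (hU : U.Nonempty) (hUu : ∀ p ∈ U, ∀ q, Unsep J p q → q ∈ U) :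
    ∃ p ∈ U, JoinedIn (insert x U) p x := by
  obtain ⟨p, hp⟩ := hU
  have hpJ := disjoint_left.1 hUJ hp
  exact ⟨p, hp, (hJ.joinedIn_component hx hpJ).mono
    (insert_subset_insert fun q hq ↦ hUu p hp q (unsep_iff.2 ⟨hpJ, hq⟩))⟩

/-- Schoenflies' characterization of closed topological disks in the plane. -/
theorem nonempty_homeomorph_closedBall_iff_joinedIn (hD : IsCompact D) :
    Nonempty (D ≃ₜ closedBall (0 : ℂ) 1) ↔ IsConnected (interior D) ∧ IsConnected Dᶜ ∧
      (∀ x ∈ frontier D, ∃ p ∈ interior D, JoinedIn (insert x (interior D)) p x) ∧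
      ∀ x ∈ frontier D, ∃ p ∈ Dᶜ, JoinedIn (insert x Dᶜ) p x := by
  rw [nonempty_homeomorph_closedBall_iff]
  constructor
  · rintro ⟨J, hJ, rfl⟩
    rw [hJ.interior_fill, hJ.frontier_fill, compl_fill]
    exact ⟨hJ.isConnected_inside, isConnected_outside hJ.isCompact,
      fun x hx ↦ hJ.joinedIn_insert hx disjoint_inside hJ.inside_nonempty
        fun _ hp _ h ↦ h.mem_inside hp,
      fun x hx ↦ hJ.joinedIn_insert hx disjoint_outside (outside_nonempty hJ.isCompact)
        fun _ hp _ h ↦ h.mem_outside hp⟩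
  · rintro ⟨hi, ho, hai, hao⟩
    have hJ : IsJordan (frontier D) := isJordan_of_joinedIn
      (hD.of_isClosed_subset isClosed_frontier hD.isClosed.frontier_subset) isOpen_interior
      hD.isClosed.isOpen_compl hi ho (disjoint_compl_right.mono_left interior_subset)
      (by rw [compl_frontier_eq_union_interior, interior_compl, hD.isClosed.closure_eq]) hai hao
    exact ⟨_, hJ, hJ.fill_eq hD hi.isPreconnected ho.isPreconnected rfl⟩

end Disk

lemma accessible_iff_joinedIn (e : ℂ ≃ₜ Plane) {E : Set Plane} {x : ℂ} (hx : e x ∉ E) :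
    Accessible E (e x) ↔ ∃ p ∈ e ⁻¹' E, JoinedIn (insert x (e ⁻¹' E)) p x := by
  constructor
  · rintro ⟨φ, hc, -, h1, hE⟩
    have h0 : φ 0 ∈ E := hE ⟨0, by simp, rfl⟩
    refine ⟨e.symm (φ 0), by simpa using h0, JoinedIn.ofLine (f := e.symm ∘ φ)
      (e.symm.continuous.comp_continuousOn hc) rfl (by simp [h1]) ?_⟩
    rintro _ ⟨t, ht, rfl⟩
    rcases ht.2.eq_or_lt with rfl | h
    · simp [h1]
    · exact .inr (by simpa using hE ⟨t, ⟨ht.1, h⟩, rfl⟩)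
  · rintro ⟨p, hp, hj⟩
    obtain ⟨A, hA, φ, hc, hi, -, h1, rfl⟩ := hj.exists_isArc (by rintro rfl; exact hx hp)
    refine ⟨e ∘ φ, e.continuous.comp_continuousOn hc, e.injective.comp_injOn hi,
      congrArg e h1, ?_⟩
    rintro _ ⟨t, ht, rfl⟩
    refine (hA ⟨t, Ico_subset_Icc_self ht, rfl⟩).resolve_left fun h ↦ ht.2.ne ?_
    exact hi (Ico_subset_Icc_self ht) (by simp) (h.trans h1.symm)

end PlaneTopology

theorem stmt_3 (D : Set Plane) (hcomp : IsCompact D) (hint : (interior D).Nonempty) :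
    Nonempty (D ≃ₜ (closedBall (0 : Plane) 1)) ↔
      (IsConnected (interior D) ∧ IsConnected (Dᶜ : Set Plane) ∧
        (∀ x ∈ frontier D, Accessible (interior D) x) ∧
        (∀ x ∈ frontier D, Accessible (Dᶜ) x)) := by
  let L : ℂ ≃ₗᵢ[ℝ] Plane := Complex.orthonormalBasisOneI.repr
  let e : ℂ ≃ₜ Plane := L.toHomeomorph
  have hball : e ⁻¹' closedBall 0 1 = closedBall 0 1 := by
    ext z
    simp [e]
  have hfr : ∀ E : Set Plane, (∀ x ∈ frontier D, x ∉ E) →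
      ((∀ x ∈ frontier D, Accessible E x) ↔ ∀ x ∈ frontier (e ⁻¹' D),
        ∃ p ∈ e ⁻¹' E, JoinedIn (insert x (e ⁻¹' E)) p x) := by
    intro E hE
    rw [← e.preimage_frontier, e.surjective.forall]
    exact forall₂_congr fun x hx ↦ PlaneTopology.accessible_iff_joinedIn e (hE _ hx)
  have hset : ∀ S : Set Plane, Nonempty (e ⁻¹' S ≃ₜ S) := fun S ↦ ⟨e.sets rfl⟩
  obtain ⟨a⟩ := hset D
  obtain ⟨b⟩ := hset (closedBall 0 1)
  have hdisk : Nonempty (D ≃ₜ closedBall (0 : Plane) 1) ↔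
      Nonempty (e ⁻¹' D ≃ₜ e ⁻¹' closedBall 0 1) :=
    ⟨fun ⟨c⟩ ↦ ⟨a.trans (c.trans b.symm)⟩, fun ⟨c⟩ ↦ ⟨a.symm.trans (c.trans b)⟩⟩
  rw [hdisk, hball, PlaneTopology.nonempty_homeomorph_closedBall_iff_joinedIn
    (e.isCompact_preimage.2 hcomp), hfr (interior D) fun x hx ↦ hx.2,
    hfr Dᶜ fun x hx h ↦ h (hcomp.isClosed.frontier_subset hx), ← preimage_compl,
    ← e.preimage_interior, e.isConnected_preimage, e.isConnected_preimage]
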